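/- Let d ≥ 2 and let w be a doubling weight on S^{d-1}. For each positive integer n let N_n(w dσ_d) denote the minimal integer N for which there exist N distinct points z_1, …, z_N ∈ S^{d-1} with (1/w(S^{d-1})) ∫_{S^{d-1}} f(x) w(x) dσ_d(x) = (1/N) · Σ_{j=1}^N f(z_j) for all f ∈ Π_n^d. Then there exist constants 0 < c ≤ C, depending only on d and the doubling constant of w, such that for every positive integer n: c · max_{x ∈ S^{d-1}} w(S^{d-1})/w(B(x, 1/n)) ≤ N_n(w dσ_d) ≤ C · max_{x ∈ S^{d-1}} w(S^{d-1})/w(B(x, 1/n)). -/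

import Mathlib

open MeasureTheory Real Set
open scoped InnerProductSpace

noncomputable section

variable {d : ℕ}

/-- The unit sphere `S^{d-1}` of `ℝ^d`. -/
def unitSphere (d : ℕ) : Set (EuclideanSpace ℝ (Fin d)) :=
  Metric.sphere (0 : EuclideanSpace ℝ (Fin d)) 1

/-- The geodesic distance `dist(x,y) = arccos (x ⬝ y)`. -/
def gdist (x y : EuclideanSpace ℝ (Fin d)) : ℝ := Real.arccos ⟪x, y⟫_ℝ

/-- The spherical cap with center `x` and radius `r`. -/
def cap (x : EuclideanSpace ℝ (Fin d)) (r : ℝ) : Set (EuclideanSpace ℝ (Fin d)) :=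
  {y ∈ unitSphere d | gdist x y ≤ r}

/-- The surface Lebesgue measure on the unit sphere, realized as the
`(d-1)`-dimensional Hausdorff measure restricted to the sphere. -/
def sphMeasure (d : ℕ) : Measure (EuclideanSpace ℝ (Fin d)) :=
  (Measure.hausdorffMeasure ((d : ℝ) - 1)).restrict (unitSphere d)

/-- `w(A) = ∫_A w dσ_d`. -/
def wMass (w : EuclideanSpace ℝ (Fin d) → ℝ) (A : Set (EuclideanSpace ℝ (Fin d))) : ℝ :=
  ∫ x in A, w x ∂(sphMeasure d)

/-- Evaluation of a `d`-variate real polynomial at a point of `ℝ^d`. -/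
def pEval (P : MvPolynomial (Fin d) ℝ) (x : EuclideanSpace ℝ (Fin d)) : ℝ :=
  MvPolynomial.eval (fun i => x i) P

/-- The geodesic arc joining `x` and `y`. -/
def arcSeg (x y : EuclideanSpace ℝ (Fin d)) : Set (EuclideanSpace ℝ (Fin d)) :=
  {z ∈ unitSphere d | ∃ t₁ t₂ : ℝ, 0 ≤ t₁ ∧ 0 ≤ t₂ ∧ z = t₁ • x + t₂ • y}

/-- Geodesic convexity of a subset of the sphere. -/
def GeoConvex (A : Set (EuclideanSpace ℝ (Fin d))) : Prop :=
  ∀ x ∈ A, ∀ y ∈ A, arcSeg x y ⊆ A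

/-- The interior of a subset of the sphere relative to the sphere. -/
def sphInterior (A : Set (EuclideanSpace ℝ (Fin d))) : Set (EuclideanSpace ℝ (Fin d)) :=
  {x ∈ A | ∃ ε : ℝ, 0 < ε ∧ Metric.ball x ε ∩ unitSphere d ⊆ A}

/-- The geodesic simplex spanned by `ξ 0, …, ξ (d-1)`. -/
def geodSimplex (ξ : Fin d → EuclideanSpace ℝ (Fin d)) :
    Set (EuclideanSpace ℝ (Fin d)) :=
  {z | ∃ t : Fin d → ℝ, (∀ j, 0 ≤ t j) ∧ (∑ j, t j) = 1 ∧
    z = ‖∑ j, t j • ξ j‖⁻¹ • ∑ j, t j • ξ j}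

/-- An admissible family `ξ 0, …, ξ (d-1)` of points of the sphere (the indices
`0, 1, …, d-1` correspond to `ξ_1, ξ_2, …, ξ_d` in the paper). -/
def Admissible (ξ : Fin d → EuclideanSpace ℝ (Fin d)) : Prop :=
  LinearIndependent ℝ ξ ∧ (∀ j, ξ j ∈ unitSphere d) ∧
  (∀ i j : Fin d, 1 ≤ (i : ℕ) → 1 ≤ (j : ℕ) → i ≠ j → ⟪ξ i, ξ j⟫_ℝ = 0) ∧
  (∀ i j : Fin d, (i : ℕ) = 0 → (j : ℕ) = 1 →
    Real.arccos ⟪ξ i, ξ j⟫_ℝ ∈ Set.Icc (π / 6) (π / 2)) ∧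
  (∀ i j : Fin d, (i : ℕ) = 0 → 2 ≤ (j : ℕ) → ⟪ξ i, ξ j⟫_ℝ = 0)

/-- A strongly `ε`-separated family of points of the sphere. -/
def StronglySep (ε : ℝ) (η : Fin d → EuclideanSpace ℝ (Fin d)) : Prop :=
  Function.Injective η ∧ (∀ j, η j ∈ unitSphere d) ∧
  ∀ j : Fin d, ∀ y ∈ Submodule.span ℝ (η '' {i | i ≠ j}), ε ≤ ‖η j - y‖

/-- The reflection negating the last coordinate. -/
def lastNeg (d : ℕ) (x : EuclideanSpace ℝ (Fin d)) : EuclideanSpace ℝ (Fin d) :=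
  (EuclideanSpace.equiv (Fin d) ℝ).symm fun i => if (i : ℕ) = d - 1 then -(x i) else x i

/-- The gradient of a `d`-variate polynomial, as a vector of `ℝ^d`. -/
def polyGrad (P : MvPolynomial (Fin d) ℝ) (x : EuclideanSpace ℝ (Fin d)) :
    EuclideanSpace ℝ (Fin d) :=
  (EuclideanSpace.equiv (Fin d) ℝ).symm fun i =>
    MvPolynomial.eval (fun j => x j) (MvPolynomial.pderiv i P)

/-- The tangential gradient `∇₀P(x) = ∇P(x) − (x⬝∇P(x))·x`. -/
def tGrad (P : MvPolynomial (Fin d) ℝ) (x : EuclideanSpace ℝ (Fin d)) :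
    EuclideanSpace ℝ (Fin d) :=
  polyGrad P x - ⟪x, polyGrad P x⟫_ℝ • x

/-- The affine hyperplane through the points `ξ j`. -/
def hplane (ξ : Fin d → EuclideanSpace ℝ (Fin d)) : Set (EuclideanSpace ℝ (Fin d)) :=
  (affineSpan ℝ (Set.range ξ) : Set (EuclideanSpace ℝ (Fin d)))

/-- The ball `B(x,r)_H = {y ∈ H : ‖x − y‖ ≤ r}` in a hyperplane `H`. -/
def ballH (H : Set (EuclideanSpace ℝ (Fin d))) (x : EuclideanSpace ℝ (Fin d)) (r : ℝ) :
    Set (EuclideanSpace ℝ (Fin d)) :=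
  {y ∈ H | ‖x - y‖ ≤ r}

/-- `w(A) = ∫_A w` with respect to `(d−1)`-dimensional Hausdorff (surface) measure. -/
def hMass (w : EuclideanSpace ℝ (Fin d) → ℝ) (A : Set (EuclideanSpace ℝ (Fin d))) : ℝ :=
  ∫ x in A, w x ∂(Measure.hausdorffMeasure ((d : ℝ) - 1))

/-- The interior of `A` relative to a hyperplane `H`. -/
def hInterior (H A : Set (EuclideanSpace ℝ (Fin d))) : Set (EuclideanSpace ℝ (Fin d)) :=
  {x ∈ A | ∃ ε : ℝ, 0 < ε ∧ Metric.ball x ε ∩ H ⊆ A}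

/-- The minimal number of nodes of a strict Chebyshev-type cubature formula of
degree `n` for the measure `w dσ_d` on the sphere. -/
def minCubNodes (d : ℕ) (w : EuclideanSpace ℝ (Fin d) → ℝ) (n : ℕ) : ℕ :=
  sInf {N : ℕ | 0 < N ∧ ∃ Z : Finset (EuclideanSpace ℝ (Fin d)), Z.card = N ∧
    (↑Z : Set (EuclideanSpace ℝ (Fin d))) ⊆ unitSphere d ∧
    ∀ P : MvPolynomial (Fin d) ℝ, P.totalDegree ≤ n →
      (1 / wMass w (unitSphere d)) * (∫ x, pEval P x * w x ∂(sphMeasure d))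
        = (1 / (N : ℝ)) * ∑ z ∈ Z, pEval P z}

section Brouwer

open scoped NNReal

lemma lipschitzWith_indicator_closedBall {V : Type*} [NormedAddCommGroup V] [NormedSpace ℝ V]
    {φ : V → V} {R : ℝ} {K : ℝ≥0}
    (hφ : LipschitzOnWith K φ (Metric.closedBall (0 : V) R)) (h0 : ∀ x, ‖x‖ = R → φ x = 0) :
    LipschitzWith K ((Metric.closedBall (0 : V) R).indicator φ) := by
  have key : ∀ x ∈ Metric.closedBall (0 : V) R, ∀ y ∉ Metric.closedBall (0 : V) R,
      dist (φ x) 0 ≤ K * dist x y := by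
    intro x hx y hy
    have hx' := mem_closedBall_zero_iff.1 hx
    have hy' : R < ‖y‖ := by simpa using hy
    obtain ⟨t, ht, hz⟩ := intermediate_value_Icc (f := fun t : ℝ => ‖AffineMap.lineMap x y t‖)
      zero_le_one (by fun_prop : Continuous _).continuousOn
      (show R ∈ Icc _ _ by simpa using ⟨hx', hy'.le⟩)
    have hzb : AffineMap.lineMap x y t ∈ Metric.closedBall (0 : V) R := by
      rw [mem_closedBall_zero_iff]; exact hz.le
    have := hφ.dist_le_mul x hx _ hzb
    rw [h0 _ hz] at this
    refine this.trans (mul_le_mul_of_nonneg_left ?_ K.2)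
    rw [dist_left_lineMap, Real.norm_of_nonneg ht.1]
    nlinarith [dist_nonneg (x := x) (y := y), ht.2]
  refine LipschitzWith.of_dist_le_mul fun x y => ?_
  by_cases hx : x ∈ Metric.closedBall (0 : V) R <;> by_cases hy : y ∈ Metric.closedBall (0 : V) R
  · simpa [hx, hy] using hφ.dist_le_mul x hx y hy
  · rw [indicator_of_mem hx, indicator_of_notMem hy]
    exact key x hx y hy
  · rw [indicator_of_notMem hx, indicator_of_mem hy, dist_comm, dist_comm x]
    exact key y hy x hx
  · rw [indicator_of_notMem hx, indicator_of_notMem hy, dist_self]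
    positivity

variable {V : Type*} [NormedAddCommGroup V] [InnerProductSpace ℝ V] [FiniteDimensional ℝ V]

/-- `t ↦ det (1 + t A)` agrees with a polynomial of degree at most `dim V`. -/
lemma exists_polynomial_det_one_add_smul (A : V →L[ℝ] V) :
    ∃ p : Polynomial ℝ, p.natDegree ≤ Module.finrank ℝ V ∧
      ∀ t : ℝ, p.eval t = (ContinuousLinearMap.id ℝ V + t • A).det := by
  let b := Module.finBasis ℝ V
  refine ⟨_, (Polynomial.natDegree_det_X_add_C_le
    (LinearMap.toMatrix b b (A : V →ₗ[ℝ] V)) 1).trans (by simp), fun t => ?_⟩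
  rw [ContinuousLinearMap.det, ← LinearMap.det_toMatrix b, ← Polynomial.coe_evalRingHom,
    RingHom.map_det]
  congr 1
  ext i j
  simp [Matrix.one_apply, LinearMap.toMatrix_apply, Finsupp.single_apply]
  split_ifs <;> simp_all [add_comm, mul_comm]

lemma det_id_add_pos {A : V →L[ℝ] V} (hA : ‖A‖ < 1) :
    0 < (ContinuousLinearMap.id ℝ V + A).det := by
  have hne : ∀ t ∈ Icc (0 : ℝ) 1, (ContinuousLinearMap.id ℝ V + t • A).det ≠ 0 := by
    intro t ht h0
    obtain ⟨v, hv, hv0⟩ := Submodule.exists_mem_ne_zero_of_ne_bot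
      (LinearMap.det_eq_zero_iff_ker_ne_bot.1 h0)
    have h1 : v = -(t • A v) := by
      have : v + t • A v = 0 := by simpa using hv
      exact eq_neg_of_add_eq_zero_left this
    have h2 : ‖v‖ ≤ ‖A‖ * ‖v‖ := by
      calc ‖v‖ = t * ‖A v‖ := by
            conv_lhs => rw [h1]
            rw [norm_neg, norm_smul, Real.norm_of_nonneg ht.1]
        _ ≤ 1 * (‖A‖ * ‖v‖) := by
            gcongr
            · exact ht.2
            · exact A.le_opNorm v
        _ = _ := one_mul _
    have : 0 < ‖v‖ := norm_pos_iff.2 hv0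
    nlinarith
  obtain ⟨p, -, hp⟩ := exists_polynomial_det_one_add_smul A
  by_contra hneg
  push Not at hneg
  have hc : ContinuousOn (fun t => p.eval t) (Icc 0 1) := p.continuous.continuousOn
  have h0 : p.eval 0 = 1 := by
    rw [hp]; simp [ContinuousLinearMap.det]
  have h1 : p.eval 1 ≤ 0 := by rw [hp]; simpa using hneg
  obtain ⟨t, ht, h⟩ := intermediate_value_Icc' zero_le_one hc
    (show (0 : ℝ) ∈ Icc (p.eval 1) (p.eval 0) from ⟨h1, by rw [h0]; norm_num⟩)
  exact hne t ht (by rw [← hp]; exact h)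

variable [MeasurableSpace V] [BorelSpace V]

lemma integral_det_id_add_smul {g : V → V} {R : ℝ}
    (hg : ∀ x ∈ Metric.ball (0 : V) R, DifferentiableAt ℝ g x) {K : ℝ≥0}
    (hK : LipschitzWith K g) (hR : ∀ x, R ≤ ‖x‖ → g x = 0) {t : ℝ} (ht0 : 0 ≤ t)
    (ht : t * K < 1) :
    ∫ x in Metric.ball (0 : V) R, (ContinuousLinearMap.id ℝ V + t • fderiv ℝ g x).det
      = volume.real (Metric.ball (0 : V) R) := by
  set f : V → V := fun x => x + t • g x with hf
  have hA : ∀ x ∈ Metric.ball (0 : V) R,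
      HasFDerivAt f (ContinuousLinearMap.id ℝ V + t • fderiv ℝ g x) x := fun x hx =>
    (hasFDerivAt_id x).add ((hg x hx).hasFDerivAt.const_smul t)
  have hlip : ∀ x y, ‖t • g x - t • g y‖ ≤ (t * K) * ‖x - y‖ := fun x y => by
    rw [← smul_sub, norm_smul, Real.norm_of_nonneg ht0, mul_assoc]
    exact mul_le_mul_of_nonneg_left (hK.norm_sub_le x y) ht0
  have hinj : Function.Injective f := by
    intro x y hxy
    have h1 : x - y = t • g y - t • g x := by
      have : x + t • g x = y + t • g y := hxy
      rw [sub_eq_sub_iff_add_eq_add, this, add_comm]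
    have h2 := hlip y x
    rw [← h1, norm_sub_rev y x] at h2
    have h3 : ‖x - y‖ = 0 := by
      by_contra h
      have : 0 < ‖x - y‖ := lt_of_le_of_ne (norm_nonneg _) (Ne.symm h)
      nlinarith
    exact sub_eq_zero.1 (norm_eq_zero.1 h3)
  have hsurj : Function.Surjective f := by
    have happ : ApproximatesLinearOn f
        ((ContinuousLinearEquiv.refl ℝ V : V ≃L[ℝ] V) : V →L[ℝ] V) univ
          (⟨t * K, by positivity⟩ : ℝ≥0) := by
      intro x _ y _
      have : f x - f y - (((ContinuousLinearEquiv.refl ℝ V : V ≃L[ℝ] V) : V →L[ℝ] V) (x - y))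
          = t • g x - t • g y := by
        simp only [hf, ContinuousLinearEquiv.coe_refl, ContinuousLinearMap.id_apply]
        abel
      rw [this]
      exact hlip x y
    refine happ.surjective ?_
    rcases subsingleton_or_nontrivial V with h | h
    · exact Or.inl h
    · right
      simp only [ContinuousLinearEquiv.refl_symm, ContinuousLinearEquiv.coe_refl]
      rw [ContinuousLinearMap.nnnorm_id, inv_one]
      exact ht
  have himg : f '' Metric.ball 0 R = Metric.ball 0 R := by
    have hout : ∀ x, R ≤ ‖x‖ → f x = x := fun x hx => by simp [hf, hR x hx]
    ext y
    simp only [mem_image, mem_ball_zero_iff]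
    constructor
    · rintro ⟨x, hx, rfl⟩
      by_contra h
      have := hinj (hout (f x) (not_lt.1 h))
      rw [this] at h
      exact h hx
    · intro hy
      obtain ⟨x, rfl⟩ := hsurj y
      refine ⟨x, ?_, rfl⟩
      by_contra h
      rw [hout x (not_lt.1 h)] at hy
      exact h hy
  have hpos : ∀ x, 0 < (ContinuousLinearMap.id ℝ V + t • fderiv ℝ g x).det := fun x => by
    apply det_id_add_pos
    rw [norm_smul, Real.norm_of_nonneg ht0]
    exact (mul_le_mul_of_nonneg_left (norm_fderiv_le_of_lipschitz ℝ hK) ht0).trans_lt ht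
  have key := integral_image_eq_integral_abs_det_fderiv_smul (μ := (volume : Measure V))
    (Metric.isOpen_ball (x := (0 : V)) (ε := R)).measurableSet
    (fun x hx => (hA x hx).hasFDerivWithinAt) (hinj.injOn) (fun _ => (1 : ℝ))
  rw [himg] at key
  simp only [smul_eq_mul, mul_one, integral_const, measureReal_restrict_apply_univ] at key
  rw [key]
  exact setIntegral_congr_fun Metric.isOpen_ball.measurableSet
    (fun x _ => (abs_of_pos (hpos x)).symm)

/-- A Lipschitz map that is the identity outside a ball and `C¹` inside does not have an
everywhere singular derivative in the ball: there is no `C¹` retraction onto the boundary. -/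
lemma exists_det_fderiv_ne_zero {g : V → V} {R : ℝ} (hR0 : 0 < R)
    (hg : ∀ x ∈ Metric.ball (0 : V) R, DifferentiableAt ℝ g x)
    (hg' : ContinuousOn (fderiv ℝ g) (Metric.ball (0 : V) R)) {K : ℝ≥0}
    (hK : LipschitzWith K g) (hR : ∀ x, R ≤ ‖x‖ → g x = 0) :
    ∃ x ∈ Metric.ball (0 : V) R, (ContinuousLinearMap.id ℝ V + fderiv ℝ g x).det ≠ 0 := by
  by_contra! hall
  choose p hpd hp using fun x => exists_polynomial_det_one_add_smul (fderiv ℝ g x)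
  set M := Module.finrank ℝ V
  set s := Finset.range (M + 1)
  set τ : ℕ → ℝ := fun i => (i : ℝ) / ((M + 1) * (K + 1)) with hτ
  have hKp : (0 : ℝ) < K + 1 := by positivity
  have hinj : Set.InjOn τ s := by
    intro i _ j _ hij
    have hne : ((M : ℝ) + 1) * (K + 1) ≠ 0 := by positivity
    simp only [hτ] at hij
    field_simp at hij
    exact_mod_cast hij
  set c : ℕ → ℝ := fun i => (Lagrange.basis s τ i).eval 1
  have hc1 : ∑ i ∈ s, c i = 1 := by
    have := congrArg (Polynomial.eval 1) (Lagrange.sum_basis hinj ⟨0, by simp [s]⟩)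
    rwa [Polynomial.eval_finsetSum, Polynomial.eval_one] at this
  have hintg : ∀ x, (p x).eval 1 = ∑ i ∈ s, (p x).eval (τ i) * c i := by
    intro x
    have hdeg : (p x).degree < s.card := by
      rw [Finset.card_range]
      refine Polynomial.degree_le_natDegree.trans_lt ?_
      exact_mod_cast Nat.lt_succ_of_le (hpd x)
    conv_lhs => rw [Lagrange.eq_interpolate hinj hdeg]
    simp [Lagrange.interpolate_apply, Polynomial.eval_finsetSum, c]
  have hcont : ∀ t : ℝ, IntegrableOn (fun x => (p x).eval t) (Metric.ball (0 : V) R) := by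
    intro t
    simp only [hp]
    have h1 : ContinuousOn (fun x => ContinuousLinearMap.id ℝ V + t • fderiv ℝ g x)
        (Metric.ball (0 : V) R) := by fun_prop
    obtain ⟨C, hC⟩ := (isCompact_closedBall (0 : V →L[ℝ] V)
      (‖ContinuousLinearMap.id ℝ V‖ + |t| * K)).exists_bound_of_continuousOn
        (ContinuousLinearMap.continuous_det (𝕜 := ℝ) (E := V)).continuousOn
    refine Integrable.mono' (g := fun _ => C) (integrableOn_const measure_ball_lt_top.ne)
      ((ContinuousLinearMap.continuous_det.comp_continuousOn h1).aestronglyMeasurable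
        Metric.isOpen_ball.measurableSet) ?_
    refine Filter.Eventually.of_forall fun x => hC _ ?_
    rw [mem_closedBall_zero_iff]
    refine (norm_add_le _ _).trans ?_
    rw [norm_smul, Real.norm_eq_abs]
    gcongr
    exact norm_fderiv_le_of_lipschitz ℝ hK
  have hτM : ∀ i ∈ s, 0 ≤ τ i ∧ τ i * K < 1 := by
    intro i hi
    refine ⟨by positivity, ?_⟩
    have : (i : ℝ) ≤ M := by exact_mod_cast Nat.lt_succ_iff.1 (Finset.mem_range.1 hi)
    rw [hτ, div_mul_eq_mul_div, div_lt_one (by positivity)]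
    have hK0 : (0 : ℝ) ≤ K := K.2
    have hM0 : (0 : ℝ) ≤ M := Nat.cast_nonneg _
    nlinarith
  have h1 : ∫ x in Metric.ball (0 : V) R, (p x).eval 1 = volume.real (Metric.ball (0 : V) R) := by
    simp only [hintg]
    rw [integral_finsetSum]
    · rw [← mul_one (volume.real (Metric.ball (0 : V) R)), ← hc1, Finset.mul_sum]
      refine Finset.sum_congr rfl fun i hi => ?_
      rw [integral_mul_const]
      simp only [hp]
      rw [integral_det_id_add_smul hg hK hR (hτM i hi).1 (hτM i hi).2]
    · intro i _
      exact (hcont (τ i)).mul_const _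
  have h0 : ∫ x in Metric.ball (0 : V) R, (p x).eval 1 = 0 := by
    refine (setIntegral_congr_fun Metric.isOpen_ball.measurableSet fun x hx => ?_).trans
      (integral_zero _ _)
    simp only [hp, one_smul, hall x hx]
  rw [h0] at h1
  have : 0 < volume.real (Metric.ball (0 : V) R) := by
    rw [measureReal_def]
    exact ENNReal.toReal_pos (Metric.measure_ball_pos _ _ hR0).ne' measure_ball_lt_top.ne
  linarith

/-- A continuous vector field pointing outwards far away from the origin has a zero. -/
theorem exists_zero_of_inner_pos {F : V → V} (hF : Continuous F) {r : ℝ}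
    (hr : ∀ x, r ≤ ‖x‖ → 0 < ⟪F x, x⟫_ℝ) : ∃ x, F x = 0 := by
  by_contra! hne
  rcases subsingleton_or_nontrivial V with hV | hV
  · exact hne 0 (Subsingleton.elim _ _)
  wlog hr0 : 0 ≤ r generalizing r
  · exact this (r := 0) (fun x hx => hr x ((not_le.1 hr0).le.trans hx)) le_rfl
  set R := r + 1 with hRdef
  have hR0 : 0 < R := by positivity
  set s : V → ℝ := fun x => max 0 (min 1 (‖x‖ - r)) with hs
  have hs0 : ∀ x, 0 ≤ s x := fun x => le_max_left _ _
  have hs1 : ∀ x, s x ≤ 1 := fun x => max_le zero_le_one (min_le_left _ _)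
  have hsR : ∀ x, R ≤ ‖x‖ → s x = 1 := fun x hx => by
    simp only [hs]; rw [min_eq_left (by linarith), max_eq_right zero_le_one]
  have hsr : ∀ x, ‖x‖ ≤ r → s x = 0 := fun x hx => by
    simp only [hs]; rw [min_eq_right (by linarith), max_eq_left (by linarith)]
  have hsc : Continuous s := by fun_prop
  set h : V → V := fun x => (1 - s x) • (F x - x) with hh
  have hhc : Continuous h := by fun_prop
  have hWne : ∀ x, x + h x ≠ 0 := by
    intro x h0
    rcases le_or_gt ‖x‖ r with hx | hx
    · simp only [hh, hsr x hx] at h0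
      exact hne x (by simpa using h0)
    · have h1 : ⟪x + h x, x⟫_ℝ = (1 - s x) * ⟪F x, x⟫_ℝ + s x * ‖x‖ ^ 2 := by
        simp only [hh, inner_add_left, inner_smul_left, inner_sub_left,
          real_inner_self_eq_norm_sq]
        simp
        ring
      rw [h0, inner_zero_left] at h1
      have h2 := hr x hx.le
      have h3 : 0 < ‖x‖ ^ 2 := by have : 0 < ‖x‖ := hr0.trans_lt hx; positivity
      rcases (hs0 x).eq_or_lt with h4 | h4
      · rw [← h4] at h1; linarith
      · have := hs1 x
        nlinarith
  obtain ⟨x₀, -, hx₀⟩ := (isCompact_closedBall (0 : V) R).exists_isMinOn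
    ⟨0, by simp [hR0.le]⟩ (f := fun x => ‖x + h x‖) (by fun_prop)
  have hε : 0 < ‖x₀ + h x₀‖ := norm_pos_iff.2 (hWne x₀)
  obtain ⟨g₀, hg₀c, hg₀, hg₀s⟩ := hhc.exists_contDiff_approx 1 (ε := fun _ => ‖x₀ + h x₀‖)
    continuous_const (fun _ => hε)
  have hg₀R : ∀ x, R ≤ ‖x‖ → g₀ x = 0 := by
    intro x hx
    by_contra hne0
    exact hg₀s hne0 (by simp [hh, hsR x hx])
  set U : V → V := fun x => x + g₀ x with hU
  have hUc : ContDiff ℝ 1 U := contDiff_id.add hg₀c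
  have hUne : ∀ x, U x ≠ 0 := by
    intro x h0
    rcases le_or_gt ‖x‖ R with hx | hx
    · have h1 := hx₀ (mem_closedBall_zero_iff.2 hx)
      have h2 := hg₀ x
      rw [dist_eq_norm] at h2
      have h3 : x + h x = -(g₀ x - h x) := by
        have e : x + g₀ x = 0 := h0
        rw [← sub_eq_zero, ← e]; abel
      simp only [Set.mem_ofPred_eq] at h1
      rw [h3, norm_neg] at h1
      linarith
    · simp only [hU, hg₀R x hx.le, add_zero] at h0
      rw [h0, norm_zero] at hx
      linarith
  set ρ : V → V := fun x => (R * ‖U x‖⁻¹) • U x with hρ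
  have hρc : ContDiff ℝ 1 ρ :=
    (contDiff_const.mul ((hUc.norm ℝ hUne).inv fun x => norm_ne_zero_iff.2 (hUne x))).smul hUc
  have hρn : ∀ x, ⟪ρ x, ρ x⟫_ℝ = R ^ 2 := by
    intro x
    have := norm_ne_zero_iff.2 (hUne x)
    rw [real_inner_self_eq_norm_sq, hρ, norm_smul, norm_mul, norm_inv, norm_norm,
      Real.norm_of_nonneg hR0.le]
    field_simp
  set φ : V → V := fun x => ρ x - x with hφ
  have hφc : ContDiff ℝ 1 φ := hρc.sub contDiff_id
  obtain ⟨K, hK⟩ := hφc.contDiffOn.exists_lipschitzOnWith one_ne_zero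
    (convex_closedBall (0 : V) R) (isCompact_closedBall _ _)
  have hφ0 : ∀ x, ‖x‖ = R → φ x = 0 := by
    intro x hx
    simp only [hφ, hρ, hU, hg₀R x hx.ge, add_zero, hx]
    rw [mul_inv_cancel₀ hR0.ne', one_smul, sub_self]
  have hev : ∀ x ∈ Metric.ball (0 : V) R,
      (Metric.closedBall (0 : V) R).indicator φ =ᶠ[nhds x] φ := by
    intro x hx
    filter_upwards [Metric.isOpen_ball.mem_nhds hx] with y hy
    exact indicator_of_mem (Metric.ball_subset_closedBall hy) φ
  obtain ⟨x, hx, hdet⟩ := exists_det_fderiv_ne_zero (V := V) hR0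
    (fun x hx => ((hφc.differentiable one_ne_zero) x).congr_of_eventuallyEq (hev x hx))
    (((hφc.continuous_fderiv one_ne_zero).continuousOn).congr fun x hx => (hev x hx).fderiv_eq)
    (lipschitzWith_indicator_closedBall hK hφ0)
    (fun x hx => by
      by_cases hxm : x ∈ Metric.closedBall (0 : V) R
      · rw [indicator_of_mem hxm]
        exact hφ0 x (le_antisymm (mem_closedBall_zero_iff.1 hxm) hx)
      · exact indicator_of_notMem hxm _)
  apply hdet
  have hd : ContinuousLinearMap.id ℝ V
      + fderiv ℝ ((Metric.closedBall (0 : V) R).indicator φ) x = fderiv ℝ ρ x := by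
    have hρd := (hρc.differentiable one_ne_zero) x
    rw [(hev x hx).fderiv_eq]
    have := (hρd.hasFDerivAt.sub (hasFDerivAt_id x)).fderiv
    rw [show fderiv ℝ φ x = _ from this]
    abel
  rw [hd]
  have horth : ∀ v, ⟪ρ x, fderiv ℝ ρ x v⟫_ℝ = 0 := by
    intro v
    have hρd := ((hρc.differentiable one_ne_zero) x).hasFDerivAt
    have h1 := (hρd.inner ℝ hρd)
    simp only [hρn] at h1
    have h2 := congrArg (fun T => T v) (h1.unique (hasFDerivAt_const (R ^ 2) x))
    simp [real_inner_comm (ρ x)] at h2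
    linarith
  by_contra hdet0
  have hs : Function.Surjective (fderiv ℝ ρ x) := by
    have hk : LinearMap.ker (fderiv ℝ ρ x : V →ₗ[ℝ] V) = ⊥ := by
      by_contra hk
      exact hdet0 (LinearMap.det_eq_zero_iff_ker_ne_bot.2 hk)
    exact LinearMap.range_eq_top.1 (LinearMap.ker_eq_bot_iff_range_eq_top.1 hk)
  obtain ⟨v, hv⟩ := hs (ρ x)
  have := horth v
  rw [hv, hρn] at this
  exact (pow_pos hR0 2).ne' this

end Brouwer

section Bernstein

open Polynomial in
lemma norm_eval_le_mul_pow {p : ℂ[X]} {N : ℕ} (hp : p.natDegree ≤ N) {M : ℝ}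
    (hM : ∀ z : ℂ, ‖z‖ = 1 → ‖p.eval z‖ ≤ M) {z : ℂ} {ρ : ℝ} (hρ : 1 ≤ ρ) (hz : ‖z‖ ≤ ρ) :
    ‖p.eval z‖ ≤ M * ρ ^ N := by
  have disk : ∀ q : ℂ[X], (∀ z : ℂ, ‖z‖ = 1 → ‖q.eval z‖ ≤ M) → ∀ z : ℂ, ‖z‖ ≤ 1 →
      ‖q.eval z‖ ≤ M := by
    intro q hq z hz
    refine Complex.norm_le_of_forall_mem_frontier_norm_le (U := Metric.ball 0 1)
      Metric.isBounded_ball q.differentiable.diffContOnCl (fun w hw => hq w ?_) ?_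
    · rw [frontier_ball _ one_ne_zero] at hw
      simpa using hw
    · rw [closure_ball _ one_ne_zero]
      simpa using hz
  have hM0 : 0 ≤ M := (norm_nonneg _).trans (hM 1 (by simp))
  rcases le_or_gt ‖z‖ 1 with h1 | h1
  · exact (disk p hM z h1).trans (le_mul_of_one_le_right hM0 (one_le_pow₀ hρ))
  have key : ∀ w : ℂ, w ≠ 0 → p.eval w = (p.reflect N).eval w⁻¹ * w ^ N := by
    intro w hw
    let := invertibleOfNonzero hw
    have := eval₂_reflect_mul_pow (RingHom.id ℂ) w N p hp
    rw [invOf_eq_inv] at this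
    exact this.symm
  have hz0 : z ≠ 0 := by rintro rfl; simp at h1; linarith
  rw [key z hz0, norm_mul, norm_pow]
  have hq : ‖(p.reflect N).eval z⁻¹‖ ≤ M := by
    refine disk _ (fun w hw => ?_) _ ?_
    · have hw0 : w⁻¹ ≠ 0 := by rintro h; rw [inv_eq_zero] at h; simp [h] at hw
      have h2 := hM w⁻¹ (by rw [norm_inv, hw, inv_one])
      rw [key _ hw0, inv_inv, norm_mul, norm_pow, norm_inv, hw] at h2
      simpa using h2
    · rw [norm_inv]; exact inv_le_one_of_one_le₀ h1.le
  gcongr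

open Polynomial in
/-- A form of Bernstein's inequality with a non-sharp constant. -/
lemma norm_eval_derivative_le {p : ℂ[X]} {N : ℕ} (hN : 1 ≤ N) (hp : p.natDegree ≤ N) {M : ℝ}
    (hM : ∀ z : ℂ, ‖z‖ = 1 → ‖p.eval z‖ ≤ M) {z : ℂ} (hz : ‖z‖ = 1) :
    ‖p.derivative.eval z‖ ≤ 3 * N * M := by
  have hM0 : 0 ≤ M := (norm_nonneg _).trans (hM 1 (by simp))
  have hN0 : (0 : ℝ) < N := by exact_mod_cast hN
  have h := Complex.norm_deriv_le_of_forall_mem_sphere_norm_le (c := z) (R := 1 / N)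
    (C := M * (1 + 1 / N) ^ N) (f := fun w => p.eval w) (by positivity)
    p.differentiable.diffContOnCl (fun w hw => by
      refine norm_eval_le_mul_pow hp hM (by simp) ?_
      have : w = z + (w - z) := by ring
      rw [this]
      refine (norm_add_le _ _).trans ?_
      rw [hz, mem_sphere_iff_norm.1 hw])
  rw [Polynomial.deriv] at h
  refine h.trans ?_
  have he : (1 + 1 / (N : ℝ)) ^ N ≤ 3 := by
    have h1 : (1 + 1 / (N : ℝ)) ^ N ≤ Real.exp (1 / N) ^ N := by
      gcongr
      rw [add_comm]; exact Real.add_one_le_exp _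
    rw [← Real.exp_nat_mul, mul_one_div_cancel hN0.ne'] at h1
    exact h1.trans (Real.exp_one_lt_d9.le.trans (by norm_num))
  rw [div_div_eq_mul_div, div_one]
  calc M * (1 + 1 / (N : ℝ)) ^ N * N ≤ M * 3 * N := by gcongr
    _ = _ := by ring

open Polynomial in
lemma exists_polynomial_greatCircle {n : ℕ} {P : MvPolynomial (Fin d) ℝ} (hP : P.totalDegree ≤ n)
    (x v : EuclideanSpace ℝ (Fin d)) : ∃ p : ℂ[X], p.natDegree ≤ 2 * n ∧
      ∀ θ : ℝ, p.eval (Complex.exp (θ * Complex.I))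
        = Complex.exp (θ * Complex.I) ^ n * (pEval P (cos θ • x + sin θ • v) : ℝ) := by
  set q : Fin d → ℂ[X] := fun i =>
    C ((x i : ℂ) / 2) * (X ^ 2 + 1) + C ((v i : ℂ) / (2 * Complex.I)) * (X ^ 2 - 1) with hq
  refine ⟨∑ α ∈ P.support, C ((P.coeff α : ℝ) : ℂ) * X ^ (n - α.degree) * ∏ i, q i ^ α i,
    ?_, fun θ => ?_⟩
  · refine natDegree_sum_le_of_forall_le _ _ fun α hα => ?_
    have hα' : α.degree ≤ n := by
      have := MvPolynomial.le_totalDegree hα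
      rw [Finsupp.degree_eq_sum]
      rw [Finsupp.sum_fintype _ _ (by simp)] at this
      omega
    have hqd : ∀ i, (q i).natDegree ≤ 2 := by
      intro i
      simp only [hq]
      compute_degree
    have h1 : (∏ i, q i ^ α i).natDegree ≤ ∑ i, α i * 2 := by
      refine (natDegree_prod_le _ _).trans (Finset.sum_le_sum fun i _ => ?_)
      exact natDegree_pow_le_of_le _ (hqd i)
    rw [← Finset.sum_mul, ← Finsupp.degree_eq_sum] at h1
    refine (natDegree_mul_le_of_le (n := α.degree * 2) (m := n - α.degree) ?_ h1).trans
      (by omega)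
    exact natDegree_C_mul_X_pow_le _ _
  · have hq' : ∀ i, (q i).eval (Complex.exp (θ * Complex.I))
        = Complex.exp (θ * Complex.I) * ((cos θ * x i + sin θ * v i : ℝ) : ℂ) := by
      intro i
      have hI := Complex.I_sq
      have hI0 := Complex.I_ne_zero
      simp only [hq, eval_add, eval_mul, eval_C, eval_sub, eval_pow, eval_X, eval_one]
      rw [Complex.exp_mul_I]
      push_cast
      have hcs : Complex.cos θ ^ 2 + Complex.sin θ ^ 2 = 1 := Complex.cos_sq_add_sin_sq _
      have e1 : (Complex.cos θ + Complex.sin θ * Complex.I) ^ 2 + 1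
          = 2 * Complex.cos θ * (Complex.cos θ + Complex.sin θ * Complex.I) := by
        linear_combination (Complex.sin (θ:ℂ))^2 * hI - hcs
      have e2 : (Complex.cos θ + Complex.sin θ * Complex.I) ^ 2 - 1
          = 2 * Complex.I * Complex.sin θ * (Complex.cos θ + Complex.sin θ * Complex.I) := by
        linear_combination -(Complex.sin (θ:ℂ))^2 * hI + hcs
      rw [e1, e2]
      field_simp
    rw [eval_finsetSum, pEval, MvPolynomial.eval_eq']
    push_cast
    rw [Finset.mul_sum]
    refine Finset.sum_congr rfl fun α hα => ?_
    have hα' : α.degree ≤ n := by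
      have := MvPolynomial.le_totalDegree hα
      rw [Finsupp.degree_eq_sum]
      rw [Finsupp.sum_fintype _ _ (by simp)] at this
      omega
    simp only [eval_mul, eval_C, eval_pow, eval_X, eval_prod, hq', mul_pow,
      Finset.prod_mul_distrib]
    rw [Finset.prod_pow_eq_pow_sum, ← Finsupp.degree_eq_sum]
    conv_rhs => rw [← Nat.sub_add_cancel hα', pow_add]
    simp
    ring

end Bernstein

section PolynomialEvaluation

variable (P Q : MvPolynomial (Fin d) ℝ) (x : EuclideanSpace ℝ (Fin d))

@[simp] lemma pEval_add : pEval (P + Q) x = pEval P x + pEval Q x := map_add _ _ _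
@[simp] lemma pEval_sub : pEval (P - Q) x = pEval P x - pEval Q x := map_sub _ _ _
@[simp] lemma pEval_neg : pEval (-P) x = -pEval P x := map_neg _ _
@[simp] lemma pEval_mul : pEval (P * Q) x = pEval P x * pEval Q x := map_mul _ _ _
@[simp] lemma pEval_pow (k : ℕ) : pEval (P ^ k) x = pEval P x ^ k := map_pow _ _ _
@[simp] lemma pEval_zero : pEval 0 x = 0 := map_zero _
@[simp] lemma pEval_one : pEval 1 x = 1 := map_one _
@[simp] lemma pEval_C (a : ℝ) : pEval (MvPolynomial.C a) x = a := MvPolynomial.eval_C _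
@[simp] lemma pEval_X (i : Fin d) : pEval (MvPolynomial.X i) x = x i := MvPolynomial.eval_X _
@[simp] lemma pEval_smul (a : ℝ) : pEval (a • P) x = a * pEval P x := MvPolynomial.smul_eval _ _ _
@[simp] lemma pEval_sum {ι : Type*} (s : Finset ι) (F : ι → MvPolynomial (Fin d) ℝ) :
    pEval (∑ i ∈ s, F i) x = ∑ i ∈ s, pEval (F i) x := map_sum _ _ _

lemma contDiff_pEval {n : WithTop ℕ∞} : ContDiff ℝ n (pEval P) := by
  have : pEval P = fun x : EuclideanSpace ℝ (Fin d) =>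
      ∑ α ∈ P.support, P.coeff α * ∏ i, x i ^ α i := by
    ext x
    rw [pEval, MvPolynomial.eval_eq']
  rw [this]
  refine ContDiff.sum fun α _ => contDiff_const.mul (contDiff_prod fun i _ => ?_)
  exact ContDiff.pow (EuclideanSpace.proj (𝕜 := ℝ) i : EuclideanSpace ℝ (Fin d) →L[ℝ] ℝ).contDiff _

@[fun_prop] lemma continuous_pEval : Continuous (pEval P) := (contDiff_pEval P (n := 0)).continuous

end PolynomialEvaluation

section SphereGeometry

variable {x y : EuclideanSpace ℝ (Fin d)}

lemma norm_eq_one_of_mem_unitSphere (hx : x ∈ unitSphere d) : ‖x‖ = 1 := mem_sphere_zero_iff_norm.1 hx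

lemma mem_unitSphere_of_norm (hx : ‖x‖ = 1) : x ∈ unitSphere d := mem_sphere_zero_iff_norm.2 hx

lemma norm_sub_eq_two_mul_sin_gdist (hx : x ∈ unitSphere d) (hy : y ∈ unitSphere d) :
    ‖x - y‖ = 2 * sin (gdist x y / 2) := by
  have hx1 := norm_eq_one_of_mem_unitSphere hx
  have hy1 := norm_eq_one_of_mem_unitSphere hy
  have hi : |⟪x, y⟫_ℝ| ≤ 1 := by simpa [hx1, hy1] using abs_real_inner_le_norm x y
  have hs : 0 ≤ sin (gdist x y / 2) := sin_nonneg_of_nonneg_of_le_pi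
    (by have := arccos_nonneg ⟪x, y⟫_ℝ; unfold gdist; linarith)
    (by have := arccos_le_pi ⟪x, y⟫_ℝ; have := pi_pos; unfold gdist; linarith)
  have h : ‖x - y‖ ^ 2 = (2 * sin (gdist x y / 2)) ^ 2 := by
    rw [norm_sub_sq_real, hx1, hy1, mul_pow, sin_sq_eq_half_sub, mul_div_cancel₀ _ two_ne_zero, gdist,
      cos_arccos (abs_le.1 hi).1 (abs_le.1 hi).2]
    ring
  exact (sq_eq_sq₀ (norm_nonneg _) (by positivity)).1 h

lemma norm_sub_le_gdist (hx : x ∈ unitSphere d) (hy : y ∈ unitSphere d) :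
    ‖x - y‖ ≤ gdist x y := by
  rw [norm_sub_eq_two_mul_sin_gdist hx hy]
  have := sin_le (x := gdist x y / 2) (by have := arccos_nonneg ⟪x, y⟫_ℝ; unfold gdist; linarith)
  linarith

lemma gdist_le_norm_sub (hx : x ∈ unitSphere d) (hy : y ∈ unitSphere d) :
    gdist x y ≤ π / 2 * ‖x - y‖ := by
  rw [norm_sub_eq_two_mul_sin_gdist hx hy]
  have := mul_le_sin (x := gdist x y / 2)
    (by have := arccos_nonneg ⟪x, y⟫_ℝ; unfold gdist; linarith)
    (by have := arccos_le_pi ⟪x, y⟫_ℝ; unfold gdist; linarith)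
  have hpi := pi_pos
  calc gdist x y = π * (2 / π * (gdist x y / 2)) := by field_simp
    _ ≤ π * sin (gdist x y / 2) := by gcongr
    _ = _ := by ring

lemma cos_smul_add_sin_smul_mem {v : EuclideanSpace ℝ (Fin d)} (hx : x ∈ unitSphere d)
    (hv : ‖v‖ = 1) (hxv : ⟪x, v⟫_ℝ = 0) (θ : ℝ) : cos θ • x + sin θ • v ∈ unitSphere d := by
  apply mem_unitSphere_of_norm
  have h : ‖cos θ • x + sin θ • v‖ ^ 2 = 1 := by
    rw [norm_add_sq_real, norm_smul, norm_smul, inner_smul_left, inner_smul_right, hxv, hv,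
      norm_eq_one_of_mem_unitSphere hx, mul_one, mul_one, norm_eq_abs, norm_eq_abs, sq_abs, sq_abs]
    simp
  exact (pow_eq_one_iff_of_nonneg (norm_nonneg _) two_ne_zero).1 h

lemma exists_eq_cos_smul_add_sin_smul (hx : x ∈ unitSphere d) (hy : y ∈ unitSphere d)
    (h1 : y ≠ x) (h2 : y ≠ -x) : ∃ v : EuclideanSpace ℝ (Fin d), ‖v‖ = 1 ∧ ⟪x, v⟫_ℝ = 0 ∧
      y = cos (gdist x y) • x + sin (gdist x y) • v := by
  have hx1 := norm_eq_one_of_mem_unitSphere hx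
  have hy1 := norm_eq_one_of_mem_unitSphere hy
  have hi : |⟪x, y⟫_ℝ| ≤ 1 := by simpa [hx1, hy1] using abs_real_inner_le_norm x y
  set t := ⟪x, y⟫_ℝ with ht
  have hxx : ⟪x, x⟫_ℝ = 1 := by rw [real_inner_self_eq_norm_sq, hx1, one_pow]
  set u := y - t • x with hu
  have hun : ‖u‖ ^ 2 = 1 - t ^ 2 := by
    rw [hu, norm_sub_sq_real, norm_smul, inner_smul_right, real_inner_comm, ← ht, hx1, hy1,
      norm_eq_abs, mul_one, sq_abs]
    ring
  have hs : sin (gdist x y) = ‖u‖ := by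
    rw [gdist, sin_arccos, ← ht, ← hun, sqrt_sq (norm_nonneg _)]
  have hu0 : u ≠ 0 := by
    intro h0
    rw [h0, norm_zero] at hun
    have hyt : y = t • x := sub_eq_zero.1 h0
    have : (t - 1) * (t + 1) = 0 := by linarith
    rcases mul_eq_zero.1 this with h | h
    · exact h1 (by rw [hyt, show t = 1 by linarith, one_smul])
    · exact h2 (by rw [hyt, show t = -1 by linarith, neg_one_smul])
  have hun0 : ‖u‖ ≠ 0 := norm_ne_zero_iff.2 hu0
  refine ⟨‖u‖⁻¹ • u, by rw [norm_smul, norm_inv, norm_norm, inv_mul_cancel₀ hun0], ?_, ?_⟩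
  · rw [inner_smul_right, hu, inner_sub_right, inner_smul_right, hxx]; simp [ht]
  · rw [hs, smul_smul, mul_inv_cancel₀ hun0, one_smul, gdist, cos_arccos (abs_le.1 hi).1 (abs_le.1 hi).2,
      hu]
    abel

/-- Bernstein's inequality along great circles, with a non-sharp constant. -/
lemma abs_pEval_sub_le {n : ℕ} {P : MvPolynomial (Fin d) ℝ} (hP : P.totalDegree ≤ n) (hn : 1 ≤ n)
    {M : ℝ} (hM : ∀ z ∈ unitSphere d, |pEval P z| ≤ M) (hx : x ∈ unitSphere d)
    (hy : y ∈ unitSphere d) : |pEval P x - pEval P y| ≤ 12 * n * ‖x - y‖ * M := by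
  have hM0 : 0 ≤ M := (abs_nonneg _).trans (hM x hx)
  have hn1 : (1 : ℝ) ≤ n := by exact_mod_cast hn
  have hx1 := norm_eq_one_of_mem_unitSphere hx
  by_cases h1 : y = x
  · simp [h1]
  by_cases h2 : y = -x
  · have h3 : ‖x - y‖ = 2 := by
      rw [h2, sub_neg_eq_add, ← two_smul ℝ, norm_smul, hx1]; simp
    rw [h3]
    calc |pEval P x - pEval P y| ≤ |pEval P x| + |pEval P y| := abs_sub _ _
      _ ≤ M + M := add_le_add (hM x hx) (hM y hy)
      _ ≤ _ := by nlinarith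
  obtain ⟨v, hv, hxv, hyv⟩ := exists_eq_cos_smul_add_sin_smul hx hy h1 h2
  obtain ⟨p, hpd, hp⟩ := exists_polynomial_greatCircle hP x v
  set f : ℝ → ℂ := fun θ => (pEval P (cos θ • x + sin θ • v) : ℝ) with hf
  have hpM : ∀ z : ℂ, ‖z‖ = 1 → ‖p.eval z‖ ≤ M := by
    intro z hz
    have : z = Complex.exp (z.arg * Complex.I) := by
      conv_lhs => rw [← Complex.norm_mul_exp_arg_mul_I z, hz]
      simp
    rw [this, hp, norm_mul, norm_pow, Complex.norm_exp_ofReal_mul_I, one_pow, one_mul,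
      Complex.norm_real]
    exact hM _ (cos_smul_add_sin_smul_mem hx hv hxv _)
  have hfe : ∀ θ : ℝ, f θ = Complex.exp (-(n * θ * Complex.I)) * p.eval (Complex.exp (θ * Complex.I)) := by
    intro θ
    rw [hp, ← Complex.exp_nat_mul, ← mul_assoc, ← Complex.exp_add]
    simp [hf, mul_assoc]
  have hder : ∀ θ : ℝ, HasDerivAt f
      (Complex.exp (-(n * θ * Complex.I)) * (-(n * Complex.I)) * p.eval (Complex.exp (θ * Complex.I))
       + Complex.exp (-(n * θ * Complex.I)) * (p.derivative.eval (Complex.exp (θ * Complex.I)) *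
        (Complex.exp (θ * Complex.I) * Complex.I))) θ := by
    intro θ
    rw [show f = fun θ : ℝ => Complex.exp (-(n * θ * Complex.I)) * p.eval (Complex.exp (θ * Complex.I))
      from funext hfe]
    have e1 : HasDerivAt (fun θ : ℂ => Complex.exp (-(n * θ * Complex.I)))
        (Complex.exp (-(n * θ * Complex.I)) * (-(n * Complex.I))) (θ : ℂ) := by
      have := ((((hasDerivAt_id (θ : ℂ)).const_mul (n : ℂ)).mul_const Complex.I).neg).cexp
      simpa using this
    have e2 : HasDerivAt (fun θ : ℂ => Complex.exp (θ * Complex.I))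
        (Complex.exp (θ * Complex.I) * Complex.I) (θ : ℂ) := by
      have := ((hasDerivAt_id (θ : ℂ)).mul_const Complex.I).cexp
      simpa using this
    exact (e1.mul ((p.hasDerivAt _).comp (θ : ℂ) e2)).comp_ofReal
  have hE : ∀ θ : ℝ, ‖Complex.exp (-(n * θ * Complex.I))‖ = 1 := by
    intro θ
    have := Complex.norm_exp_ofReal_mul_I (-(n * θ))
    rw [← this]; congr 2; push_cast; ring
  have hbd : ∀ θ ∈ (univ : Set ℝ), ‖deriv f θ‖ ≤ 7 * n * M := by
    intro θ _
    rw [(hder θ).deriv]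
    refine (norm_add_le _ _).trans ?_
    have hz : ‖Complex.exp (θ * Complex.I)‖ = 1 := Complex.norm_exp_ofReal_mul_I θ
    have b1 := hpM _ hz
    have b2 := norm_eval_derivative_le (N := 2 * n) (by omega) hpd hpM hz
    simp only [norm_mul, hE, norm_neg, Complex.norm_natCast, Complex.norm_I, hz, mul_one, one_mul]
    push_cast at b2
    nlinarith
  have hmv := convex_univ.norm_image_sub_le_of_norm_deriv_le
    (fun θ _ => (hder θ).differentiableAt) hbd (mem_univ 0) (mem_univ (gdist x y))
  have e3 : f (gdist x y) - f 0 = ((pEval P y - pEval P x : ℝ) : ℂ) := by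
    simp only [hf]
    rw [← hyv]; simp
  rw [e3, Complex.norm_real, norm_eq_abs, abs_sub_comm, sub_zero, norm_eq_abs,
    abs_of_nonneg (show 0 ≤ gdist x y from arccos_nonneg _)] at hmv
  refine hmv.trans ?_
  have h5 := gdist_le_norm_sub hx hy
  have h6 := pi_lt_d2
  have h7 : gdist x y ≤ 12 / 7 * ‖x - y‖ := h5.trans
    (mul_le_mul_of_nonneg_right (by linarith) (norm_nonneg _))
  calc 7 * n * M * gdist x y ≤ 7 * n * M * (12 / 7 * ‖x - y‖) := by gcongr
    _ = _ := by ring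

end SphereGeometry

section Kernel

/-- The Dirichlet kernel `(1 + 2 ∑_{k=1}^m cos kθ) / (2 m + 1)` as a polynomial in `cos θ`. -/
def dirichletPoly (m : ℕ) : Polynomial ℝ :=
  Polynomial.C ((2 * m + 1 : ℝ)⁻¹) *
    (1 + Polynomial.C 2 * ∑ k ∈ Finset.range m, Polynomial.Chebyshev.T ℝ (k + 1 : ℕ))

/-- The zonal polynomial `x ↦ D_m(y ⬝ x)` of degree `m` peaking at `y`. -/
def zonal (m : ℕ) (y : EuclideanSpace ℝ (Fin d)) : MvPolynomial (Fin d) ℝ :=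
  Polynomial.aeval (∑ i, MvPolynomial.C (y i) * MvPolynomial.X i) (dirichletPoly m)

lemma natDegree_dirichletPoly_le (m : ℕ) : (dirichletPoly m).natDegree ≤ m := by
  refine (Polynomial.natDegree_C_mul_le _ _).trans ?_
  refine Polynomial.natDegree_add_le_of_degree_le (by simp) ?_
  refine (Polynomial.natDegree_C_mul_le _ _).trans ?_
  refine Polynomial.natDegree_sum_le_of_forall_le _ _ fun k hk => ?_
  rw [Polynomial.Chebyshev.natDegree_T]
  have := Finset.mem_range.1 hk
  simp; omega

lemma eval_dirichletPoly_cos (m : ℕ) (θ : ℝ) : (dirichletPoly m).eval (cos θ) =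
    (2 * m + 1 : ℝ)⁻¹ * (1 + 2 * ∑ k ∈ Finset.range m, cos ((k + 1) * θ)) := by
  simp [dirichletPoly, Polynomial.eval_finsetSum, Polynomial.Chebyshev.T_real_cos]

lemma sin_half_mul_dirichlet (m : ℕ) (θ : ℝ) :
    sin (θ / 2) * (1 + 2 * ∑ k ∈ Finset.range m, cos ((k + 1) * θ)) = sin ((m + 1 / 2) * θ) := by
  induction m with
  | zero => simp; ring_nf
  | succ m ih =>
    rw [Finset.sum_range_succ, mul_add 2, ← add_assoc, mul_add, ih]
    have h1 : ((m : ℝ) + 1 / 2) * θ = (m + 1) * θ - θ / 2 := by ring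
    have h2 : (((m + 1 : ℕ) : ℝ) + 1 / 2) * θ = (m + 1) * θ + θ / 2 := by push_cast; ring
    rw [h1, h2, sin_sub, sin_add]
    ring

lemma pEval_zonal (m : ℕ) (x y : EuclideanSpace ℝ (Fin d)) :
    pEval (zonal m y) x = (dirichletPoly m).eval ⟪y, x⟫_ℝ := by
  have h : MvPolynomial.aeval (fun i => x i)
      (∑ i, MvPolynomial.C (y i) * MvPolynomial.X i : MvPolynomial (Fin d) ℝ) = ⟪y, x⟫_ℝ := by
    simp [PiLp.inner_apply, mul_comm]
  rw [pEval, zonal, ← MvPolynomial.coe_aeval_eq_eval, RingHom.coe_coe, ← Polynomial.aeval_algHom_apply, h,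
    Polynomial.coe_aeval_eq_eval]

lemma totalDegree_zonal_le (m : ℕ) (y : EuclideanSpace ℝ (Fin d)) : (zonal m y).totalDegree ≤ m := by
  rw [zonal, Polynomial.aeval_eq_sum_range]
  refine MvPolynomial.totalDegree_finsetSum_le fun i hi => ?_
  refine (MvPolynomial.totalDegree_smul_le _ _).trans ((MvPolynomial.totalDegree_pow _ _).trans ?_)
  have h1 : (∑ i, MvPolynomial.C (y i) * MvPolynomial.X i : MvPolynomial (Fin d) ℝ).totalDegree ≤ 1 := by
    refine MvPolynomial.totalDegree_finsetSum_le fun j _ => ?_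
    refine (MvPolynomial.totalDegree_mul _ _).trans ?_
    simp
  have h2 := natDegree_dirichletPoly_le m
  have h3 := Finset.mem_range.1 hi
  calc _ ≤ i * 1 := by gcongr
    _ ≤ m := by omega

variable {x y : EuclideanSpace ℝ (Fin d)}

lemma inner_eq_cos_gdist (hx : x ∈ unitSphere d) (hy : y ∈ unitSphere d) :
    ⟪y, x⟫_ℝ = cos (gdist y x) := by
  have hi : |⟪y, x⟫_ℝ| ≤ 1 := by
    simpa [norm_eq_one_of_mem_unitSphere hx, norm_eq_one_of_mem_unitSphere hy]
      using abs_real_inner_le_norm y x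
  rw [gdist, cos_arccos (abs_le.1 hi).1 (abs_le.1 hi).2]

lemma pEval_zonal_self (m : ℕ) (hy : y ∈ unitSphere d) : pEval (zonal m y) y = 1 := by
  rw [pEval_zonal, real_inner_self_eq_norm_sq, norm_eq_one_of_mem_unitSphere hy, one_pow,
    ← cos_zero, eval_dirichletPoly_cos]
  simp
  field_simp
  ring

lemma abs_pEval_zonal_le_one (m : ℕ) (hx : x ∈ unitSphere d) (hy : y ∈ unitSphere d) :
    |pEval (zonal m y) x| ≤ 1 := by
  rw [pEval_zonal, inner_eq_cos_gdist hx hy, eval_dirichletPoly_cos, abs_mul, abs_inv,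
    abs_of_pos (show (0 : ℝ) < 2 * m + 1 by positivity), inv_mul_le_iff₀ (by positivity), mul_one]
  refine (abs_add_le _ _).trans ?_
  rw [abs_one, abs_mul, abs_two, add_comm]
  gcongr
  refine (Finset.abs_sum_le_sum_abs _ _).trans ?_
  refine (Finset.sum_le_card_nsmul _ _ 1 fun k _ => abs_cos_le_one _).trans ?_
  simp

lemma abs_pEval_zonal_le (m : ℕ) (hx : x ∈ unitSphere d) (hy : y ∈ unitSphere d) :
    |pEval (zonal m y) x| ≤ 2 / (1 + m * ‖y - x‖) := by
  have h1 := abs_pEval_zonal_le_one m hx hy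
  rw [le_div_iff₀ (by positivity)]
  have h2 : |pEval (zonal m y) x| * ((2 * m + 1) * ‖y - x‖) ≤ 2 := by
    rw [pEval_zonal, inner_eq_cos_gdist hx hy, eval_dirichletPoly_cos,
      norm_sub_eq_two_mul_sin_gdist hy hx]
    have h3 := sin_half_mul_dirichlet m (gdist y x)
    have h4 : 0 ≤ sin (gdist y x / 2) := by
      have := norm_sub_eq_two_mul_sin_gdist hy hx
      have := norm_nonneg (y - x)
      linarith
    rw [abs_mul, abs_inv, abs_of_pos (show (0 : ℝ) < 2 * m + 1 by positivity)]
    set D := 1 + 2 * ∑ k ∈ Finset.range m, cos ((k + 1) * gdist y x)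
    have h5 : |sin (gdist y x / 2) * D| ≤ 1 := by rw [h3]; exact abs_sin_le_one _
    rw [abs_mul, abs_of_nonneg h4] at h5
    calc _ = 2 * (sin (gdist y x / 2) * |D|) := by field_simp
      _ ≤ _ := by linarith
  have h0 := abs_nonneg (pEval (zonal m y) x)
  nlinarith [norm_nonneg (y - x), mul_nonneg h0 (norm_nonneg (y - x))]

end Kernel

section LocalBernstein

variable {x y : EuclideanSpace ℝ (Fin d)}

lemma abs_one_sub_pow_le {a : ℝ} (ha : |a| ≤ 1) (β : ℕ) : |1 - a ^ β| ≤ β * |1 - a| := by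
  induction β with
  | zero => simp
  | succ k ih =>
    have : 1 - a ^ (k + 1) = (1 - a ^ k) + a ^ k * (1 - a) := by ring
    rw [this]
    refine (abs_add_le _ _).trans ?_
    rw [abs_mul, abs_pow]
    have h1 : |a| ^ k ≤ 1 := pow_le_one₀ (abs_nonneg _) ha
    push_cast
    nlinarith [abs_nonneg (1 - a)]

/-- Bernstein's inequality for polynomials that grow at a controlled rate away from `y`. -/
lemma abs_pEval_sub_le_of_growth {n β : ℕ} (hn : 1 ≤ n) {P : MvPolynomial (Fin d) ℝ}
    (hP : P.totalDegree ≤ n) {A : ℝ} (hy : y ∈ unitSphere d)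
    (hA : ∀ z ∈ unitSphere d, |pEval P z| ≤ A * (1 + n * ‖y - z‖) ^ β) (hx : x ∈ unitSphere d)
    (hxy : n * ‖y - x‖ ≤ 6) :
    |pEval P x - pEval P y| ≤ 24 * (1 + β) * 7 ^ β * (n * ‖y - x‖) * A := by
  have hA0 : 0 ≤ A := by
    have := hA y hy
    simp only [sub_self, norm_zero, mul_zero, add_zero, one_pow, mul_one] at this
    exact (abs_nonneg _).trans this
  set D := pEval (zonal n y) x with hD
  have hD1 : |D| ≤ 1 := abs_pEval_zonal_le_one n hx hy
  have hQ := abs_pEval_sub_le (n := n * (1 + β)) (P := P * zonal n y ^ β) (M := A * 2 ^ β)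
    (by
      refine (MvPolynomial.totalDegree_mul _ _).trans ?_
      have := (MvPolynomial.totalDegree_pow (zonal n y) β).trans
        (Nat.mul_le_mul_left β (totalDegree_zonal_le n y))
      nlinarith) (by nlinarith) (fun z hz => by
      rw [pEval_mul, pEval_pow, abs_mul, abs_pow]
      have h1 := abs_pEval_zonal_le n hz hy
      calc _ ≤ (A * (1 + n * ‖y - z‖) ^ β) * (2 / (1 + n * ‖y - z‖)) ^ β := by
            gcongr
            exact hA z hz
        _ = A * 2 ^ β := by
            rw [div_pow]
            field_simp) hx hy
  have hDD := abs_pEval_sub_le (M := 1) (totalDegree_zonal_le n y) hn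
    (fun z hz => abs_pEval_zonal_le_one n hz hy) hx hy
  rw [pEval_mul, pEval_mul, pEval_pow, pEval_pow, pEval_zonal_self n hy, one_pow, mul_one, ← hD] at hQ
  rw [pEval_zonal_self n hy, ← hD, mul_one, abs_sub_comm, norm_sub_rev] at hDD
  rw [norm_sub_rev] at hQ
  push_cast at hQ
  have hPx : |pEval P x| ≤ A * 7 ^ β := (hA x hx).trans (by gcongr; linarith)
  have h2 := abs_one_sub_pow_le hD1 β
  have h3 : (2 : ℝ) ^ β ≤ 7 ^ β := by gcongr; norm_num
  set s := (n : ℝ) * ‖y - x‖ with hs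
  have hs0 : 0 ≤ s := by positivity
  have h4 : pEval P x - pEval P y = (pEval P x * D ^ β - pEval P y) + pEval P x * (1 - D ^ β) := by
    ring
  rw [h4]
  calc _ ≤ |pEval P x * D ^ β - pEval P y| + |pEval P x| * |1 - D ^ β| := by
        rw [← abs_mul]; exact abs_add_le _ _
    _ ≤ 12 * (1 + β) * s * (A * 7 ^ β) + A * 7 ^ β * (β * (12 * s)) := by
        refine add_le_add (hQ.trans ?_) ?_
        · calc _ = 12 * (1 + β) * s * (A * 2 ^ β) := by rw [hs]; ring
            _ ≤ _ := by gcongr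
        · refine mul_le_mul hPx (h2.trans ?_) (abs_nonneg _) (by positivity)
          gcongr
          linarith
    _ ≤ _ := by
        have : 0 ≤ A * 7 ^ β * s := by positivity
        nlinarith

end LocalBernstein

section Doubling

/-- A measure carried by the unit sphere that is doubling for Euclidean balls. -/
structure SphereDoubling (ν : Measure (EuclideanSpace ℝ (Fin d))) (L : ℝ) : Prop where
  compl : ν (unitSphere d)ᶜ = 0
  doubling : ∀ x ∈ unitSphere d, ∀ r : ℝ, 0 < r →
    ν.real (Metric.closedBall x (2 * r)) ≤ L * ν.real (Metric.closedBall x r)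

namespace SphereDoubling

variable {ν : Measure (EuclideanSpace ℝ (Fin d))} {L : ℝ}
  {x : EuclideanSpace ℝ (Fin d)}

lemma ae_mem (hν : SphereDoubling ν L) : ∀ᵐ x ∂ν, x ∈ unitSphere d := hν.compl

variable [IsProbabilityMeasure ν]

lemma nonempty (hν : SphereDoubling ν L) : (unitSphere d).Nonempty := hν.ae_mem.exists

lemma measureReal_closedBall_eq_one (hν : SphereDoubling ν L) (hx : x ∈ unitSphere d) {r : ℝ}
    (hr : 2 ≤ r) : ν.real (Metric.closedBall x r) = 1 := by
  rw [measureReal_def, (prob_compl_eq_zero_iff Metric.isClosed_closedBall.measurableSet).1,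
    ENNReal.toReal_one]
  refine measure_mono_null (compl_subset_compl.2 fun y hyS => ?_) hν.compl
  rw [Metric.mem_closedBall, dist_eq_norm]
  refine (norm_sub_le _ _).trans ?_
  rw [norm_eq_one_of_mem_unitSphere hx, norm_eq_one_of_mem_unitSphere hyS]
  linarith

lemma one_le (hν : SphereDoubling ν L) : 1 ≤ L := by
  obtain ⟨x, hx⟩ := hν.nonempty
  have := hν.doubling x hx 2 two_pos
  rwa [hν.measureReal_closedBall_eq_one hx (by norm_num),
    hν.measureReal_closedBall_eq_one hx le_rfl, mul_one] at this

lemma measureReal_closedBall_le (hν : SphereDoubling ν L) (hx : x ∈ unitSphere d) {r R : ℝ}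
    (hr : 0 < r) (k : ℕ) (hR : R ≤ 2 ^ k * r) :
    ν.real (Metric.closedBall x R) ≤ L ^ k * ν.real (Metric.closedBall x r) := by
  refine (measureReal_mono (Metric.closedBall_subset_closedBall hR)).trans ?_
  clear hR
  induction k with
  | zero => simp
  | succ k ih =>
    rw [pow_succ', mul_assoc, pow_succ', mul_assoc]
    exact (hν.doubling x hx _ (by positivity)).trans
      (mul_le_mul_of_nonneg_left ih (by linarith [hν.one_le]))

lemma measureReal_closedBall_pos (hν : SphereDoubling ν L) (hx : x ∈ unitSphere d) {r : ℝ}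
    (hr : 0 < r) : 0 < ν.real (Metric.closedBall x r) := by
  obtain ⟨k, hk⟩ := pow_unbounded_of_one_lt (2 / r) one_lt_two
  have h := hν.measureReal_closedBall_le hx hr k (R := 2) (by rw [div_lt_iff₀ hr] at hk; exact hk.le)
  rw [hν.measureReal_closedBall_eq_one hx le_rfl] at h
  by_contra h0
  have : ν.real (Metric.closedBall x r) = 0 := le_antisymm (not_lt.1 h0) measureReal_nonneg
  rw [this] at h
  linarith

/-- Uniform lower bound for the mass of balls of a fixed radius. -/
lemma exists_le_measureReal_closedBall (hν : SphereDoubling ν L) {r : ℝ} (hr : 0 < r) :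
    ∃ c : ℝ, 0 < c ∧ ∀ x ∈ unitSphere d, c ≤ ν.real (Metric.closedBall x r) := by
  obtain ⟨k, hk⟩ := pow_unbounded_of_one_lt (2 / r) one_lt_two
  have hL : 0 < L := by linarith [hν.one_le]
  refine ⟨(L ^ k)⁻¹, by positivity, fun x hx => ?_⟩
  have h := hν.measureReal_closedBall_le hx hr k (R := 2) (by rw [div_lt_iff₀ hr] at hk; exact hk.le)
  rw [hν.measureReal_closedBall_eq_one hx le_rfl] at h
  rwa [inv_le_iff_one_le_mul₀' (by positivity)]

lemma integrable_of_continuousOn (hν : SphereDoubling ν L) {f : EuclideanSpace ℝ (Fin d) → ℝ}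
    (hf : Continuous f) : Integrable f ν := by
  obtain ⟨C, hC⟩ := (isCompact_sphere (0 : EuclideanSpace ℝ (Fin d)) 1).exists_bound_of_continuousOn
    hf.continuousOn
  exact Integrable.of_bound hf.aestronglyMeasurable C (hν.ae_mem.mono hC)

/-- Polynomially decaying functions have integral comparable with the mass of the central ball. -/
lemma integral_decay_le (hν : SphereDoubling ν L) (hx : x ∈ unitSphere d) {n : ℕ} (hn : 1 ≤ n)
    {β : ℕ} (hβ : 2 * L ≤ 2 ^ β) :
    ∫ y, ((1 + n * ‖x - y‖) ^ β)⁻¹ ∂ν ≤ 2 ^ (β + 1) * ν.real (Metric.closedBall x (1 / n)) := by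
  have hn0 : (0 : ℝ) < n := by exact_mod_cast hn
  have hL0 : 0 ≤ L := by linarith [hν.one_le]
  obtain ⟨I, hI⟩ := pow_unbounded_of_one_lt (2 * n : ℝ) one_lt_two
  set B : ℕ → Set (EuclideanSpace ℝ (Fin d)) := fun i => Metric.closedBall x (2 ^ i * (1 / n))
  have hB : ∀ i, MeasurableSet (B i) := fun i => Metric.isClosed_closedBall.measurableSet
  have hpt : ∀ y ∈ unitSphere d, ((1 + n * ‖x - y‖) ^ β)⁻¹ ≤
      ∑ i ∈ Finset.range (I + 1), (B i).indicator (fun _ => 2 ^ β * ((2 : ℝ) ^ β)⁻¹ ^ i) y := by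
    intro y hy
    have hr0 : 0 ≤ n * ‖x - y‖ := by positivity
    have hr2 : ‖x - y‖ ≤ 2 := by
      refine (norm_sub_le _ _).trans ?_
      rw [norm_eq_one_of_mem_unitSphere hx, norm_eq_one_of_mem_unitSphere hy]; norm_num
    have hex : ∃ i : ℕ, n * ‖x - y‖ ≤ 2 ^ i := ⟨I, by nlinarith⟩
    classical
    set i := Nat.find hex with hi
    have hi1 : n * ‖x - y‖ ≤ 2 ^ i := Nat.find_spec hex
    have hiI : i ≤ I := Nat.find_min' hex (by nlinarith)
    have hyB : y ∈ B i := by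
      simp only [B, Metric.mem_closedBall, dist_eq_norm]
      rw [norm_sub_rev, mul_one_div, le_div_iff₀ hn0, mul_comm]
      exact hi1
    have hle : ((1 + n * ‖x - y‖) ^ β)⁻¹ ≤ 2 ^ β * ((2 : ℝ) ^ β)⁻¹ ^ i := by
      rcases Nat.eq_zero_or_pos i with h0 | h0
      · rw [h0, pow_zero, mul_one]
        refine (inv_le_one_of_one_le₀ (one_le_pow₀ (by linarith))).trans (one_le_pow₀ one_le_two)
      · obtain ⟨j, hj⟩ : ∃ j, i = j + 1 := ⟨i - 1, by omega⟩
        have hlt : ¬ (n * ‖x - y‖ ≤ 2 ^ j) := Nat.find_min hex (by omega)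
        rw [hj, pow_succ', ← mul_assoc, mul_inv_cancel₀ (by positivity), one_mul, inv_pow, ← pow_mul,
          mul_comm β j, pow_mul]
        gcongr
        linarith
    refine hle.trans ?_
    rw [← indicator_of_mem hyB (fun _ => 2 ^ β * ((2 : ℝ) ^ β)⁻¹ ^ i)]
    exact Finset.single_le_sum (f := fun i => (B i).indicator
      (fun _ => 2 ^ β * ((2 : ℝ) ^ β)⁻¹ ^ i) y)
      (fun k _ => indicator_nonneg (fun _ _ => by positivity) _) (Finset.mem_range.2 (by omega))
  have hintg : ∀ i ∈ Finset.range (I + 1),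
      Integrable ((B i).indicator (fun _ => 2 ^ β * ((2 : ℝ) ^ β)⁻¹ ^ i)) ν := fun i _ =>
    (integrable_const _).indicator (hB i)
  calc _ ≤ ∫ y, ∑ i ∈ Finset.range (I + 1),
          (B i).indicator (fun _ => 2 ^ β * ((2 : ℝ) ^ β)⁻¹ ^ i) y ∂ν := by
        refine integral_mono_of_nonneg (Filter.Eventually.of_forall fun y => by positivity)
          (integrable_finsetSum _ hintg) (hν.ae_mem.mono hpt)
    _ = ∑ i ∈ Finset.range (I + 1), ν.real (B i) * (2 ^ β * ((2 : ℝ) ^ β)⁻¹ ^ i) := by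
        rw [integral_finsetSum _ hintg]
        refine Finset.sum_congr rfl fun i _ => ?_
        rw [integral_indicator_const _ (hB i), smul_eq_mul]
    _ ≤ ∑ i ∈ Finset.range (I + 1),
          2 ^ β * ν.real (Metric.closedBall x (1 / n)) * (1 / 2) ^ i := by
        refine Finset.sum_le_sum fun i _ => ?_
        have h1 := hν.measureReal_closedBall_le hx (r := 1 / n) (by positivity) i le_rfl
        calc _ ≤ L ^ i * ν.real (Metric.closedBall x (1 / n)) * (2 ^ β * ((2 : ℝ) ^ β)⁻¹ ^ i) := by
              gcongr
          _ = 2 ^ β * ν.real (Metric.closedBall x (1 / n)) * (L * ((2 : ℝ) ^ β)⁻¹) ^ i := by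
              rw [mul_pow]; ring
          _ ≤ _ := by
              gcongr
              rw [← div_eq_mul_inv, div_le_div_iff₀ (by positivity) two_pos]
              linarith
    _ ≤ _ := by
        rw [← Finset.mul_sum]
        refine (mul_le_mul_of_nonneg_left (sum_geometric_two_le (I + 1))
          (mul_nonneg (by positivity) measureReal_nonneg)).trans_eq ?_
        ring

end SphereDoubling

end Doubling

section LocalControl

namespace SphereDoubling

variable {ν : Measure (EuclideanSpace ℝ (Fin d))} [IsProbabilityMeasure ν] {L : ℝ}

lemma measurable_measureReal_closedBall (ν : Measure (EuclideanSpace ℝ (Fin d)))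
    [IsProbabilityMeasure ν] (r : ℝ) :
    Measurable fun z => ν.real (Metric.closedBall z r) := by
  have h : MeasurableSet {p : EuclideanSpace ℝ (Fin d) × EuclideanSpace ℝ (Fin d) |
      dist p.2 p.1 ≤ r} := (isClosed_le (by fun_prop) (by fun_prop)).measurableSet
  exact (measurable_measure_prodMk_left h).ennreal_toReal

lemma one_add_mul_norm_sub_le (n : ℕ) (x y z : EuclideanSpace ℝ (Fin d)) :
    1 + n * ‖x - z‖ ≤ (1 + n * ‖x - y‖) * (1 + n * ‖y - z‖) := by
  have h := norm_sub_le_norm_sub_add_norm_sub x y z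
  have h1 : (n : ℝ) * ‖x - z‖ ≤ n * (‖x - y‖ + ‖y - z‖) := by gcongr
  have h2 : 0 ≤ (n * ‖x - y‖) * (n * ‖y - z‖) := by positivity
  linarith

/-- The average of `|P|` at scale `1 / n` around `x`, with polynomially decaying weights. -/
def localAverage (ν : Measure (EuclideanSpace ℝ (Fin d))) (n β : ℕ) (P : MvPolynomial (Fin d) ℝ)
    (x : EuclideanSpace ℝ (Fin d)) : ℝ :=
  ∫ z, |pEval P z| * (ν.real (Metric.closedBall z (1 / n)))⁻¹ * ((1 + n * ‖x - z‖) ^ β)⁻¹ ∂ν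

lemma localAverage_nonneg (ν : Measure (EuclideanSpace ℝ (Fin d))) (n β : ℕ)
    (P : MvPolynomial (Fin d) ℝ) (x : EuclideanSpace ℝ (Fin d)) : 0 ≤ localAverage ν n β P x :=
  integral_nonneg fun z => by
    have : 0 ≤ ν.real (Metric.closedBall z (1 / n)) := measureReal_nonneg
    positivity

variable {n β : ℕ} {P : MvPolynomial (Fin d) ℝ}

lemma integrable_prod_localAverage (hν : SphereDoubling ν L) (hn : 1 ≤ n) (β : ℕ)
    (P : MvPolynomial (Fin d) ℝ) :
    Integrable (Function.uncurry fun x z => |pEval P z| *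
      (ν.real (Metric.closedBall z (1 / n)))⁻¹ * ((1 + n * ‖x - z‖) ^ β)⁻¹) (ν.prod ν) ∧
    ∀ x, Integrable (fun z => |pEval P z| *
      (ν.real (Metric.closedBall z (1 / n)))⁻¹ * ((1 + n * ‖x - z‖) ^ β)⁻¹) ν := by
  have hn0 : (0 : ℝ) < n := by exact_mod_cast hn
  obtain ⟨M, hM⟩ := (isCompact_sphere (0 : EuclideanSpace ℝ (Fin d)) 1).exists_bound_of_continuousOn
    (continuous_pEval P).continuousOn
  obtain ⟨c, hc, hcν⟩ := hν.exists_le_measureReal_closedBall (r := 1 / n) (by positivity)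
  have hbd : ∀ x, ∀ z ∈ unitSphere d, ‖|pEval P z| *
      (ν.real (Metric.closedBall z (1 / n)))⁻¹ * ((1 + n * ‖x - z‖) ^ β)⁻¹‖ ≤ M * c⁻¹ * 1 := by
    intro x z hz
    rw [norm_mul, norm_mul, norm_inv, norm_inv, norm_eq_abs, norm_eq_abs, abs_abs,
      norm_of_nonneg (show 0 ≤ (1 + n * ‖x - z‖) ^ β by positivity), abs_of_nonneg measureReal_nonneg]
    have h1 := hM z hz
    have h2 := hcν z hz
    have h3 : ((1 + n * ‖x - z‖) ^ β)⁻¹ ≤ 1 := inv_le_one_of_one_le₀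
      (one_le_pow₀ (by have : 0 ≤ n * ‖x - z‖ := by positivity
                       linarith))
    have hM0 : 0 ≤ M := (norm_nonneg _).trans h1
    gcongr
    exact h1
  have hmeas := measurable_measureReal_closedBall ν (1 / n : ℝ)
  have hPm := (continuous_pEval P).measurable
  refine ⟨Integrable.of_bound (C := M * c⁻¹ * 1) ?_ ?_, fun x =>
    Integrable.of_bound (C := M * c⁻¹ * 1) ?_ (hν.ae_mem.mono (hbd x))⟩
  · apply Measurable.aestronglyMeasurable
    simp only [Function.uncurry_def]
    exact (((hPm.comp measurable_snd).norm).mul (hmeas.comp measurable_snd).inv).mul (by fun_prop)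
  · exact (Measure.quasiMeasurePreserving_snd.ae hν.ae_mem).mono fun p hp => hbd p.1 p.2 hp
  · apply Measurable.aestronglyMeasurable
    exact (hPm.norm.mul hmeas.inv).mul (by fun_prop)

lemma integrable_localAverage (hν : SphereDoubling ν L) (hn : 1 ≤ n) :
    Integrable (localAverage ν n β P) ν :=
  (hν.integrable_prod_localAverage hn β P).1.integral_prod_left

lemma integral_localAverage_le (hν : SphereDoubling ν L) (hn : 1 ≤ n) (hβ : 2 * L ≤ 2 ^ β) :
    ∫ x, localAverage ν n β P x ∂ν ≤ 2 ^ (β + 1) * ∫ z, |pEval P z| ∂ν := by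
  have hn0 : (0 : ℝ) < n := by exact_mod_cast hn
  unfold localAverage
  rw [integral_integral_swap (hν.integrable_prod_localAverage hn β P).1, ← integral_const_mul]
  refine integral_mono_of_nonneg (Filter.Eventually.of_forall fun z => integral_nonneg fun x => ?_)
    ((hν.integrable_of_continuousOn (by fun_prop)).const_mul _) (hν.ae_mem.mono fun z hz => ?_)
  · have : 0 ≤ ν.real (Metric.closedBall z (1 / n)) := measureReal_nonneg
    positivity
  · simp only
    rw [integral_const_mul]
    have h1 := hν.integral_decay_le hz hn hβ
    have h2 := hν.measureReal_closedBall_pos hz (r := 1 / n) (by positivity)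
    simp only [norm_sub_rev z] at h1
    calc _ ≤ |pEval P z| * (ν.real (Metric.closedBall z (1 / n)))⁻¹ *
          (2 ^ (β + 1) * ν.real (Metric.closedBall z (1 / n))) := by gcongr
      _ = _ := by field_simp

/-- A polynomial of degree `n` is controlled at scale `1 / n` by an integrable function of
comparable `L¹` norm. -/
theorem exists_local_control (d : ℕ) (L : ℝ) : ∃ C : ℝ, 0 < C ∧
    ∀ (ν : Measure (EuclideanSpace ℝ (Fin d))) [IsProbabilityMeasure ν], SphereDoubling ν L →
    ∀ n : ℕ, 1 ≤ n → ∀ P : MvPolynomial (Fin d) ℝ, P.totalDegree ≤ n →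
    ∃ g : EuclideanSpace ℝ (Fin d) → ℝ, Integrable g ν ∧ (∀ x, 0 ≤ g x) ∧
      ∫ x, g x ∂ν ≤ C * ∫ x, |pEval P x| ∂ν ∧
      ∀ x ∈ unitSphere d, ∀ y ∈ unitSphere d, n * ‖x - y‖ ≤ 3 → |pEval P y| ≤ g x ∧
        ∀ y' ∈ unitSphere d, n * ‖x - y'‖ ≤ 3 →
          |pEval P y - pEval P y'| ≤ n * ‖y - y'‖ * g x := by
  by_cases hL : 1 ≤ L
  swap
  · exact ⟨1, one_pos, fun ν _ hν => absurd hν.one_le hL⟩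
  obtain ⟨β, hβ⟩ := pow_unbounded_of_one_lt (2 * L) one_lt_two
  set C₁ : ℝ := 24 * (1 + β) * 7 ^ β with hC₁
  have hC₁1 : 1 ≤ C₁ := by
    have h1 : (1 : ℝ) ≤ 7 ^ β := one_le_pow₀ (by norm_num)
    have h2 : (0 : ℝ) ≤ β := Nat.cast_nonneg _
    rw [hC₁]
    nlinarith
  set c : ℝ := 1 / (2 * C₁) with hc
  have hc0 : 0 < c := by positivity
  have hc1 : c ≤ 1 := by rw [hc, div_le_one (by positivity)]; linarith
  obtain ⟨k, hk⟩ := pow_unbounded_of_one_lt (2 / c) one_lt_two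
  have hL0 : 0 < L := by linarith
  set C₂ : ℝ := 2 * 2 ^ β * L ^ k with hC₂
  refine ⟨C₁ * 4 ^ β * C₂ * 2 ^ (β + 1), by positivity, fun ν _ hν n hn P hP => ?_⟩
  have hn0 : (0 : ℝ) < n := by exact_mod_cast hn
  refine ⟨fun x => C₁ * 4 ^ β * C₂ * localAverage ν n β P x,
    (hν.integrable_localAverage hn).const_mul _,
    fun x => mul_nonneg (by positivity) (localAverage_nonneg ν n β P x), ?_, fun x hx y hy hxy => ?_⟩
  · rw [integral_const_mul, mul_assoc _ (2 ^ (β + 1))]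
    exact mul_le_mul_of_nonneg_left (hν.integral_localAverage_le hn hβ.le) (by positivity)
  obtain ⟨y₀, hy₀, hmax⟩ := (isCompact_sphere (0 : EuclideanSpace ℝ (Fin d)) 1).exists_isMaxOn
    ⟨x, hx⟩ (f := fun z => |pEval P z| / (1 + n * ‖x - z‖) ^ β)
    (by
      refine ContinuousOn.div (by fun_prop) (by fun_prop) fun z _ => ?_
      positivity)
  set F := |pEval P y₀| / (1 + n * ‖x - y₀‖) ^ β with hF
  have hF0 : 0 ≤ F := by positivity
  have hPF : ∀ z ∈ unitSphere d, |pEval P z| ≤ F * (1 + n * ‖x - z‖) ^ β := fun z hz => by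
    have : |pEval P z| / (1 + n * ‖x - z‖) ^ β ≤ F := hmax hz
    rwa [div_le_iff₀ (by positivity)] at this
  have hPy₀ : |pEval P y₀| = F * (1 + n * ‖x - y₀‖) ^ β := by rw [hF]; field_simp
  have hgrow : ∀ w : EuclideanSpace ℝ (Fin d), ∀ z ∈ unitSphere d,
      |pEval P z| ≤ (F * (1 + n * ‖x - w‖) ^ β) * (1 + n * ‖w - z‖) ^ β := fun w z hz => by
    refine (hPF z hz).trans ?_
    rw [mul_assoc, ← mul_pow]
    gcongr
    exact one_add_mul_norm_sub_le n x w z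
  have hFavg : F ≤ C₂ * localAverage ν n β P x := by
    have hball : ∀ z ∈ unitSphere d, z ∈ Metric.closedBall y₀ (c / n) →
        F / (2 * 2 ^ β * ν.real (Metric.closedBall y₀ (2 / n))) ≤
          |pEval P z| * (ν.real (Metric.closedBall z (1 / n)))⁻¹ * ((1 + n * ‖x - z‖) ^ β)⁻¹ := by
      intro z hz hzb
      have hd : n * ‖y₀ - z‖ ≤ c := by
        rw [Metric.mem_closedBall, dist_eq_norm, norm_sub_rev, le_div_iff₀ hn0] at hzb
        linarith
      have h1 := abs_pEval_sub_le_of_growth hn hP hy₀ (hgrow y₀) hz (by linarith)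
      rw [← hPy₀, ← hC₁] at h1
      have h2 : C₁ * (n * ‖y₀ - z‖) * |pEval P y₀| ≤ C₁ * c * |pEval P y₀| := by gcongr
      have h3 : C₁ * c = 1 / 2 := by rw [hc]; field_simp
      have h4 : |pEval P y₀| - |pEval P z| ≤ |pEval P z - pEval P y₀| := by
        rw [abs_sub_comm]; exact abs_sub_abs_le_abs_sub _ _
      have h5 : F * (1 + n * ‖x - y₀‖) ^ β / 2 ≤ |pEval P z| := by
        rw [← hPy₀]; rw [h3] at h2; linarith
      have h6 : (1 + n * ‖x - z‖) ^ β ≤ (1 + n * ‖x - y₀‖) ^ β * 2 ^ β := by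
        rw [← mul_pow]
        refine pow_le_pow_left₀ (by positivity)
          ((one_add_mul_norm_sub_le n x y₀ z).trans ?_) β
        gcongr
        linarith
      have h7 : ν.real (Metric.closedBall z (1 / n)) ≤ ν.real (Metric.closedBall y₀ (2 / n)) := by
        refine measureReal_mono (Metric.closedBall_subset_closedBall' ?_)
        rw [Metric.mem_closedBall] at hzb
        have : c / n ≤ 1 / n := by gcongr
        have e : (2 : ℝ) / n = 1 / n + 1 / n := by ring
        linarith
      have h8 := hν.measureReal_closedBall_pos hz (r := 1 / n) (by positivity)
      calc F / (2 * 2 ^ β * ν.real (Metric.closedBall y₀ (2 / n)))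
          = (F * (1 + n * ‖x - y₀‖) ^ β / 2) * (ν.real (Metric.closedBall y₀ (2 / n)))⁻¹
              * ((1 + n * ‖x - y₀‖) ^ β * 2 ^ β)⁻¹ := by field_simp
        _ ≤ _ := by gcongr
    have hb := hν.measureReal_closedBall_le hy₀ (r := c / n) (R := 2 / n) (by positivity) k (by
      rw [div_lt_iff₀ hc0] at hk
      rw [mul_div_assoc']
      gcongr)
    have hp2 := hν.measureReal_closedBall_pos hy₀ (r := 2 / n) (by positivity)
    have hintg := (hν.integrable_prod_localAverage hn β P).2 x
    have h1 : ν.real (Metric.closedBall y₀ (c / n)) *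
        (F / (2 * 2 ^ β * ν.real (Metric.closedBall y₀ (2 / n)))) ≤ localAverage ν n β P x := by
      calc _ = ∫ z in Metric.closedBall y₀ (c / n),
            F / (2 * 2 ^ β * ν.real (Metric.closedBall y₀ (2 / n))) ∂ν := by
            rw [setIntegral_const, smul_eq_mul]
        _ ≤ ∫ z in Metric.closedBall y₀ (c / n), |pEval P z| *
            (ν.real (Metric.closedBall z (1 / n)))⁻¹ * ((1 + n * ‖x - z‖) ^ β)⁻¹ ∂ν := by
            refine setIntegral_mono_on_ae (integrableOn_const (measure_ne_top _ _))
              hintg.integrableOn Metric.isClosed_closedBall.measurableSet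
              (hν.ae_mem.mono fun z hz hzb => hball z hz hzb)
        _ ≤ _ := setIntegral_le_integral hintg (Filter.Eventually.of_forall fun z => by
            have : 0 ≤ ν.real (Metric.closedBall z (1 / n)) := measureReal_nonneg
            simp only [Pi.zero_apply]
            positivity)
    rw [mul_div_assoc', div_le_iff₀ (by positivity)] at h1
    have hA0 := localAverage_nonneg ν n β P x
    have h2 : F * ν.real (Metric.closedBall y₀ (c / n)) ≤
        C₂ * localAverage ν n β P x * ν.real (Metric.closedBall y₀ (c / n)) := by
      calc _ = ν.real (Metric.closedBall y₀ (c / n)) * F := mul_comm _ _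
        _ ≤ _ := h1
        _ ≤ localAverage ν n β P x * (2 * 2 ^ β * (L ^ k * ν.real (Metric.closedBall y₀ (c / n)))) := by
            gcongr
        _ = _ := by rw [hC₂]; ring
    exact le_of_mul_le_mul_right h2 (hν.measureReal_closedBall_pos hy₀ (by positivity))
  have h4 : (1 + n * ‖x - y‖) ^ β ≤ 4 ^ β := by gcongr; linarith
  have hFg : C₁ * 4 ^ β * F ≤ C₁ * 4 ^ β * C₂ * localAverage ν n β P x := by
    rw [mul_assoc _ C₂]
    gcongr
  refine ⟨?_, fun y' hy' hxy' => ?_⟩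
  · calc _ ≤ F * 4 ^ β := (hPF y hy).trans (by gcongr)
      _ = 1 * 4 ^ β * F := by ring
      _ ≤ C₁ * 4 ^ β * F := by gcongr
      _ ≤ _ := hFg
  · have h5 := norm_sub_le_norm_sub_add_norm_sub y x y'
    rw [norm_sub_rev y x] at h5
    have h6 : (n : ℝ) * ‖y - y'‖ ≤ n * (‖x - y‖ + ‖x - y'‖) := by gcongr
    have h7 := abs_pEval_sub_le_of_growth hn hP hy (hgrow y) hy' (by linarith)
    rw [abs_sub_comm]
    calc _ ≤ C₁ * (n * ‖y - y'‖) * (F * (1 + n * ‖x - y‖) ^ β) := h7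
      _ ≤ C₁ * (n * ‖y - y'‖) * (F * 4 ^ β) := by gcongr
      _ = n * ‖y - y'‖ * (C₁ * 4 ^ β * F) := by ring
      _ ≤ _ := by gcongr

end SphereDoubling

end LocalControl

section LowerBound

variable {x y z : EuclideanSpace ℝ (Fin d)}

lemma exists_pEval_eq_sub_norm_sq (d : ℕ) (a : ℝ) (x : EuclideanSpace ℝ (Fin d))
    (hx : x ∈ unitSphere d) : ∃ P : MvPolynomial (Fin d) ℝ, P.totalDegree ≤ 1 ∧
      ∀ y ∈ unitSphere d, pEval P y = a - ‖x - y‖ ^ 2 := by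
  refine ⟨MvPolynomial.C (a - 2) + ∑ i, MvPolynomial.C (2 * x i) * MvPolynomial.X i, ?_,
    fun y hy => ?_⟩
  · refine (MvPolynomial.totalDegree_add _ _).trans (max_le
      ((MvPolynomial.totalDegree_C _).le.trans zero_le_one) ?_)
    refine MvPolynomial.totalDegree_finsetSum_le fun i _ => ?_
    refine (MvPolynomial.totalDegree_mul _ _).trans ?_
    rw [MvPolynomial.totalDegree_C, MvPolynomial.totalDegree_X]
  · rw [norm_sub_sq_real, norm_eq_one_of_mem_unitSphere hx, norm_eq_one_of_mem_unitSphere hy]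
    have h : ⟪x, y⟫_ℝ = ∑ i, x i * y i := by simp [PiLp.inner_apply, mul_comm]
    simp only [pEval_add, pEval_C, pEval_sum, pEval_mul, pEval_X, h, mul_assoc]
    rw [← Finset.mul_sum]
    ring

lemma abs_pEval_zonal_div_le {n γ : ℕ} (hγ : 1 ≤ γ) (hn : 1 ≤ n) (hx : x ∈ unitSphere d)
    (hy : y ∈ unitSphere d) :
    |pEval (zonal ((n - 1) / (2 * γ)) y) x| ≤ (2 * (1 + 4 * γ)) / (1 + n * ‖y - x‖) := by
  set m := (n - 1) / (2 * γ) with hm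
  have h1 : n ≤ 2 * γ * (m + 1) := by
    have := Nat.lt_mul_div_succ (n - 1) (b := 2 * γ) (by omega)
    rw [← hm] at this
    omega
  have h1' : (n : ℝ) ≤ 2 * γ * (m + 1) := by exact_mod_cast h1
  refine (abs_pEval_zonal_le m hx hy).trans ?_
  have hr : ‖y - x‖ ≤ 2 := by
    refine (norm_sub_le _ _).trans ?_
    rw [norm_eq_one_of_mem_unitSphere hx, norm_eq_one_of_mem_unitSphere hy]; norm_num
  have hr0 := norm_nonneg (y - x)
  rw [div_le_div_iff₀ (by positivity) (by positivity), mul_assoc]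
  have h2 : (n : ℝ) * ‖y - x‖ ≤ 2 * γ * (m + 1) * ‖y - x‖ := by gcongr
  have h3 : (γ : ℝ) * ‖y - x‖ ≤ γ * 2 := by gcongr
  have h4 : 0 ≤ (m : ℝ) * ‖y - x‖ := by positivity
  have h5 : 0 ≤ (γ : ℝ) * (m * ‖y - x‖) := by positivity
  nlinarith

namespace SphereDoubling

variable {ν : Measure (EuclideanSpace ℝ (Fin d))} [IsProbabilityMeasure ν] {L : ℝ}

lemma le_integral_pEval_zonal_pow (hν : SphereDoubling ν L) (hy : y ∈ unitSphere d) {n : ℕ}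
    (hn : 1 ≤ n) (γ : ℕ) {m : ℕ} (hm : m ≤ n) :
    ν.real (Metric.closedBall y (1 / n)) ≤
      L ^ 5 * 4 ^ γ * ∫ x, pEval (zonal m y ^ (2 * γ)) x ∂ν := by
  have hn0 : (0 : ℝ) < n := by exact_mod_cast hn
  have hL0 : 0 < L := by linarith [hν.one_le]
  have hball : ∀ x ∈ unitSphere d, x ∈ Metric.closedBall y (1 / (24 * n)) →
      ((4 : ℝ) ^ γ)⁻¹ ≤ pEval (zonal m y ^ (2 * γ)) x := by
    intro x hx hxb
    rw [Metric.mem_closedBall, dist_eq_norm, le_div_iff₀ (by positivity)] at hxb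
    have h1 := abs_pEval_sub_le ((totalDegree_zonal_le m y).trans hm) hn
      (fun z hz => abs_pEval_zonal_le_one m hz hy) hx hy
    rw [pEval_zonal_self m hy] at h1
    have h2 : 1 / 2 ≤ pEval (zonal m y) x := by
      have := (abs_le.1 h1).1
      linarith
    rw [pEval_pow, pow_mul, ← inv_pow]
    gcongr
    nlinarith
  have hi : Integrable (pEval (zonal m y ^ (2 * γ))) ν := hν.integrable_of_continuousOn (by fun_prop)
  have h3 : ν.real (Metric.closedBall y (1 / (24 * n))) * ((4 : ℝ) ^ γ)⁻¹ ≤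
      ∫ x, pEval (zonal m y ^ (2 * γ)) x ∂ν := by
    calc _ = ∫ x in Metric.closedBall y (1 / (24 * n)), ((4 : ℝ) ^ γ)⁻¹ ∂ν := by
          rw [setIntegral_const, smul_eq_mul]
      _ ≤ ∫ x in Metric.closedBall y (1 / (24 * n)), pEval (zonal m y ^ (2 * γ)) x ∂ν :=
          setIntegral_mono_on_ae (integrableOn_const (measure_ne_top _ _)) hi.integrableOn
            Metric.isClosed_closedBall.measurableSet
            (hν.ae_mem.mono fun z hz hzb => hball z hz hzb)
      _ ≤ _ := setIntegral_le_integral hi (Filter.Eventually.of_forall fun z => by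
            simp only [Pi.zero_apply, pEval_pow, pow_mul]
            positivity)
  have h4 := hν.measureReal_closedBall_le hy (r := 1 / (24 * n)) (R := 1 / n) (by positivity) 5 (by
    rw [mul_one_div, div_le_div_iff₀ hn0 (by positivity)]
    linarith)
  rw [← div_eq_mul_inv, div_le_iff₀ (by positivity)] at h3
  calc _ ≤ _ := h4
    _ ≤ L ^ 5 * ((∫ x, pEval (zonal m y ^ (2 * γ)) x ∂ν) * 4 ^ γ) := by gcongr
    _ = _ := by ring

/-- Lower bound for the number of nodes of an equal-weight cubature formula. -/
theorem exists_card_lower_bound (d : ℕ) (L : ℝ) : ∃ C : ℝ, 0 < C ∧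
    ∀ (ν : Measure (EuclideanSpace ℝ (Fin d))) [IsProbabilityMeasure ν], SphereDoubling ν L →
    ∀ n : ℕ, 1 ≤ n → ∀ Z : Finset (EuclideanSpace ℝ (Fin d)), 0 < Z.card → ↑Z ⊆ unitSphere d →
    (∀ P : MvPolynomial (Fin d) ℝ, P.totalDegree ≤ n →
      ∫ x, pEval P x ∂ν = (1 / (Z.card : ℝ)) * ∑ z ∈ Z, pEval P z) →
    ∀ x ∈ unitSphere d, 1 ≤ C * Z.card * ν.real (Metric.closedBall x (1 / n)) := by
  by_cases hL : 1 ≤ L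
  swap
  · exact ⟨1, one_pos, fun ν _ hν => absurd hν.one_le hL⟩
  obtain ⟨β, hβ⟩ := pow_unbounded_of_one_lt (2 * L) one_lt_two
  set γ := β + 1 with hγ
  set B : ℝ := 2 * (1 + 4 * γ) with hB
  have hB0 : 0 < B := by positivity
  set K : ℝ := 1 + L ^ 5 * 4 ^ γ * B ^ (2 * γ) * 2 ^ (2 * β + 1) with hK
  have hL0 : 0 < L := by linarith
  have hK1 : 1 ≤ K := by rw [hK]; simp only [le_add_iff_nonneg_right]; positivity
  obtain ⟨k, hk⟩ := pow_unbounded_of_one_lt (K + 1) one_lt_two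
  refine ⟨B ^ (2 * γ) * 2 ^ (2 * γ + 1) * L ^ k, by positivity, fun ν _ hν n hn Z hZ hZS hcub x hx => ?_⟩
  have hn0 : (0 : ℝ) < n := by exact_mod_cast hn
  have hZ0 : (0 : ℝ) < Z.card := by exact_mod_cast hZ
  set m := (n - 1) / (2 * γ) with hm
  have hm1 : m * (2 * γ) ≤ n - 1 := Nat.div_mul_le_self _ _
  have hmn : m ≤ n := by nlinarith [Nat.sub_le n 1]
  have hdeg : ∀ y : EuclideanSpace ℝ (Fin d), (zonal m y ^ (2 * γ)).totalDegree ≤ n - 1 := fun y =>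
    (MvPolynomial.totalDegree_pow _ _).trans
      ((Nat.mul_le_mul_left _ (totalDegree_zonal_le m y)).trans (by linarith))
  have hpow2 : ∀ a b : ℕ, b ≤ a → 2 * L ≤ 2 ^ b → 2 * L ≤ (2 : ℝ) ^ a := fun a b hab h =>
    h.trans (pow_le_pow_right₀ one_le_two hab)
  have hZball : ∃ z ∈ Z, ‖x - z‖ < K / n := by
    by_contra! hfar
    obtain ⟨R, hR1, hR⟩ := exists_pEval_eq_sub_norm_sq d ((K / n) ^ 2) x hx
    have h1 := hcub (R * zonal m x ^ (2 * γ)) ((MvPolynomial.totalDegree_mul _ _).trans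
      (by have := hdeg x; omega))
    have h2 : ∫ y, pEval (R * zonal m x ^ (2 * γ)) y ∂ν ≤ 0 := by
      rw [h1]
      refine mul_nonpos_of_nonneg_of_nonpos (by positivity) (Finset.sum_nonpos fun z hz => ?_)
      rw [pEval_mul, hR z (hZS hz), pEval_pow, pow_mul]
      refine mul_nonpos_of_nonpos_of_nonneg ?_ (by positivity)
      have := hfar z hz
      have : (K / n) ^ 2 ≤ ‖x - z‖ ^ 2 := by gcongr
      linarith
    have hi : Integrable (pEval (zonal m x ^ (2 * γ))) ν :=
      hν.integrable_of_continuousOn (by fun_prop)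
    have h3 : ∫ y, pEval (R * zonal m x ^ (2 * γ)) y ∂ν =
        (K / n) ^ 2 * ∫ y, pEval (zonal m x ^ (2 * γ)) y ∂ν
          - ∫ y, ‖x - y‖ ^ 2 * pEval (zonal m x ^ (2 * γ)) y ∂ν := by
      rw [← integral_const_mul, ← integral_sub (hi.const_mul _)
        (hν.integrable_of_continuousOn (by fun_prop))]
      refine integral_congr_ae (hν.ae_mem.mono fun y hy => ?_)
      simp only [pEval_mul, hR y hy]
      ring
    have h4 : ∫ y, ‖x - y‖ ^ 2 * pEval (zonal m x ^ (2 * γ)) y ∂ν ≤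
        (B ^ (2 * γ) / n ^ 2) * (2 ^ (2 * β + 1) * ν.real (Metric.closedBall x (1 / n))) := by
      refine le_trans ?_ (mul_le_mul_of_nonneg_left
        (hν.integral_decay_le hx hn (hpow2 _ _ (by omega) hβ.le)) (by positivity))
      rw [← integral_const_mul]
      have hc : Continuous fun y : EuclideanSpace ℝ (Fin d) =>
          ((1 + (n : ℝ) * ‖x - y‖) ^ (2 * β))⁻¹ :=
        Continuous.inv₀ (by fun_prop) fun y => by positivity
      refine integral_mono_ae (hν.integrable_of_continuousOn (by fun_prop))
        ((hν.integrable_of_continuousOn hc).const_mul _) (hν.ae_mem.mono fun y hy => ?_)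
      simp only [pEval_pow]
      have h5 := abs_pEval_zonal_div_le (γ := γ) (by omega) hn hy hx
      rw [← hm] at h5
      have h6 : pEval (zonal m x) y ^ (2 * γ) ≤ (B / (1 + n * ‖x - y‖)) ^ (2 * γ) := by
        rw [← Even.pow_abs (even_two_mul γ)]
        gcongr
      calc _ ≤ ‖x - y‖ ^ 2 * (B / (1 + n * ‖x - y‖)) ^ (2 * γ) := by gcongr
        _ = (B ^ (2 * γ) / n ^ 2) * ((1 + n * ‖x - y‖) ^ (2 * β))⁻¹ *
            ((n * ‖x - y‖) / (1 + n * ‖x - y‖)) ^ 2 := by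
            rw [div_pow, div_pow, show 2 * γ = 2 * β + 2 by omega, pow_add (1 + n * ‖x - y‖)]
            field_simp
        _ ≤ (B ^ (2 * γ) / n ^ 2) * ((1 + n * ‖x - y‖) ^ (2 * β))⁻¹ * 1 := by
            gcongr
            refine pow_le_one₀ (by positivity) ?_
            rw [div_le_one (by positivity)]
            linarith
        _ = _ := mul_one _
    have h7 := hν.le_integral_pEval_zonal_pow hx hn γ hmn
    have hpos := hν.measureReal_closedBall_pos hx (r := 1 / n) (by positivity)
    have h8 : K ^ 2 * ∫ y, pEval (zonal m x ^ (2 * γ)) y ∂ν ≤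
        B ^ (2 * γ) * 2 ^ (2 * β + 1) * ν.real (Metric.closedBall x (1 / n)) := by
      have h9 : (K / n) ^ 2 * ∫ y, pEval (zonal m x ^ (2 * γ)) y ∂ν ≤
        (B ^ (2 * γ) / n ^ 2) * (2 ^ (2 * β + 1) * ν.real (Metric.closedBall x (1 / n))) := by
        linarith
      rw [div_pow, div_mul_eq_mul_div, div_mul_eq_mul_div,
        div_le_div_iff_of_pos_right (by positivity)] at h9
      linarith
    have h10 : K ^ 2 * ν.real (Metric.closedBall x (1 / n)) ≤
        (K - 1) * ν.real (Metric.closedBall x (1 / n)) := by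
      calc _ ≤ K ^ 2 * (L ^ 5 * 4 ^ γ * ∫ y, pEval (zonal m x ^ (2 * γ)) y ∂ν) := by gcongr
        _ = L ^ 5 * 4 ^ γ * (K ^ 2 * ∫ y, pEval (zonal m x ^ (2 * γ)) y ∂ν) := by ring
        _ ≤ L ^ 5 * 4 ^ γ *
            (B ^ (2 * γ) * 2 ^ (2 * β + 1) * ν.real (Metric.closedBall x (1 / n))) := by gcongr
        _ = _ := by rw [hK]; ring
    have := le_of_mul_le_mul_right h10 hpos
    nlinarith
  obtain ⟨z, hz, hxz⟩ := hZball
  have hzS := hZS hz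
  have h1 := hcub (zonal m z ^ (2 * γ)) ((hdeg z).trans (Nat.sub_le _ _))
  have h2 : 1 ≤ ∑ w ∈ Z, pEval (zonal m z ^ (2 * γ)) w := by
    refine le_trans (le_of_eq ?_) (Finset.single_le_sum (fun w _ => ?_) hz)
    · rw [pEval_pow, pEval_zonal_self m hzS, one_pow]
    · rw [pEval_pow, pow_mul]; positivity
  have h3 : ∫ y, pEval (zonal m z ^ (2 * γ)) y ∂ν ≤
      B ^ (2 * γ) * (2 ^ (2 * γ + 1) * ν.real (Metric.closedBall z (1 / n))) := by
    refine le_trans ?_ (mul_le_mul_of_nonneg_left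
      (hν.integral_decay_le hzS hn (hpow2 _ _ (by omega) hβ.le)) (by positivity))
    rw [← integral_const_mul]
    have hc : Continuous fun y : EuclideanSpace ℝ (Fin d) =>
        ((1 + (n : ℝ) * ‖z - y‖) ^ (2 * γ))⁻¹ :=
      Continuous.inv₀ (by fun_prop) fun y => by positivity
    refine integral_mono_ae (hν.integrable_of_continuousOn (by fun_prop))
      ((hν.integrable_of_continuousOn hc).const_mul _) (hν.ae_mem.mono fun y hy => ?_)
    simp only [pEval_pow]
    have h5 := abs_pEval_zonal_div_le (γ := γ) (by omega) hn hy hzS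
    rw [← hm] at h5
    rw [← Even.pow_abs (even_two_mul γ), ← div_eq_mul_inv, ← div_pow]
    gcongr
  have h4 : ν.real (Metric.closedBall z (1 / n)) ≤ L ^ k * ν.real (Metric.closedBall x (1 / n)) := by
    refine le_trans (measureReal_mono (Metric.closedBall_subset_closedBall' (ε₂ := (K + 1) / n) ?_))
      (hν.measureReal_closedBall_le hx (by positivity) k ?_)
    · rw [dist_eq_norm, norm_sub_rev, add_div, add_comm]
      gcongr
    · rw [mul_one_div]
      gcongr
  have h5 : 1 ≤ Z.card * ∫ y, pEval (zonal m z ^ (2 * γ)) y ∂ν := by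
    rw [h1, ← mul_assoc, mul_one_div_cancel hZ0.ne', one_mul]
    exact h2
  calc (1 : ℝ) ≤ _ := h5
    _ ≤ Z.card * (B ^ (2 * γ) * (2 ^ (2 * γ + 1) *
        (L ^ k * ν.real (Metric.closedBall x (1 / n))))) := by
        gcongr
        exact h3.trans (by gcongr)
    _ = _ := by ring

end SphereDoubling

end LowerBound

section Nets

/-- A compact set contains a finite `r`-separated `r`-net. -/
lemma exists_finset_net {X : Type*} [PseudoMetricSpace X] {s : Set X} (hs : IsCompact s) {r : ℝ}
    (hr : 0 < r) : ∃ V : Finset X, ↑V ⊆ s ∧ (∀ u ∈ V, ∀ v ∈ V, u ≠ v → r < dist u v) ∧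
      ∀ x ∈ s, ∃ v ∈ V, dist x v ≤ r := by
  classical
  obtain ⟨T, -, hT, hcov⟩ := hs.finite_cover_balls (half_pos hr)
  lift T to Finset X using hT
  let p : ℕ → Prop := fun k => ∃ V : Finset X, V.card = k ∧ ↑V ⊆ s ∧
    ∀ u ∈ V, ∀ v ∈ V, u ≠ v → r < dist u v
  have hp : ∀ k, p k → k ≤ T.card := by
    rintro _ ⟨V, rfl, hV, hsep⟩
    have hc : ∀ v ∈ V, ∃ t ∈ T, dist v t < r / 2 := fun v hv => by
      simpa using hcov (hV hv)
    choose! f hf hfd using hc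
    refine Finset.card_le_card_of_injOn f hf fun u hu v hv huv => ?_
    by_contra hne
    have h1 := hsep u hu v hv hne
    have h2 := dist_triangle_right u v (f u)
    have h3 := hfd u hu
    have h4 := hfd v hv
    rw [← huv] at h4
    linarith
  obtain ⟨V, hcard, hV, hsep⟩ : p (Nat.findGreatest p T.card) :=
    Nat.findGreatest_spec (m := 0) (Nat.zero_le _) ⟨∅, by simp⟩
  refine ⟨V, hV, hsep, fun x hx => ?_⟩
  by_contra! h
  have hxV : x ∉ V := fun hxV => by have := h x hxV; rw [dist_self] at this; linarith
  have hins : p (V.card + 1) := by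
    refine ⟨insert x V, Finset.card_insert_of_notMem hxV, ?_, ?_⟩
    · rw [Finset.coe_insert]; exact insert_subset hx hV
    · intro u hu v hv huv
      rcases Finset.mem_insert.1 hu with hu' | hu' <;>
        rcases Finset.mem_insert.1 hv with hv' | hv'
      · exact absurd (hu'.trans hv'.symm) huv
      · rw [hu']; exact h v hv'
      · rw [hv', dist_comm]; exact h u hu'
      · exact hsep u hu' v hv' huv
  have := Nat.le_findGreatest (hp _ hins) hins
  omega

/-- The proximity graph of a net of a preconnected set is connected. -/
lemma exists_dist_le_of_net {X : Type*} [PseudoMetricSpace X] {s : Set X} (hs : IsPreconnected s)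
    {r : ℝ} (hr : 0 ≤ r) {V W : Finset X} (hVs : ↑V ⊆ s) (hV : ∀ x ∈ s, ∃ v ∈ V, dist x v ≤ r)
    (hWV : W ⊆ V) (hW : W.Nonempty) (hne : W ≠ V) :
    ∃ u ∈ W, ∃ v ∈ V, v ∉ W ∧ dist v u ≤ 2 * r := by
  classical
  have hcl : ∀ U : Finset X, IsClosed (⋃ u ∈ U, Metric.closedBall u r) := fun U =>
    U.finite_toSet.isClosed_biUnion fun _ _ => Metric.isClosed_closedBall
  obtain ⟨w, hw⟩ := hW
  obtain ⟨v, hv, hvW⟩ := Finset.exists_of_ssubset (hWV.ssubset_of_ne hne)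
  obtain ⟨x, -, hx1, hx2⟩ := isPreconnected_closed_iff.1 hs _ _ (hcl W) (hcl (V \ W))
    (fun x hx => by
      obtain ⟨v, hv, hxv⟩ := hV x hx
      by_cases hvW : v ∈ W
      · exact Or.inl (mem_iUnion₂.2 ⟨v, hvW, hxv⟩)
      · exact Or.inr (mem_iUnion₂.2 ⟨v, Finset.mem_sdiff.2 ⟨hv, hvW⟩, hxv⟩))
    ⟨w, hVs (hWV hw), mem_iUnion₂.2 ⟨w, hw, Metric.mem_closedBall_self hr⟩⟩
    ⟨v, hVs hv, mem_iUnion₂.2 ⟨v, Finset.mem_sdiff.2 ⟨hv, hvW⟩, Metric.mem_closedBall_self hr⟩⟩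
  obtain ⟨u, hu, hxu⟩ := mem_iUnion₂.1 hx1
  obtain ⟨v', hv', hxv⟩ := mem_iUnion₂.1 hx2
  rw [Finset.mem_sdiff] at hv'
  refine ⟨u, hu, v', hv'.1, hv'.2, ?_⟩
  have := dist_triangle_left v' u x
  rw [Metric.mem_closedBall] at hxu hxv
  linarith

/-- Weights with integral sum on a connected graph can be rounded to integers by moving less than
one unit of mass along the edges of a spanning tree. -/
lemma exists_rounding {ι : Type*} (adj : ι → ι → Prop) (V : Finset ι) (hV : V.Nonempty)
    (hconn : ∀ W ⊆ V, W.Nonempty → W ≠ V → ∃ u ∈ W, ∃ v ∈ V, v ∉ W ∧ adj v u)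
    (a : ι → ℝ) (ha : ∀ v ∈ V, 0 ≤ a v) (N : ℕ) (hN : ∑ v ∈ V, a v = N) :
    ∃ b : ι → ℕ, ∑ v ∈ V, b v = N ∧ ∀ φ ψ : ι → ℝ, (∀ v ∈ V, 0 ≤ ψ v) →
      (∀ u ∈ V, ∀ v ∈ V, adj v u → |φ v - φ u| ≤ ψ v) →
      |∑ v ∈ V, (b v - a v) * φ v| ≤ ∑ v ∈ V, ψ v := by
  classical
  let p : Finset ι → Prop := fun W => W ⊆ V ∧ W.Nonempty ∧ ∀ a : ι → ℝ, (∀ v ∈ W, 0 ≤ a v) →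
    ∀ N : ℕ, ∑ v ∈ W, a v = N → ∃ b : ι → ℕ, ∑ v ∈ W, b v = N ∧ ∀ φ ψ : ι → ℝ,
      (∀ v ∈ W, 0 ≤ ψ v) → (∀ u ∈ W, ∀ v ∈ W, adj v u → |φ v - φ u| ≤ ψ v) →
      |∑ v ∈ W, (b v - a v) * φ v| ≤ ∑ v ∈ W, ψ v
  obtain ⟨v₀, hv₀⟩ := hV
  have h0 : p {v₀} := by
    refine ⟨by simpa using hv₀, by simp, fun a _ N hN => ⟨fun _ => N, by simp, fun φ ψ hψ _ => ?_⟩⟩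
    have hN' : a v₀ = N := by simpa using hN
    simpa [hN'] using hψ
  obtain ⟨W, hW, hmax⟩ := Finset.exists_max_image (V.powerset.filter p) Finset.card
    ⟨{v₀}, by simpa using ⟨hv₀, h0⟩⟩
  obtain ⟨hWV, hWne, hWp⟩ := (Finset.mem_filter.1 hW).2
  by_cases hWeq : W = V
  · subst hWeq; exact hWp a ha N hN
  exfalso
  obtain ⟨u, hu, v, hv, hvW, hvu⟩ := hconn W hWV hWne hWeq
  have hvu' : u ≠ v := fun h => hvW (h ▸ hu)
  have hins : p (insert v W) := by
    refine ⟨Finset.insert_subset hv hWV, by simp, fun a ha N hN => ?_⟩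
    have hav : 0 ≤ a v := ha v (Finset.mem_insert_self _ _)
    set e : ℝ := a v - ⌊a v⌋₊ with he
    have he0 : 0 ≤ e := sub_nonneg.2 (Nat.floor_le hav)
    have he1 : e ≤ 1 := by have := Nat.lt_floor_add_one (a v); linarith
    rw [Finset.sum_insert hvW] at hN
    have hWa : 0 ≤ ∑ w ∈ W, a w :=
      Finset.sum_nonneg fun w hw => ha w (Finset.mem_insert_of_mem hw)
    have hle : ⌊a v⌋₊ ≤ N := by
      have : (⌊a v⌋₊ : ℝ) ≤ N := by linarith
      exact_mod_cast this
    have hsum : ∑ w ∈ W, (a w + if w = u then e else 0) = ((N - ⌊a v⌋₊ : ℕ) : ℝ) := by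
      rw [Finset.sum_add_distrib, Finset.sum_ite_eq' W u, if_pos hu, Nat.cast_sub hle]
      linarith
    obtain ⟨b, hbN, hb⟩ := hWp (fun w => a w + if w = u then e else 0)
      (fun w hw => add_nonneg (ha w (Finset.mem_insert_of_mem hw)) (by split_ifs <;> simp [he0]))
      _ hsum
    have hne : ∀ w ∈ W, w ≠ v := fun w hw h => hvW (h ▸ hw)
    refine ⟨fun w => if w = v then ⌊a v⌋₊ else b w, ?_, fun φ ψ hψ hφ => ?_⟩
    · rw [Finset.sum_insert hvW, if_pos rfl,
        Finset.sum_congr rfl fun w hw => if_neg (hne w hw), hbN]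
      omega
    have h1 := hb φ ψ (fun w hw => hψ w (Finset.mem_insert_of_mem hw))
      fun x hx y hy => hφ x (Finset.mem_insert_of_mem hx) y (Finset.mem_insert_of_mem hy)
    have h2 := hφ u (Finset.mem_insert_of_mem hu) v (Finset.mem_insert_self _ _) hvu
    have h3 : ∑ w ∈ insert v W, (((if w = v then ⌊a v⌋₊ else b w : ℕ) : ℝ) - a w) * φ w =
        e * (φ u - φ v) + ∑ w ∈ W, (b w - (a w + if w = u then e else 0)) * φ w := by
      have h4 : ∑ w ∈ W, (if w = u then e else 0) * φ w = e * φ u := by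
        simp [ite_mul, hu]
      have h5 : ∑ w ∈ W, (((if w = v then ⌊a v⌋₊ else b w : ℕ) : ℝ) - a w) * φ w =
          ∑ w ∈ W, (b w - (a w + if w = u then e else 0)) * φ w +
            ∑ w ∈ W, (if w = u then e else 0) * φ w := by
        rw [← Finset.sum_add_distrib]
        refine Finset.sum_congr rfl fun w hw => ?_
        rw [if_neg (hne w hw)]
        ring
      rw [Finset.sum_insert hvW, if_pos rfl, h5, h4, he]
      ring
    rw [h3, Finset.sum_insert hvW]
    refine (abs_add_le _ _).trans (add_le_add ?_ h1)
    rw [abs_mul, abs_of_nonneg he0, abs_sub_comm]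
    nlinarith [abs_nonneg (φ v - φ u)]
  have h1 := hmax (insert v W) (Finset.mem_filter.2 ⟨Finset.mem_powerset.2 hins.1, hins⟩)
  rw [Finset.card_insert_of_notMem hvW] at h1
  omega

/-- A set covered by the balls around a finite net splits into measurable pieces, one in each
ball. -/
lemma exists_partition_net {X : Type*} [PseudoMetricSpace X] [MeasurableSpace X]
    [OpensMeasurableSpace X] {s : Set X} {V : Finset X} {r : ℝ}
    (hV : ∀ x ∈ s, ∃ v ∈ V, dist x v ≤ r) : ∃ R : X → Set X, (∀ v, MeasurableSet (R v)) ∧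
      (∀ v, R v ⊆ Metric.closedBall v r) ∧ (↑V : Set X).PairwiseDisjoint R ∧
      s ⊆ ⋃ v ∈ V, R v := by
  classical
  induction V using Finset.induction_on generalizing s with
  | empty =>
    refine ⟨fun _ => ∅, by simp, by simp, by simp, fun x hx => ?_⟩
    obtain ⟨v, hv, -⟩ := hV x hx
    simp at hv
  | insert a V ha ih =>
    obtain ⟨R, hRm, hRb, hRd, hRs⟩ := ih (s := s \ Metric.closedBall a r) fun x hx => by
      obtain ⟨v, hv, hxv⟩ := hV x hx.1
      rcases Finset.mem_insert.1 hv with rfl | hv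
      · exact absurd hxv hx.2
      · exact ⟨v, hv, hxv⟩
    have hne : ∀ v ∈ V, v ≠ a := fun v hv h => ha (h ▸ hv)
    refine ⟨fun v => if v = a then Metric.closedBall a r else R v \ Metric.closedBall a r,
      fun v => ?_, fun v => ?_, ?_, fun x hx => ?_⟩
    · dsimp only
      split_ifs
      · exact Metric.isClosed_closedBall.measurableSet
      · exact (hRm v).diff Metric.isClosed_closedBall.measurableSet
    · dsimp only
      split_ifs with h
      · rw [h]
      · exact sdiff_subset.trans (hRb v)
    · rw [Finset.coe_insert, Set.pairwiseDisjoint_insert]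
      refine ⟨fun u hu v hv huv => ?_, fun v hv hav => ?_⟩
      · simp only [Function.onFun, if_neg (hne u hu), if_neg (hne v hv)]
        exact (hRd hu hv huv).mono sdiff_subset sdiff_subset
      · simp only [if_true, if_neg (hne v hv)]
        exact disjoint_sdiff_self_right
    · by_cases hxa : x ∈ Metric.closedBall a r
      · exact mem_iUnion₂.2 ⟨a, Finset.mem_insert_self _ _, by simpa using hxa⟩
      · obtain ⟨v, hv, hxv⟩ := mem_iUnion₂.1 (hRs ⟨hx, hxa⟩)
        exact mem_iUnion₂.2 ⟨v, Finset.mem_insert_of_mem hv, by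
          simp only [if_neg (hne v hv)]; exact ⟨hxv, hxa⟩⟩

end Nets

section Rotations

variable {x y z : EuclideanSpace ℝ (Fin d)} {P : MvPolynomial (Fin d) ℝ} {n : ℕ}

lemma hasDerivAt_coord {γ : ℝ → EuclideanSpace ℝ (Fin d)} {γ' : EuclideanSpace ℝ (Fin d)} {t : ℝ}
    (h : HasDerivAt γ γ' t) (i : Fin d) : HasDerivAt (fun s => γ s i) (γ' i) t :=
  (EuclideanSpace.proj (𝕜 := ℝ) i).hasFDerivAt.comp_hasDerivAt t h

lemma hasDerivAt_pEval (P : MvPolynomial (Fin d) ℝ) {γ : ℝ → EuclideanSpace ℝ (Fin d)}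
    {γ' : EuclideanSpace ℝ (Fin d)} {t : ℝ} (h : HasDerivAt γ γ' t) :
    HasDerivAt (fun s => pEval P (γ s)) (∑ i, γ' i * pEval (MvPolynomial.pderiv i P) (γ t)) t := by
  induction P using MvPolynomial.induction_on with
  | C a => simpa using hasDerivAt_const t a
  | add P Q hP hQ =>
    simp only [map_add, pEval_add, mul_add, Finset.sum_add_distrib]
    exact hP.add hQ
  | mul_X P k hP =>
    simp only [pEval_mul, pEval_X]
    refine (hP.mul (hasDerivAt_coord h k)).congr_deriv ?_
    simp only [Derivation.leibniz, smul_eq_mul, pEval_add, pEval_mul, pEval_X, mul_add,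
      Finset.sum_add_distrib, MvPolynomial.pderiv_X]
    have h1 : ∀ i, pEval (Pi.single (M := fun _ => MvPolynomial (Fin d) ℝ) i 1 k) (γ t) =
        if i = k then 1 else 0 := fun i => by
      rw [Pi.single_apply]
      by_cases hik : k = i <;> simp [hik, eq_comm]
    simp only [h1]
    simp [Finset.sum_mul]
    rw [add_comm]
    congr 1
    · ring
    · exact Finset.sum_congr rfl fun i _ => by ring

/-- The derivative of `P` along the rotations of the plane spanned by the coordinates `i`, `j`. -/
def rotDeriv (i j : Fin d) (P : MvPolynomial (Fin d) ℝ) : MvPolynomial (Fin d) ℝ :=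
  MvPolynomial.X i * MvPolynomial.pderiv j P - MvPolynomial.X j * MvPolynomial.pderiv i P

lemma totalDegree_X_mul_pderiv_le (i j : Fin d) (P : MvPolynomial (Fin d) ℝ) :
    (MvPolynomial.X i * MvPolynomial.pderiv j P).totalDegree ≤ P.totalDegree := by
  conv_lhs => rw [P.as_sum, map_sum, Finset.mul_sum]
  refine MvPolynomial.totalDegree_finsetSum_le fun m hm => ?_
  rw [MvPolynomial.pderiv_monomial]
  rcases Nat.eq_zero_or_pos (m j) with h | h
  · simp [h]
  refine (MvPolynomial.totalDegree_mul _ _).trans ?_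
  rw [MvPolynomial.totalDegree_X]
  have h1 : (m - Finsupp.single j 1).degree + 1 = m.degree := by
    have h2 : m - Finsupp.single j 1 + Finsupp.single j 1 = m :=
      tsub_add_cancel_of_le (Finsupp.single_le_iff.2 h)
    conv_rhs => rw [← h2]
    simp
  have h3 := MvPolynomial.totalDegree_monomial_le (m - Finsupp.single j 1)
    (MvPolynomial.coeff m P * (m j : ℝ))
  have h4 := MvPolynomial.le_totalDegree hm
  simp only [Finsupp.degree_apply, Finsupp.sum, id_eq] at h1 h3 h4
  omega

lemma totalDegree_rotDeriv_le (i j : Fin d) (hP : P.totalDegree ≤ n) :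
    (rotDeriv i j P).totalDegree ≤ n :=
  (MvPolynomial.totalDegree_sub _ _).trans
    (max_le ((totalDegree_X_mul_pderiv_le i j P).trans hP)
      ((totalDegree_X_mul_pderiv_le j i P).trans hP))

lemma pEval_rotDeriv (i j : Fin d) : pEval (rotDeriv i j P) x =
    x i * pEval (MvPolynomial.pderiv j P) x - x j * pEval (MvPolynomial.pderiv i P) x := by
  simp [rotDeriv]

/-- The rotation by the angle `s` of the plane spanned by the coordinates `i`, `j`. -/
def planeRot (i j : Fin d) (s : ℝ) (y : EuclideanSpace ℝ (Fin d)) : EuclideanSpace ℝ (Fin d) :=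
  WithLp.toLp 2 fun k => if k = i then cos s * y i - sin s * y j else
    if k = j then sin s * y i + cos s * y j else y k

lemma planeRot_zero (i j : Fin d) : planeRot i j 0 y = y := by
  ext k
  by_cases hi : k = i <;> by_cases hj : k = j <;> simp_all [planeRot]

lemma planeRot_sub (i j : Fin d) (s : ℝ) :
    planeRot i j s x - planeRot i j s y = planeRot i j s (x - y) := by
  ext k
  simp only [planeRot, PiLp.sub_apply]
  split_ifs <;> ring

lemma sum_eq_add_add_of_ne {i j : Fin d} (hij : i ≠ j) (f : Fin d → ℝ) :
    ∑ k, f k = f i + f j + ∑ k ∈ {i, j}ᶜ, f k := by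
  rw [← Finset.sum_add_sum_compl {i, j} f, Finset.sum_pair hij]

lemma norm_planeRot {i j : Fin d} (hij : i ≠ j) (s : ℝ) : ‖planeRot i j s y‖ = ‖y‖ := by
  rw [EuclideanSpace.norm_eq, EuclideanSpace.norm_eq, sum_eq_add_add_of_ne hij,
    sum_eq_add_add_of_ne hij (fun k => ‖y k‖ ^ 2)]
  congr 2
  · simp [planeRot, hij.symm]
    linear_combination (y i ^ 2 + y j ^ 2) * (sin_sq_add_cos_sq s)
  · refine Finset.sum_congr rfl fun k hk => ?_
    simp only [Finset.mem_compl, Finset.mem_insert, Finset.mem_singleton, not_or] at hk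
    simp [planeRot, hk.1, hk.2]

lemma planeRot_mem {i j : Fin d} (hij : i ≠ j) (s : ℝ) (hy : y ∈ unitSphere d) :
    planeRot i j s y ∈ unitSphere d :=
  mem_unitSphere_of_norm ((norm_planeRot hij s).trans (norm_eq_one_of_mem_unitSphere hy))

lemma hasDerivAt_planeRot {i j : Fin d} (hij : i ≠ j) (s : ℝ) :
    HasDerivAt (fun s => planeRot i j s y) (-(planeRot i j s y j) • EuclideanSpace.single i 1 +
      planeRot i j s y i • EuclideanSpace.single j 1) s := by
  have h : HasDerivAt (fun s => (planeRot i j s y).ofLp) (-(planeRot i j s y j) •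
      EuclideanSpace.single i 1 + planeRot i j s y i • EuclideanSpace.single j 1 :
        EuclideanSpace ℝ (Fin d)).ofLp s := by
    rw [hasDerivAt_pi]
    intro k
    by_cases hi : k = i
    · subst hi
      simp only [planeRot, if_true, if_neg hij.symm]
      refine (((hasDerivAt_cos s).mul_const _).sub ((hasDerivAt_sin s).mul_const _)).congr_deriv ?_
      simp [hij]
      ring
    by_cases hj : k = j
    · subst hj
      simp only [planeRot, if_true, if_neg hij.symm]
      refine (((hasDerivAt_sin s).mul_const _).add ((hasDerivAt_cos s).mul_const _)).congr_deriv ?_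
      simp [hij.symm]
      ring
    · simpa [planeRot, hi, hj, hij.symm] using hasDerivAt_const s (y k)
  exact (PiLp.continuousLinearEquiv 2 ℝ fun _ => ℝ).symm.hasFDerivAt.comp_hasDerivAt s h

lemma hasDerivAt_pEval_planeRot {i j : Fin d} (hij : i ≠ j) (P : MvPolynomial (Fin d) ℝ) (s : ℝ) :
    HasDerivAt (fun s => pEval P (planeRot i j s y)) (pEval (rotDeriv i j P) (planeRot i j s y))
      s := by
  refine (hasDerivAt_pEval P (hasDerivAt_planeRot hij s)).congr_deriv ?_
  rw [sum_eq_add_add_of_ne hij, Finset.sum_eq_zero, pEval_rotDeriv]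
  · simp [hij, hij.symm]
    ring
  · intro k hk
    simp only [Finset.mem_compl, Finset.mem_insert, Finset.mem_singleton, not_or] at hk
    simp [hk.1, hk.2]

lemma norm_planeRot_sub_le {i j : Fin d} (hij : i ≠ j) (s t : ℝ) (hy : y ∈ unitSphere d) :
    ‖planeRot i j s y - planeRot i j t y‖ ≤ |s - t| := by
  have h : ∀ u ∈ (univ : Set ℝ), ‖-(planeRot i j u y j) • EuclideanSpace.single i (1 : ℝ) +
      planeRot i j u y i • EuclideanSpace.single j (1 : ℝ)‖ ≤ 1 := by
    intro u _
    refine abs_le_one_iff_mul_self_le_one.2 ?_ |> le_of_abs_le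
    have h1 := norm_eq_one_of_mem_unitSphere (planeRot_mem hij u hy)
    rw [EuclideanSpace.norm_eq, Real.sqrt_eq_one, sum_eq_add_add_of_ne hij] at h1
    have h2 : 0 ≤ ∑ k ∈ {i, j}ᶜ, ‖planeRot i j u y k‖ ^ 2 := by positivity
    generalize ∑ k ∈ {i, j}ᶜ, ‖planeRot i j u y k‖ ^ 2 = a at h1 h2
    rw [← pow_two, EuclideanSpace.norm_sq_eq, sum_eq_add_add_of_ne hij, Finset.sum_eq_zero]
    · simp [hij, hij.symm] at h1 ⊢
      linarith
    · intro k hk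
      simp only [Finset.mem_compl, Finset.mem_insert, Finset.mem_singleton, not_or] at hk
      simp [hk.1, hk.2]
  simpa using Convex.norm_image_sub_le_of_norm_hasDerivWithin_le
    (fun u _ => (hasDerivAt_planeRot hij u).hasDerivWithinAt) h convex_univ (mem_univ t) (mem_univ s)

lemma continuous_planeRot (i j : Fin d) :
    Continuous fun p : ℝ × EuclideanSpace ℝ (Fin d) => planeRot i j p.1 p.2 := by
  refine (PiLp.continuous_toLp 2 _).comp (continuous_pi fun k => ?_)
  split_ifs <;> fun_prop

end Rotations

section RotationProducts

variable {x y z v : EuclideanSpace ℝ (Fin d)} {P : MvPolynomial (Fin d) ℝ}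

/-- Ordered pairs of distinct coordinates. -/
abbrev CoordPair (d : ℕ) : Type := {p : Fin d × Fin d // p.1 ≠ p.2}

/-- The composition of the coordinate rotations by the angles `s l`, for `l` in a list. -/
def rotList (s : CoordPair d → ℝ) (ls : List (CoordPair d)) (y : EuclideanSpace ℝ (Fin d)) :
    EuclideanSpace ℝ (Fin d) :=
  ls.foldl (fun z l => planeRot l.1.1 l.1.2 (s l) z) y

lemma rotList_cons (s : CoordPair d → ℝ) (l : CoordPair d) (ls : List (CoordPair d)) :
    rotList s (l :: ls) y = rotList s ls (planeRot l.1.1 l.1.2 (s l) y) := rfl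

lemma rotList_mem (s : CoordPair d → ℝ) (ls : List (CoordPair d)) (hy : y ∈ unitSphere d) :
    rotList s ls y ∈ unitSphere d := by
  induction ls generalizing y with
  | nil => exact hy
  | cons l ls ih => exact ih (planeRot_mem l.2 _ hy)

lemma norm_rotList_sub (s : CoordPair d → ℝ) (ls : List (CoordPair d)) :
    ‖rotList s ls y - rotList s ls z‖ = ‖y - z‖ := by
  induction ls generalizing y z with
  | nil => rfl
  | cons l ls ih => rw [rotList_cons, rotList_cons, ih, planeRot_sub, norm_planeRot l.2]

lemma norm_rotList_sub_le (s t : CoordPair d → ℝ) (ls : List (CoordPair d))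
    (hy : y ∈ unitSphere d) :
    ‖rotList s ls y - rotList t ls y‖ ≤ (ls.map fun l => |s l - t l|).sum := by
  induction ls generalizing y with
  | nil => simp [rotList]
  | cons l ls ih =>
    rw [rotList_cons, rotList_cons, List.map_cons, List.sum_cons]
    refine (norm_sub_le_norm_sub_add_norm_sub _
      (rotList s ls (planeRot l.1.1 l.1.2 (t l) y)) _).trans (add_le_add ?_ ?_)
    · rw [norm_rotList_sub]
      exact norm_planeRot_sub_le l.2 _ _ hy
    · exact ih (planeRot_mem l.2 _ hy)

lemma continuous_rotList {X : Type*} [TopologicalSpace X] {s : X → CoordPair d → ℝ}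
    (hs : ∀ l, Continuous fun c => s c l) (ls : List (CoordPair d))
    {f : X → EuclideanSpace ℝ (Fin d)} (hf : Continuous f) :
    Continuous fun c => rotList (s c) ls (f c) := by
  induction ls generalizing f with
  | nil => exact hf
  | cons l ls ih =>
    simp only [rotList_cons]
    have h := (continuous_planeRot l.1.1 l.1.2).comp ((hs l).prodMk hf)
    simp only [Function.comp_def] at h
    exact ih h

lemma abs_pEval_planeRot_sub_le {i j : Fin d} (hij : i ≠ j) {s κ r a : ℝ} (hy : y ∈ unitSphere d)
    (hκ : ∀ z ∈ unitSphere d, ‖z - v‖ ≤ r → |pEval (rotDeriv i j P) z - a| ≤ κ)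
    (hr : |s| + ‖y - v‖ ≤ r) :
    |pEval P (planeRot i j s y) - pEval P y - s * a| ≤ |s| * κ := by
  have h := (convex_uIcc (0 : ℝ) s).norm_image_sub_le_of_norm_hasDerivWithin_le
    (f := fun u => pEval P (planeRot i j u y) - u * a) (C := κ)
    (fun u _ => ((hasDerivAt_pEval_planeRot hij P u).sub
      ((hasDerivAt_id u).mul_const a)).hasDerivWithinAt) (fun u hu => ?_) left_mem_uIcc
    right_mem_uIcc
  · simpa [planeRot_zero, sub_right_comm, mul_comm] using h
  · rw [Real.norm_eq_abs, one_mul]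
    refine hκ _ (planeRot_mem hij _ hy) ((norm_sub_le_norm_sub_add_norm_sub _ y _).trans ?_)
    have h1 := norm_planeRot_sub_le hij u 0 hy
    rw [planeRot_zero, sub_zero] at h1
    have h2 := abs_sub_left_of_mem_uIcc hu
    rw [sub_zero, sub_zero] at h2
    linarith

lemma le_pEval_rotList_sub {κ r : ℝ} (s : CoordPair d → ℝ) (ls : List (CoordPair d))
    (hy : y ∈ unitSphere d)
    (hκ : ∀ l : CoordPair d, ∀ z ∈ unitSphere d, ‖z - v‖ ≤ r →
      |pEval (rotDeriv l.1.1 l.1.2 P) z - pEval (rotDeriv l.1.1 l.1.2 P) v| ≤ κ)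
    (hr : (ls.map fun l => |s l|).sum + ‖y - v‖ ≤ r) :
    (ls.map fun l => s l * pEval (rotDeriv l.1.1 l.1.2 P) v - |s l| * κ).sum ≤
      pEval P (rotList s ls y) - pEval P y := by
  induction ls generalizing y with
  | nil => simp [rotList]
  | cons l ls ih =>
    rw [List.map_cons, List.sum_cons] at hr ⊢
    have h0 : 0 ≤ (ls.map fun l => |s l|).sum := List.sum_nonneg fun a ha => by
      obtain ⟨l, -, rfl⟩ := List.mem_map.1 ha
      exact abs_nonneg _
    have h1 := abs_pEval_planeRot_sub_le l.2 (s := s l) hy (hκ l) (by linarith)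
    have h2 := norm_planeRot_sub_le l.2 (s l) 0 hy
    rw [planeRot_zero, sub_zero] at h2
    have h3 := norm_sub_le_norm_sub_add_norm_sub (planeRot l.1.1 l.1.2 (s l) y) y v
    have h4 := ih (planeRot_mem l.2 (s l) hy) (by linarith)
    rw [rotList_cons]
    linarith [(abs_le.1 h1).1]

lemma sum_mul_eq_sum_coordPair {y u D : Fin d → ℝ} (hy : ∑ i, y i * y i = 1)
    (hu : ∑ i, y i * u i = 0) : ∑ i, u i * D i =
      ∑ l : CoordPair d, y l.1.1 * u l.1.2 * (y l.1.1 * D l.1.2 - y l.1.2 * D l.1.1) := by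
  rw [← Finset.sum_subtype (Finset.univ.filter fun p : Fin d × Fin d => p.1 ≠ p.2) (by simp)
    fun p => y p.1 * u p.2 * (y p.1 * D p.2 - y p.2 * D p.1), Finset.sum_filter_of_ne,
    ← Finset.univ_product_univ, Finset.sum_product]
  · have h1 : ∀ i j, y i * u j * (y i * D j - y j * D i) =
        y i * y i * (u j * D j) - y i * D i * (y j * u j) := fun i j => by ring
    simp only [h1, Finset.sum_sub_distrib, ← Finset.mul_sum, hu, mul_zero,
      sub_zero, ← Finset.sum_mul, hy, one_mul]
  · intro p _ h hp
    exact h (by rw [hp, sub_self, mul_zero])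

/-- The oscillation of a polynomial is controlled by its derivatives along coordinate rotations. -/
lemma abs_pEval_sub_le_of_rotDeriv (hx : x ∈ unitSphere d) (hy : y ∈ unitSphere d) (hxy : y ≠ -x)
    {B : ℝ} (hB : ∀ z ∈ unitSphere d, ‖z - x‖ ≤ 2 * ‖x - y‖ →
      ∑ l : CoordPair d, |pEval (rotDeriv l.1.1 l.1.2 P) z| ≤ B) :
    |pEval P y - pEval P x| ≤ 2 * ‖x - y‖ * B := by
  rcases eq_or_ne y x with rfl | hne
  · simp
  obtain ⟨v, hv, hxv, hyv⟩ := exists_eq_cos_smul_add_sin_smul hx hy hne hxy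
  set θ := gdist x y with hθ
  have hx1 := norm_eq_one_of_mem_unitSphere hx
  have hθ0 : 0 ≤ θ := arccos_nonneg _
  have hθ1 : θ ≤ 2 * ‖x - y‖ := (gdist_le_norm_sub hx hy).trans
    (mul_le_mul_of_nonneg_right (by linarith [pi_le_four]) (norm_nonneg _))
  have hγ : ∀ t : ℝ, HasDerivAt (fun t => cos t • x + sin t • v) (-sin t • x + cos t • v) t :=
    fun t => ((hasDerivAt_cos t).smul_const x).add ((hasDerivAt_sin t).smul_const v)
  have h := (convex_Icc (0 : ℝ) θ).norm_image_sub_le_of_norm_hasDerivWithin_le (C := B)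
    (fun t _ => (hasDerivAt_pEval P (hγ t)).hasDerivWithinAt) (fun t ht => ?_)
    (left_mem_Icc.2 hθ0) (right_mem_Icc.2 hθ0)
  · have hB0 : 0 ≤ B := (Finset.sum_nonneg fun _ _ => abs_nonneg _).trans
      (hB x hx (by simp))
    simp only [cos_zero, sin_zero, one_smul, zero_smul, add_zero, sub_zero, ← hyv,
      Real.norm_eq_abs] at h
    rw [abs_of_nonneg hθ0, mul_comm] at h
    exact h.trans (mul_le_mul_of_nonneg_right hθ1 hB0)
  · set z := cos t • x + sin t • v with hz
    set u := -sin t • x + cos t • v with hu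
    have hzS : z ∈ unitSphere d := cos_smul_add_sin_smul_mem hx hv hxv t
    have hz1 := norm_eq_one_of_mem_unitSphere hzS
    have hu1 : ‖u‖ = 1 := by
      have := norm_eq_one_of_mem_unitSphere (cos_smul_add_sin_smul_mem hx hv hxv (t + π / 2))
      rwa [cos_add_pi_div_two, sin_add_pi_div_two] at this
    have hzu : ⟪z, u⟫_ℝ = 0 := by
      simp only [hz, hu, inner_add_left, inner_add_right, real_inner_smul_left,
        real_inner_smul_right, hxv, real_inner_comm x v, real_inner_self_eq_norm_sq, hx1, hv]
      ring
    have hzx : ‖z - x‖ ≤ 2 * ‖x - y‖ := by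
      refine le_trans (abs_le_of_sq_le_sq' ?_ ht.1).2 (ht.2.trans hθ1)
      rw [norm_sub_sq_real, hz1, hx1]
      have : ⟪z, x⟫_ℝ = cos t := by
        simp [hz, inner_add_left, real_inner_smul_left, hxv, real_inner_comm x v, hx1]
      rw [this]
      linarith [one_sub_sq_div_two_le_cos (x := t)]
    have h1 : ∀ w : EuclideanSpace ℝ (Fin d), ∀ i, ‖w‖ = 1 → |w i| ≤ 1 := fun w i hw =>
      (PiLp.norm_apply_le w i).trans hw.le
    rw [PiLp.inner_apply] at hzu
    have hzz : ∑ i, z i * z i = 1 := by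
      have := real_inner_self_eq_norm_sq z
      rw [hz1, PiLp.inner_apply] at this
      simpa [pow_two] using this
    rw [sum_mul_eq_sum_coordPair (y := z) (u := u) hzz (by simpa [mul_comm] using hzu),
      Real.norm_eq_abs]
    refine (Finset.abs_sum_le_sum_abs _ _).trans ((Finset.sum_le_sum fun l _ => ?_).trans
      (hB z hzS hzx))
    rw [← pEval_rotDeriv, abs_mul, abs_mul]
    refine mul_le_of_le_one_left (abs_nonneg _) ?_
    exact mul_le_one₀ (h1 z _ hz1) (abs_nonneg _) (h1 u _ hu1)

end RotationProducts

section Sphere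

lemma isPreconnected_unitSphere (hd : 2 ≤ d) : IsPreconnected (unitSphere d) := by
  refine isPreconnected_sphere ?_ _ _
  rw [← Module.finrank_eq_rank, finrank_euclideanSpace_fin]
  exact_mod_cast hd

lemma infinite_unitSphere_inter_closedBall (hd : 2 ≤ d) {v : EuclideanSpace ℝ (Fin d)}
    (hv : v ∈ unitSphere d) {r : ℝ} (hr : 0 < r) :
    (unitSphere d ∩ Metric.closedBall v r).Infinite := by
  have h1 := (isPreconnected_unitSphere hd).intermediate_value hv
    (mem_unitSphere_of_norm ((norm_neg v).trans (norm_eq_one_of_mem_unitSphere hv)))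
    (f := fun y => dist y v) (by fun_prop)
  have h2 : dist (-v) v = 2 := by
    rw [dist_eq_norm, ← neg_add', norm_neg, ← two_smul ℝ v, norm_smul,
      norm_eq_one_of_mem_unitSphere hv]
    norm_num
  rw [dist_self, h2] at h1
  refine Infinite.of_image (fun y => dist y v) ((Icc_infinite (lt_min hr two_pos)).mono ?_)
  intro t ht
  obtain ⟨y, hy, rfl⟩ := h1 ⟨ht.1, ht.2.trans (min_le_right _ _)⟩
  exact ⟨y, ⟨hy, ht.2.trans (min_le_left _ _)⟩, rfl⟩

/-- A polynomial whose derivatives along rotations vanish on the sphere is constant there. -/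
lemma pEval_eq_of_rotDeriv_eq_zero (hd : 2 ≤ d) {P : MvPolynomial (Fin d) ℝ}
    (hP : ∀ l : CoordPair d, ∀ z ∈ unitSphere d, pEval (rotDeriv l.1.1 l.1.2 P) z = 0)
    {x y : EuclideanSpace ℝ (Fin d)} (hx : x ∈ unitSphere d) (hy : y ∈ unitSphere d) :
    pEval P y = pEval P x := by
  have key : ∀ x ∈ unitSphere d, ∀ y ∈ unitSphere d, y ≠ -x → pEval P y = pEval P x := by
    intro x hx y hy hxy
    have := abs_pEval_sub_le_of_rotDeriv hx hy hxy (P := P) (B := 0) fun z hz _ =>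
      (Finset.sum_eq_zero fun l _ => by rw [hP l z hz, abs_zero]).le
    rw [mul_zero] at this
    exact sub_eq_zero.1 (abs_nonpos_iff.1 this)
  by_cases hxy : y = -x
  · obtain ⟨z, hz, hz'⟩ := ((infinite_unitSphere_inter_closedBall hd hx two_pos).sdiff
      (toFinite {x, -x})).nonempty
    simp only [mem_insert_iff, mem_singleton_iff, not_or] at hz'
    refine (key z hz.1 y hy fun h => hz'.1 ?_).trans (key x hx z hz.1 hz'.2)
    rw [hxy] at h
    exact (neg_injective h).symm
  · exact key x hx y hy hxy

end Sphere

section McShane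

variable {X : Type*} [PseudoMetricSpace X] {V : Finset X}

/-- The McShane regularization `x ↦ max_u (f u - κ dist(x, u))` of a function on a finite set. -/
def mcShane (hV : V.Nonempty) (f : X → ℝ) (κ : ℝ) (x : X) : ℝ :=
  V.sup' hV fun u => f u - κ * dist x u

lemma le_mcShane (hV : V.Nonempty) (f : X → ℝ) (κ : ℝ) {v : X} (hv : v ∈ V) :
    f v ≤ mcShane hV f κ v := by
  have := Finset.le_sup' (fun u => f u - κ * dist v u) hv
  rwa [dist_self, mul_zero, sub_zero] at this

lemma abs_mcShane_sub_le (hV : V.Nonempty) (f : X → ℝ) {κ : ℝ} (hκ : 0 ≤ κ) (x y : X) :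
    |mcShane hV f κ x - mcShane hV f κ y| ≤ κ * dist x y := by
  have key : ∀ x y, mcShane hV f κ x ≤ mcShane hV f κ y + κ * dist x y := fun x y => by
    refine Finset.sup'_le hV _ fun u hu => ?_
    have h1 := Finset.le_sup' (fun u => f u - κ * dist y u) hu
    have h2 := mul_le_mul_of_nonneg_left (dist_triangle_left y u x) hκ
    simp only [mcShane] at *
    linarith
  rw [abs_sub_le_iff]
  have h1 := key x y
  have h2 := key y x
  rw [dist_comm y x] at h2
  constructor <;> linarith

/-- Truncation to the interval `[-1, 1]`. -/
def truncOne (t : ℝ) : ℝ := max (-1) (min 1 t)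

lemma abs_mcShane_truncOne_le (hV : V.Nonempty) (Q : X → ℝ) {κ : ℝ} (hκ : 0 ≤ κ) {v : X}
    (hv : v ∈ V) : |mcShane hV (fun u => truncOne (Q u)) κ v| ≤ 1 := by
  refine abs_le.2 ⟨(le_max_left _ _).trans (le_mcShane hV (fun u => truncOne (Q u)) κ hv), ?_⟩
  refine Finset.sup'_le hV _ fun u _ => ?_
  have h1 : truncOne (Q u) ≤ 1 := max_le (by norm_num) (min_le_left _ _)
  have h2 := mul_nonneg hκ (dist_nonneg (x := v) (y := u))
  linarith

/-- The regularized sign of `Q` almost detects `|Q|`. -/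
lemma le_mcShane_truncOne_mul (hV : V.Nonempty) (Q : X → ℝ) {κ e : ℝ} (hκ : 0 ≤ κ) (he : 0 ≤ e)
    {v : X} (hv : v ∈ V) (hQ : ∀ u ∈ V, κ * dist v u ≤ 2 → |Q u - Q v| ≤ e) :
    |Q v| - 1 - 2 * e ≤ mcShane hV (fun u => truncOne (Q u)) κ v * Q v := by
  obtain ⟨u, hu, hχ⟩ := V.exists_mem_eq_sup' hV fun u => truncOne (Q u) - κ * dist v u
  have h1 := abs_le.1 (abs_mcShane_truncOne_le hV Q hκ hv)
  have h2 := le_mcShane hV (fun u => truncOne (Q u)) κ hv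
  change mcShane hV (fun u => truncOne (Q u)) κ v = _ at hχ
  set χ := mcShane hV (fun u => truncOne (Q u)) κ v
  have h3 : truncOne (Q u) ≤ 1 := max_le (by norm_num) (min_le_left _ _)
  have h4 := mul_nonneg hκ (dist_nonneg (x := v) (y := u))
  have h5 := abs_le.1 (hQ u hu (by linarith))
  have h6 : χ ≤ truncOne (Q u) := by linarith
  have h7 : -1 < χ → χ ≤ Q u := fun h => by
    have : truncOne (Q u) ≤ max (-1) (Q u) := max_le_max le_rfl (min_le_right _ _)
    rcases le_max_iff.1 (h6.trans this) with h' | h'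
    · linarith
    · exact h'
  have h9 : min 1 (Q v) ≤ χ := (le_max_right _ _).trans h2
  rcases le_or_gt 1 (Q v) with hc | hc
  · rw [min_eq_left hc] at h9
    have : χ = 1 := le_antisymm h1.2 h9
    rw [this, abs_of_nonneg (by linarith)]
    linarith
  rw [min_eq_right hc.le] at h9
  rcases eq_or_lt_of_le h1.1 with hχ1 | hχ1
  · rw [← hχ1]
    have : Q v ≤ 0 := by linarith
    rw [abs_of_nonpos this]
    linarith
  have h10 := h7 hχ1
  rcases le_or_gt 0 (Q v) with hq | hq
  · rw [abs_of_nonneg hq]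
    nlinarith
  · rw [abs_of_neg hq]
    rcases le_or_gt χ 0 with hx | hx
    · nlinarith
    · nlinarith

end McShane
section RotControl

variable {ν : Measure (EuclideanSpace ℝ (Fin d))} {P : MvPolynomial (Fin d) ℝ} {n : ℕ}
  {G : EuclideanSpace ℝ (Fin d) → ℝ}

/-- The sum of the absolute values of the derivatives along the coordinate rotations. -/
def rotAbs (P : MvPolynomial (Fin d) ℝ) (x : EuclideanSpace ℝ (Fin d)) : ℝ :=
  ∑ l : CoordPair d, |pEval (rotDeriv l.1.1 l.1.2 P) x|

/-- `G` controls the derivatives of `P` along rotations and their oscillation at scale `1 / n`. -/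
structure RotControl (ν : Measure (EuclideanSpace ℝ (Fin d))) (n : ℕ) (P : MvPolynomial (Fin d) ℝ)
    (G : EuclideanSpace ℝ (Fin d) → ℝ) : Prop where
  integrable : Integrable G ν
  nonneg : ∀ x, 0 ≤ G x
  rotAbs_le : ∀ x ∈ unitSphere d, ∀ y ∈ unitSphere d, n * ‖x - y‖ ≤ 3 → rotAbs P y ≤ G x
  sub_le : ∀ x ∈ unitSphere d, ∀ y ∈ unitSphere d, n * ‖x - y‖ ≤ 3 → ∀ z ∈ unitSphere d,
    n * ‖x - z‖ ≤ 3 → ∀ l : CoordPair d,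
      |pEval (rotDeriv l.1.1 l.1.2 P) y - pEval (rotDeriv l.1.1 l.1.2 P) z| ≤ n * ‖y - z‖ * G x

lemma continuous_rotAbs : Continuous (rotAbs P) :=
  continuous_finsetSum _ fun _ _ => (continuous_pEval _).abs

theorem exists_rotControl (d : ℕ) (L : ℝ) : ∃ C : ℝ, 1 ≤ C ∧
    ∀ (ν : Measure (EuclideanSpace ℝ (Fin d))) [IsProbabilityMeasure ν], SphereDoubling ν L →
    ∀ n : ℕ, 1 ≤ n → ∀ P : MvPolynomial (Fin d) ℝ, P.totalDegree ≤ n →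
    ∃ G, RotControl ν n P G ∧ ∫ x, G x ∂ν ≤ C * ∫ x, rotAbs P x ∂ν := by
  obtain ⟨C, hC, h⟩ := SphereDoubling.exists_local_control d L
  refine ⟨max 1 C, le_max_left _ _, fun ν _ hν n hn P hP => ?_⟩
  choose g hgi hg0 hgC hg using fun l : CoordPair d =>
    h ν hν n hn (rotDeriv l.1.1 l.1.2 P) (totalDegree_rotDeriv_le _ _ hP)
  have hle : ∀ l x, g l x ≤ ∑ l, g l x := fun l x =>
    Finset.single_le_sum (f := fun l => g l x) (fun l _ => hg0 l x) (Finset.mem_univ l)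
  refine ⟨fun x => ∑ l, g l x, ⟨integrable_finsetSum _ fun l _ => hgi l,
    fun x => Finset.sum_nonneg fun l _ => hg0 l x, fun x hx y hy hxy =>
      Finset.sum_le_sum fun l _ => (hg l x hx y hy hxy).1, fun x hx y hy hxy z hz hxz l =>
      ((hg l x hx y hy hxy).2 z hz hxz).trans ?_⟩, ?_⟩
  · exact mul_le_mul_of_nonneg_left (hle l x) (by positivity)
  · unfold rotAbs
    rw [integral_finsetSum _ fun l _ => hgi l, integral_finsetSum _ fun l _ =>
      hν.integrable_of_continuousOn (continuous_pEval _).abs, Finset.mul_sum]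
    exact Finset.sum_le_sum fun l _ => (hgC l).trans
      (mul_le_mul_of_nonneg_right (le_max_right _ _) (integral_nonneg fun x => abs_nonneg _))

/-- The infimum of `G` over the part of the sphere in a ball. -/
def localInf (G : EuclideanSpace ℝ (Fin d) → ℝ) (r : ℝ) (v : EuclideanSpace ℝ (Fin d)) : ℝ :=
  ⨅ w : ↥(unitSphere d ∩ Metric.closedBall v r), G w

lemma localInf_le (hG : ∀ x, 0 ≤ G x) {r : ℝ} {v w : EuclideanSpace ℝ (Fin d)}
    (hw : w ∈ unitSphere d) (hvw : dist w v ≤ r) : localInf G r v ≤ G w :=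
  ciInf_le (f := fun w : ↥(unitSphere d ∩ Metric.closedBall v r) => G w)
    ⟨0, by rintro _ ⟨w, rfl⟩; exact hG _⟩ ⟨w, hw, hvw⟩

lemma le_localInf {r a : ℝ} (hr : 0 ≤ r) {v : EuclideanSpace ℝ (Fin d)} (hv : v ∈ unitSphere d)
    (h : ∀ w ∈ unitSphere d, dist w v ≤ r → a ≤ G w) : a ≤ localInf G r v := by
  have : Nonempty ↥(unitSphere d ∩ Metric.closedBall v r) :=
    ⟨⟨v, hv, Metric.mem_closedBall_self hr⟩⟩
  exact le_ciInf fun w => h w w.2.1 w.2.2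

lemma localInf_nonneg (hG : ∀ x, 0 ≤ G x) (r : ℝ) (v : EuclideanSpace ℝ (Fin d)) :
    0 ≤ localInf G r v := Real.iInf_nonneg fun w => hG w

/-- Integration over disjoint pieces located near the points of a finite set. -/
lemma sum_measureReal_mul_localInf_le [IsProbabilityMeasure ν] (hν : ν (unitSphere d)ᶜ = 0)
    (hGi : Integrable G ν) (hG : ∀ x, 0 ≤ G x) {V : Finset (EuclideanSpace ℝ (Fin d))} {r : ℝ}
    {R : EuclideanSpace ℝ (Fin d) → Set (EuclideanSpace ℝ (Fin d))}
    (hRm : ∀ v, MeasurableSet (R v)) (hRb : ∀ v, R v ⊆ Metric.closedBall v r)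
    (hRd : (↑V : Set (EuclideanSpace ℝ (Fin d))).PairwiseDisjoint R) :
    ∑ v ∈ V, ν.real (R v) * localInf G r v ≤ ∫ x, G x ∂ν := by
  have h1 : ∑ v ∈ V, ∫ x in R v, G x ∂ν ≤ ∫ x, G x ∂ν := by
    rw [← integral_biUnion_finset V (fun v _ => hRm v) hRd fun v _ => hGi.integrableOn]
    exact setIntegral_le_integral hGi (.of_forall hG)
  refine (Finset.sum_le_sum fun v _ => ?_).trans h1
  have h2 : ∀ᵐ x ∂ν, x ∈ R v → localInf G r v ≤ G x := by
    have : ∀ᵐ x ∂ν, x ∈ unitSphere d := hν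
    exact this.mono fun x hx hxR => localInf_le hG hx (hRb v hxR)
  have h3 := setIntegral_mono_on_ae (integrableOn_const (C := localInf G r v))
    hGi.integrableOn (hRm v) h2
  rwa [setIntegral_const, smul_eq_mul] at h3

lemma integral_le_sum_measureReal_mul [IsProbabilityMeasure ν] (hν : ν (unitSphere d)ᶜ = 0)
    {F f : EuclideanSpace ℝ (Fin d) → ℝ} (hF : Integrable F ν)
    {V : Finset (EuclideanSpace ℝ (Fin d))} {r : ℝ}
    {R : EuclideanSpace ℝ (Fin d) → Set (EuclideanSpace ℝ (Fin d))}
    (hRm : ∀ v, MeasurableSet (R v)) (hRb : ∀ v, R v ⊆ Metric.closedBall v r)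
    (hRd : (↑V : Set (EuclideanSpace ℝ (Fin d))).PairwiseDisjoint R)
    (hRs : unitSphere d ⊆ ⋃ v ∈ V, R v)
    (hf : ∀ v ∈ V, ∀ x ∈ unitSphere d, dist x v ≤ r → F x ≤ f v) :
    ∫ x, F x ∂ν ≤ ∑ v ∈ V, ν.real (R v) * f v := by
  have hS : ∀ᵐ x ∂ν, x ∈ unitSphere d := hν
  have h1 : ∫ x, F x ∂ν = ∑ v ∈ V, ∫ x in R v, F x ∂ν := by
    rw [← integral_biUnion_finset V (fun v _ => hRm v) hRd fun v _ => hF.integrableOn,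
      setIntegral_eq_integral_of_ae_compl_eq_zero]
    exact hS.mono fun x hx hx' => absurd (hRs hx) hx'
  rw [h1]
  refine Finset.sum_le_sum fun v hv => ?_
  have h3 := setIntegral_mono_on_ae (μ := ν) (f := F) (g := fun _ => f v) (s := R v)
    hF.integrableOn (integrableOn_const) (hRm v)
    (hS.mono fun x hx hxR => hf v hv x hx (hRb v hxR))
  rwa [setIntegral_const, smul_eq_mul] at h3

end RotControl

section MovedNodes

variable {ν : Measure (EuclideanSpace ℝ (Fin d))} {P : MvPolynomial (Fin d) ℝ} {n : ℕ}
  {G : EuclideanSpace ℝ (Fin d) → ℝ} {u v x y z q : EuclideanSpace ℝ (Fin d)} {r ρ κ ε K : ℝ}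
  {V : Finset (EuclideanSpace ℝ (Fin d))}

namespace RotControl

lemma rotAbs_le_localInf (h : RotControl ν n P G) (hr : 0 ≤ r) (hv : v ∈ unitSphere d)
    (hz : z ∈ unitSphere d) (hzv : n * (‖z - v‖ + r) ≤ 3) : rotAbs P z ≤ localInf G r v := by
  refine le_localInf hr hv fun w hw hwv => h.rotAbs_le w hw z hz (le_trans ?_ hzv)
  rw [dist_eq_norm] at hwv
  have := norm_sub_le_norm_sub_add_norm_sub w v z
  rw [norm_sub_rev v z] at this
  gcongr
  linarith

lemma rotDeriv_sub_le_localInf (h : RotControl ν n P G) (hr : 0 ≤ r) (hv : v ∈ unitSphere d)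
    (hy : y ∈ unitSphere d) (hz : z ∈ unitSphere d) (hyv : n * (‖y - v‖ + r) ≤ 3)
    (hzv : n * (‖z - v‖ + r) ≤ 3) (l : CoordPair d) :
    |pEval (rotDeriv l.1.1 l.1.2 P) y - pEval (rotDeriv l.1.1 l.1.2 P) z| ≤
      n * ‖y - z‖ * localInf G r v := by
  rcases eq_or_lt_of_le (show 0 ≤ n * ‖y - z‖ by positivity) with h0 | h0
  · have := h.sub_le y hy y hy (by simp) z hz (by rw [← h0]; norm_num) l
    rw [← h0, zero_mul] at this ⊢
    exact this
  rw [← div_le_iff₀' h0]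
  refine le_localInf hr hv fun w hw hwv => (div_le_iff₀' h0).2 ?_
  rw [dist_eq_norm] at hwv
  have h1 := norm_sub_le_norm_sub_add_norm_sub w v y
  have h2 := norm_sub_le_norm_sub_add_norm_sub w v z
  rw [norm_sub_rev v] at h1 h2
  refine h.sub_le w hw y hy (le_trans ?_ hyv) z hz (le_trans ?_ hzv) l <;> gcongr <;> linarith

lemma pEval_sub_le_localInf (h : RotControl ν n P G) (hn : 1 ≤ n) (hr : 0 ≤ r)
    (hv : v ∈ unitSphere d) (hx : x ∈ unitSphere d) (hy : y ∈ unitSphere d)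
    (hxy : n * (‖x - v‖ + 2 * ‖x - y‖ + r) ≤ 3) :
    |pEval P y - pEval P x| ≤ 2 * ‖x - y‖ * localInf G r v := by
  have hn' : (1 : ℝ) ≤ n := by exact_mod_cast hn
  refine abs_pEval_sub_le_of_rotDeriv hx hy ?_ fun z hz hzx =>
    h.rotAbs_le_localInf hr hv hz (le_trans ?_ hxy)
  · rintro rfl
    rw [sub_neg_eq_add, ← two_smul ℝ x, norm_smul, norm_eq_one_of_mem_unitSphere hx] at hxy
    norm_num at hxy
    have := norm_nonneg (x - v)
    nlinarith
  · have := norm_sub_le_norm_sub_add_norm_sub z x v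
    gcongr
    linarith

lemma abs_rotAbs_sub_le (h : RotControl ν n P G) (hr : 0 ≤ r) (hv : v ∈ unitSphere d)
    (hy : y ∈ unitSphere d) (hz : z ∈ unitSphere d) (hyv : n * (‖y - v‖ + r) ≤ 3)
    (hzv : n * (‖z - v‖ + r) ≤ 3) :
    |rotAbs P y - rotAbs P z| ≤
      Fintype.card (CoordPair d) * (n * ‖y - z‖ * localInf G r v) := by
  unfold rotAbs
  rw [← Finset.sum_sub_distrib, ← nsmul_eq_mul]
  refine (Finset.abs_sum_le_sum_abs _ _).trans (Finset.sum_le_card_nsmul _ _ _ fun l _ => ?_)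
  exact (abs_abs_sub_abs_le _ _).trans (h.rotDeriv_sub_le_localInf hr hv hy hz hyv hzv l)

end RotControl

/-- The point obtained from `q` by small rotations which increase `P` near `v`. -/
def movedNode (hV : V.Nonempty) (s K : ℝ) (P : MvPolynomial (Fin d) ℝ)
    (v q : EuclideanSpace ℝ (Fin d)) : EuclideanSpace ℝ (Fin d) :=
  rotList (fun l => s * mcShane hV (fun u => truncOne (pEval (rotDeriv l.1.1 l.1.2 P) u)) K v)
    Finset.univ.toList q

lemma movedNode_mem (hV : V.Nonempty) (s K : ℝ) (P : MvPolynomial (Fin d) ℝ)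
    (hq : q ∈ unitSphere d) : movedNode hV s K P v q ∈ unitSphere d := rotList_mem _ _ hq

lemma sum_map_univ_toList {ι : Type*} [Fintype ι] (f : ι → ℝ) :
    ((Finset.univ : Finset ι).toList.map f).sum = ∑ i, f i := Finset.sum_map_toList _ _

lemma eq_of_movedNode_eq (hV : V.Nonempty) {s : ℝ} (hs : 0 ≤ s) (hK : 0 ≤ K)
    (hsK : Fintype.card (CoordPair d) * (s * K) ≤ 1 / 4)
    {q' : EuclideanSpace ℝ (Fin d)} (hq' : q' ∈ unitSphere d)
    (hqv : ‖q - v‖ ≤ ‖v - u‖ / 4) (hqu : ‖q' - u‖ ≤ ‖v - u‖ / 4)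
    (h : movedNode hV s K P v q = movedNode hV s K P u q') : v = u := by
  set a : EuclideanSpace ℝ (Fin d) → CoordPair d → ℝ := fun v l =>
    s * mcShane hV (fun u => truncOne (pEval (rotDeriv l.1.1 l.1.2 P) u)) K v with ha
  have h1 : ‖rotList (a v) Finset.univ.toList q' - rotList (a u) Finset.univ.toList q'‖ ≤
      ‖v - u‖ / 4 := by
    refine (norm_rotList_sub_le _ _ _ hq').trans ?_
    rw [sum_map_univ_toList]
    calc _ ≤ ∑ l : CoordPair d, s * K * ‖v - u‖ := by
          refine Finset.sum_le_sum fun l _ => ?_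
          rw [ha]
          simp only
          rw [← mul_sub, abs_mul, abs_of_nonneg hs, mul_assoc, ← dist_eq_norm]
          exact mul_le_mul_of_nonneg_left (abs_mcShane_sub_le hV _ hK _ _) hs
      _ = Fintype.card (CoordPair d) * (s * K) * ‖v - u‖ := by
          rw [Finset.sum_const, nsmul_eq_mul, Finset.card_univ]; ring
      _ ≤ 1 / 4 * ‖v - u‖ := by gcongr
      _ = _ := by ring
  have h2 : ‖q - q'‖ = ‖rotList (a v) Finset.univ.toList q' -
      rotList (a u) Finset.univ.toList q'‖ := by
    rw [← norm_rotList_sub (a v) Finset.univ.toList, norm_sub_rev]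
    exact congrArg (fun x => ‖rotList (a v) Finset.univ.toList q' - x‖) h
  have h3 : ‖v - u‖ ≤ ‖q - v‖ + ‖q - q'‖ + ‖q' - u‖ := by
    have h4 := norm_sub_le_norm_sub_add_norm_sub v q u
    have h5 := norm_sub_le_norm_sub_add_norm_sub q q' u
    rw [norm_sub_rev v q] at h4
    linarith
  have h6 : ‖v - u‖ ≤ 0 := by linarith
  exact sub_eq_zero.1 (norm_le_zero_iff.1 h6)

lemma movedNode_inj (hV : V.Nonempty) {s : ℝ} {q' : EuclideanSpace ℝ (Fin d)}
    (h : movedNode hV s K P v q = movedNode hV s K P v q') : q = q' := by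
  rw [← sub_eq_zero, ← norm_eq_zero, movedNode, movedNode, norm_rotList_sub] at h
  exact sub_eq_zero.1 (norm_eq_zero.1 h)

/-- A lower bound for `n P` at the nodes moved from the vicinity of `v`. -/
def nodeBound (n : ℕ) (ρ κ ε : ℝ) (P : MvPolynomial (Fin d) ℝ)
    (G : EuclideanSpace ℝ (Fin d) → ℝ) (v : EuclideanSpace ℝ (Fin d)) : ℝ :=
  n * pEval P v + ρ * rotAbs P v - ρ * Fintype.card (CoordPair d) -
    κ * localInf G (4 * ε / n) v

namespace RotControl

lemma nodeBound_le (h : RotControl ν n P G) (hn : 1 ≤ n) (hV : V.Nonempty)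
    (hVS : ↑V ⊆ unitSphere d) (hv : v ∈ V) (hq : q ∈ unitSphere d) (hρ : 0 ≤ ρ) (hε : 0 ≤ ε)
    (hε' : ε ≤ 1 / 8) (hK : 2 ≤ K) (hρ' : Fintype.card (CoordPair d) * ρ ≤ 1)
    (hqv : ‖q - v‖ ≤ ε / n) :
    nodeBound n ρ (ρ * (4 * Fintype.card (CoordPair d) / K + Fintype.card (CoordPair d) *
      (Fintype.card (CoordPair d) * ρ + ε)) + 2 * ε) ε P G v ≤
      n * pEval P (movedNode hV (ρ / n) (K * n) P v q) := by
  have hn0 : (0 : ℝ) < n := by exact_mod_cast hn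
  have hvS := hVS hv
  set m : ℝ := (Fintype.card (CoordPair d) : ℝ) with hm
  have hm0 : 0 ≤ m := by positivity
  set t := localInf G (4 * ε / n) v with ht
  have ht0 : 0 ≤ t := localInf_nonneg h.nonneg _ _
  have hr : 0 ≤ 4 * ε / n := by positivity
  have hscale : ∀ {a b : ℝ}, a ≤ b / n → b + 4 * ε ≤ 3 → n * (a + 4 * ε / n) ≤ 3 := by
    intro a b hab hb
    calc n * (a + 4 * ε / n) ≤ n * (b / n + 4 * ε / n) := by gcongr
      _ = b + 4 * ε := by field_simp
      _ ≤ 3 := hb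
  have hvv : n * (‖v - v‖ + 4 * ε / n) ≤ 3 := by
    rw [sub_self, norm_zero]
    exact hscale (b := 0) (by simp) (by linarith)
  set χ : CoordPair d → ℝ := fun l =>
    mcShane hV (fun u => truncOne (pEval (rotDeriv l.1.1 l.1.2 P) u)) (K * n) v with hχ
  have hχ1 : ∀ l, |χ l| ≤ 1 := fun l => abs_mcShane_truncOne_le hV _ (by positivity) hv
  have hχQ : ∀ l, |pEval (rotDeriv l.1.1 l.1.2 P) v| - 1 - 4 / K * t ≤
      χ l * pEval (rotDeriv l.1.1 l.1.2 P) v := fun l => by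
    have := le_mcShane_truncOne_mul hV (fun u => pEval (rotDeriv l.1.1 l.1.2 P) u)
      (κ := K * n) (e := 2 / K * t) (by positivity) (by positivity) hv fun u hu hvu => by
        rw [dist_eq_norm] at hvu
        have hvu' : n * ‖u - v‖ ≤ 2 / K := by
          rw [le_div_iff₀ (by linarith), norm_sub_rev]; linarith
        have h2K : 2 / K ≤ 1 := by rw [div_le_one (by linarith)]; exact hK
        refine (h.rotDeriv_sub_le_localInf hr hvS (hVS hu) hvS ?_ hvv l).trans ?_
        · exact hscale (b := 1) (by rw [le_div_iff₀ hn0]; linarith) (by linarith)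
        · gcongr
    refine le_trans (le_of_eq ?_) this
    ring
  have hs : ∀ l, |ρ / n * χ l| ≤ ρ / n := fun l => by
    rw [abs_mul, abs_of_nonneg (by positivity : 0 ≤ ρ / n)]
    exact mul_le_of_le_one_right (by positivity) (hχ1 l)
  have hmove := le_pEval_rotList_sub (P := P) (v := v) (κ := (m * ρ + ε) * t)
    (r := (m * ρ + ε) / n) (fun l => ρ / n * χ l) Finset.univ.toList hq
    (fun l z hz hzv => by
      refine (h.rotDeriv_sub_le_localInf hr hvS hz hvS (hscale hzv (by linarith)) hvv l).trans ?_
      rw [le_div_iff₀ hn0] at hzv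
      gcongr
      linarith) (by
      rw [sum_map_univ_toList]
      have : ∑ l, |ρ / n * χ l| ≤ m * (ρ / n) := by
        rw [hm, ← nsmul_eq_mul, ← Finset.card_univ]
        exact Finset.sum_le_card_nsmul _ _ _ fun l _ => hs l
      calc _ ≤ m * (ρ / n) + ε / n := add_le_add this hqv
        _ = _ := by ring)
  rw [sum_map_univ_toList] at hmove
  have hstart := (abs_le.1 (h.pEval_sub_le_localInf hn hr hvS hvS hq (by
    rw [sub_self, norm_zero, zero_add, norm_sub_rev]
    refine hscale (b := 2 * ε) ?_ (by linarith)
    rw [mul_div_assoc]; gcongr))).1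
  rw [norm_sub_rev, ← ht] at hstart
  have hsum : ρ / n * (rotAbs P v - m - 4 * m / K * t) - m * (ρ / n * ((m * ρ + ε) * t)) ≤
      ∑ l, (ρ / n * χ l * pEval (rotDeriv l.1.1 l.1.2 P) v -
        |ρ / n * χ l| * ((m * ρ + ε) * t)) := by
    have : ρ / n * (rotAbs P v - m - 4 * m / K * t) - m * (ρ / n * ((m * ρ + ε) * t)) =
        ∑ l : CoordPair d, (ρ / n * (|pEval (rotDeriv l.1.1 l.1.2 P) v| - 1 - 4 / K * t) -
          ρ / n * ((m * ρ + ε) * t)) := by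
      rw [Finset.sum_sub_distrib, ← Finset.mul_sum, Finset.sum_sub_distrib,
        Finset.sum_sub_distrib]
      simp only [Finset.sum_const, nsmul_eq_mul, Finset.card_univ, ← hm, rotAbs]
      ring
    rw [this]
    refine Finset.sum_le_sum fun l _ => sub_le_sub ?_ ?_
    · rw [mul_assoc]
      exact mul_le_mul_of_nonneg_left (hχQ l) (by positivity)
    · exact mul_le_mul_of_nonneg_right (hs l) (by positivity)
  have hfin : pEval P v - 2 * (ε / n) * t +
      (ρ / n * (rotAbs P v - m - 4 * m / K * t) - m * (ρ / n * ((m * ρ + ε) * t))) ≤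
      pEval P (movedNode hV (ρ / n) (K * n) P v q) := by
    have h2 : 2 * ‖q - v‖ * t ≤ 2 * (ε / n) * t := by gcongr
    change _ ≤ pEval P (movedNode hV (ρ / n) (K * n) P v q) - _ at hmove
    linarith
  refine le_trans (le_of_eq ?_) (mul_le_mul_of_nonneg_left hfin hn0.le)
  rw [nodeBound, ← hm, ← ht]
  field_simp
  ring

lemma abs_nodeBound_sub_le (h : RotControl ν n P G) (hn : 1 ≤ n) (hv : v ∈ unitSphere d)
    (hu : u ∈ unitSphere d) (hρ : 0 ≤ ρ) (hκ : 0 ≤ κ) (hε : 0 ≤ ε) (hε' : ε ≤ 1 / 8)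
    (huv : ‖v - u‖ ≤ 2 * (ε / n)) :
    |nodeBound n ρ κ ε P G v - nodeBound n ρ κ ε P G u| ≤
      (4 * ε + 2 * ρ * Fintype.card (CoordPair d) * ε + κ) * localInf G (ε / n) v := by
  have hn0 : (0 : ℝ) < n := by exact_mod_cast hn
  have hr : 0 ≤ ε / n := by positivity
  set m : ℝ := (Fintype.card (CoordPair d) : ℝ) with hm
  set s := localInf G (ε / n) v with hs
  have hs0 : 0 ≤ s := localInf_nonneg h.nonneg _ _
  have hnr : n * (ε / n) = ε := by field_simp
  have hnuv : n * ‖v - u‖ ≤ 2 * ε := by nlinarith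
  have h1 := h.pEval_sub_le_localInf hn hr hv hv hu (by
    rw [sub_self, norm_zero]; linarith)
  have h2 := h.abs_rotAbs_sub_le hr hv hv hu (by rw [sub_self, norm_zero]; linarith)
    (by rw [norm_sub_rev]; linarith)
  have h3 : localInf G (4 * ε / n) v ≤ s := le_localInf hr hv fun w hw hwv =>
    localInf_le h.nonneg hw (hwv.trans (by gcongr; linarith))
  have h4 : localInf G (4 * ε / n) u ≤ s := le_localInf hr hv fun w hw hwv =>
    localInf_le h.nonneg hw ((dist_triangle w v u).trans (by
      rw [dist_eq_norm v]
      have : 4 * ε / n = ε / n + 2 * (ε / n) + ε / n := by ring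
      linarith))
  have h5 := localInf_nonneg h.nonneg (4 * ε / n) v
  have h6 := localInf_nonneg h.nonneg (4 * ε / n) u
  have h7 : |localInf G (4 * ε / n) v - localInf G (4 * ε / n) u| ≤ s :=
    abs_sub_le_iff.2 ⟨by linarith, by linarith⟩
  have e : nodeBound n ρ κ ε P G v - nodeBound n ρ κ ε P G u =
      n * (pEval P v - pEval P u) + ρ * (rotAbs P v - rotAbs P u) -
        κ * (localInf G (4 * ε / n) v - localInf G (4 * ε / n) u) := by
    unfold nodeBound; ring
  rw [e]
  refine (abs_sub _ _).trans ((add_le_add_left (abs_add_le _ _) _).trans ?_)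
  rw [abs_mul, abs_mul, abs_mul, abs_of_pos hn0, abs_of_nonneg hρ, abs_of_nonneg hκ]
  rw [abs_sub_comm (pEval P v)]
  calc _ ≤ n * (2 * ‖v - u‖ * s) + ρ * (m * (n * ‖v - u‖ * s)) + κ * s := by gcongr
    _ = (2 * (n * ‖v - u‖) + ρ * m * (n * ‖v - u‖) + κ) * s := by ring
    _ ≤ (2 * (2 * ε) + ρ * m * (2 * ε) + κ) * s := by gcongr
    _ = _ := by ring

lemma le_nodeBound (h : RotControl ν n P G) (hn : 1 ≤ n) (hv : v ∈ unitSphere d)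
    (hx : x ∈ unitSphere d) (hρ : 0 ≤ ρ) (hκ : 0 ≤ κ) (hε : 0 ≤ ε) (hε' : ε ≤ 1 / 8)
    (hxv : ‖x - v‖ ≤ ε / n) :
    n * pEval P x + ρ * rotAbs P x - ρ * Fintype.card (CoordPair d) -
      (2 * ε + ρ * Fintype.card (CoordPair d) * ε + κ) * G x ≤ nodeBound n ρ κ ε P G v := by
  have hn0 : (0 : ℝ) < n := by exact_mod_cast hn
  set m : ℝ := (Fintype.card (CoordPair d) : ℝ) with hm
  have hnr : n * (ε / n) = ε := by field_simp
  have hnuv : n * ‖x - v‖ ≤ ε := by nlinarith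
  have h0 : localInf G 0 x ≤ G x := localInf_le h.nonneg hx (by simp)
  have hG := h.nonneg x
  have h1 := (abs_le.1 (h.pEval_sub_le_localInf hn le_rfl hx hx hv (by
    rw [sub_self, norm_zero]; linarith))).1
  have h2 := (abs_le.1 (h.abs_rotAbs_sub_le le_rfl hx hx hv
    (by rw [sub_self, norm_zero]; linarith) (by rw [norm_sub_rev]; linarith))).2
  have h3 : localInf G (4 * ε / n) v ≤ G x := localInf_le h.nonneg hx (by
    rw [dist_eq_norm]; exact hxv.trans (by gcongr; linarith))
  have h4 : n * (2 * ‖x - v‖ * localInf G 0 x) ≤ 2 * ε * G x := by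
    calc _ = 2 * (n * ‖x - v‖) * localInf G 0 x := by ring
      _ ≤ _ := by gcongr; exact localInf_nonneg h.nonneg _ _
  have h5 : ρ * (m * (n * ‖x - v‖ * localInf G 0 x)) ≤ ρ * m * ε * G x := by
    calc _ = ρ * m * (n * ‖x - v‖) * localInf G 0 x := by ring
      _ ≤ _ := by gcongr; exact localInf_nonneg h.nonneg _ _
  have h6 := mul_le_mul_of_nonneg_left h1 hn0.le
  have h7 := mul_le_mul_of_nonneg_left h2 hρ
  have h8 := mul_le_mul_of_nonneg_left h3 hκ
  unfold nodeBound
  rw [← hm]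
  linarith

end RotControl

end MovedNodes

section NodeFamily

variable {ν : Measure (EuclideanSpace ℝ (Fin d))} {P : MvPolynomial (Fin d) ℝ} {n : ℕ}
  {G : EuclideanSpace ℝ (Fin d) → ℝ} {ρ κ ε L A : ℝ} {V : Finset (EuclideanSpace ℝ (Fin d))}

lemma RotControl.sum_localInf_le [IsProbabilityMeasure ν] (h : RotControl ν n P G)
    (hν : SphereDoubling ν L) (hn : 1 ≤ n) (hε : 0 < ε) (hVS : ↑V ⊆ unitSphere d)
    (hsep : ∀ u ∈ V, ∀ v ∈ V, u ≠ v → ε / n < dist u v) {k : ℕ} (hk : 2 ≤ 2 ^ k * ε)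
    (hA : ∀ x ∈ unitSphere d, 1 ≤ A * ν.real (Metric.closedBall x (1 / n))) :
    ∑ v ∈ V, localInf G (ε / n) v ≤ A * L ^ k * ∫ x, G x ∂ν := by
  have hn0 : (0 : ℝ) < n := by exact_mod_cast hn
  have hA0 : 0 ≤ A := by
    obtain ⟨x, hx⟩ := hν.nonempty
    by_contra hneg
    have := mul_nonneg (neg_nonneg.2 (not_le.1 hneg).le)
      (measureReal_nonneg (μ := ν) (s := Metric.closedBall x (1 / n)))
    linarith [hA x hx]
  have hL0 : 0 ≤ L := by linarith [hν.one_le]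
  have h1 := sum_measureReal_mul_localInf_le (V := V) (r := ε / n) hν.compl h.integrable h.nonneg
    (R := fun v => Metric.closedBall v (ε / n / 2))
    (fun v => Metric.isClosed_closedBall.measurableSet)
    (fun v => Metric.closedBall_subset_closedBall (by linarith [div_pos hε hn0]))
    (fun u hu v hv huv => Metric.closedBall_disjoint_closedBall
      (by linarith [hsep u hu v hv huv]))
  refine le_trans ?_ (mul_le_mul_of_nonneg_left h1 (by positivity))
  rw [Finset.mul_sum]
  refine Finset.sum_le_sum fun v hv => ?_
  have h2 := hν.measureReal_closedBall_le (hVS hv) (r := ε / n / 2) (R := 1 / n) (by positivity) k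
    (by rw [div_div, mul_div_assoc', div_le_div_iff₀ hn0 (by positivity)]; nlinarith)
  have h3 : 1 ≤ A * L ^ k * ν.real (Metric.closedBall v (ε / n / 2)) := by
    rw [mul_assoc]
    exact (hA v (hVS hv)).trans (mul_le_mul_of_nonneg_left h2 hA0)
  rw [← mul_assoc]
  exact le_mul_of_one_le_left (localInf_nonneg h.nonneg _ _) h3

lemma RotControl.le_sum_mul_nodeBound [IsProbabilityMeasure ν] (h : RotControl ν n P G)
    (hν : SphereDoubling ν L) (hn : 1 ≤ n) (hρ : 0 ≤ ρ) (hκ : 0 ≤ κ) (hε : 0 < ε)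
    (hε' : ε ≤ 1 / 8) (hVS : ↑V ⊆ unitSphere d)
    {R : EuclideanSpace ℝ (Fin d) → Set (EuclideanSpace ℝ (Fin d))}
    (hRm : ∀ v, MeasurableSet (R v)) (hRb : ∀ v, R v ⊆ Metric.closedBall v (ε / n))
    (hRd : (↑V : Set (EuclideanSpace ℝ (Fin d))).PairwiseDisjoint R)
    (hRs : unitSphere d ⊆ ⋃ v ∈ V, R v) :
    n * ∫ x, pEval P x ∂ν + ρ * ∫ x, rotAbs P x ∂ν - ρ * Fintype.card (CoordPair d) -
      (2 * ε + ρ * Fintype.card (CoordPair d) * ε + κ) * ∫ x, G x ∂ν ≤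
      ∑ v ∈ V, ν.real (R v) * nodeBound n ρ κ ε P G v := by
  have i1 : Integrable (fun x => n * pEval P x) ν :=
    (hν.integrable_of_continuousOn (continuous_pEval P)).const_mul _
  have i2 : Integrable (fun x => ρ * rotAbs P x) ν :=
    (hν.integrable_of_continuousOn continuous_rotAbs).const_mul _
  have i3 := h.integrable.const_mul (2 * ε + ρ * Fintype.card (CoordPair d) * ε + κ)
  refine le_trans (le_of_eq ?_) (integral_le_sum_measureReal_mul hν.compl
    (((i1.add i2).sub (integrable_const (ρ * Fintype.card (CoordPair d)))).sub i3) hRm hRb hRd hRs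
    fun v hv x hx hxv => h.le_nodeBound hn (hVS hv) hx hρ hκ hε.le hε' (by rwa [← dist_eq_norm]))
  rw [integral_sub' ((i1.add i2).sub (integrable_const _)) i3,
    integral_sub' (i1.add i2) (integrable_const _), integral_add' i1 i2]
  generalize (Fintype.card (CoordPair d) : ℝ) = m
  simp only [integral_const_mul, integral_const, probReal_univ, one_smul]

lemma pEval_rotDeriv_sum_smul {M : ℕ} (c : EuclideanSpace ℝ (Fin M))
    (p : Fin M → MvPolynomial (Fin d) ℝ) (i j : Fin d) (x : EuclideanSpace ℝ (Fin d)) :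
    pEval (rotDeriv i j (∑ a, c a • p a)) x = ∑ a, c a * pEval (rotDeriv i j (p a)) x := by
  simp only [rotDeriv, map_sum, pEval_sub, pEval_mul, pEval_X, pEval_sum, Finset.mul_sum,
    ← Finset.sum_sub_distrib]
  exact Finset.sum_congr rfl fun a _ => by
    rw [Derivation.map_smul, Derivation.map_smul, pEval_smul, pEval_smul]; ring

/-- The arithmetic of the error terms in the construction of the nodes. -/
lemma rounding_error_lt {C₀ m I D N A' S T : ℝ} (hρ : 0 < ρ) (hD : 2 * m < D) (hI : 0 ≤ I)
    (hI' : I ≤ C₀ * D) (hN : A' ≤ N) (hεC : C₀ * ε ≤ ρ / 64) (hκC : κ * C₀ ≤ ρ / 8)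
    (hρmε : ρ * m * ε * C₀ ≤ ρ / 64) (hε : 0 ≤ ε) (hκ : 0 ≤ κ) (hm : 0 ≤ m)
    (hN0 : 0 < N) (hS : S ≤ A' * I)
    (hT : ρ * D - ρ * m - (2 * ε + ρ * m * ε + κ) * I ≤ T) :
    (4 * ε + 2 * ρ * m * ε + κ) * S < N * T := by
  have hD0 : 0 ≤ D := by linarith
  have h5 : (4 * ε + 2 * ρ * m * ε + κ) * S ≤ N * (ρ / 4 * D) := by
    calc _ ≤ (4 * ε + 2 * ρ * m * ε + κ) * (N * (C₀ * D)) := by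
          gcongr
          exact hS.trans (by gcongr)
      _ = N * D * (4 * (C₀ * ε) + 2 * (ρ * m * ε * C₀) + κ * C₀) := by ring
      _ ≤ N * D * (ρ / 4) := by
          gcongr
          linarith
      _ = _ := by ring
  have h6 : (2 * ε + ρ * m * ε + κ) * I ≤ ρ / 4 * D := by
    calc _ ≤ (2 * ε + ρ * m * ε + κ) * (C₀ * D) := by gcongr
      _ = D * (2 * (C₀ * ε) + ρ * m * ε * C₀ + κ * C₀) := by ring
      _ ≤ D * (ρ / 4) := by
          gcongr
          linarith
      _ = _ := by ring
  have h7 : N * (ρ * D - ρ * m - ρ / 4 * D) ≤ N * T := by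
    gcongr
    linarith
  have h8 : 0 < N * (ρ * (D / 2 - m)) := mul_pos hN0 (mul_pos hρ (by linarith))
  linarith

set_option maxHeartbeats 400000 in
/-- Families of points depending continuously on `P`, at which `P` is positive on average as soon as
it has mean zero and sufficiently large derivatives. -/
theorem exists_node_family (hd : 2 ≤ d) (L : ℝ) : ∃ C : ℝ, 0 < C ∧
    ∀ (ν : Measure (EuclideanSpace ℝ (Fin d))) [IsProbabilityMeasure ν], SphereDoubling ν L →
    ∀ n : ℕ, 1 ≤ n → ∀ A : ℝ,
    (∀ x ∈ unitSphere d, 1 ≤ A * ν.real (Metric.closedBall x (1 / n))) →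
    ∃ (ι : Type) (_ : Fintype ι) (X : MvPolynomial (Fin d) ℝ → ι → EuclideanSpace ℝ (Fin d)),
      0 < Fintype.card ι ∧ (Fintype.card ι : ℝ) ≤ C * A ∧ (∀ P i, X P i ∈ unitSphere d) ∧
      (∀ P, Function.Injective (X P)) ∧
      (∀ (M : ℕ) (b : Fin M → MvPolynomial (Fin d) ℝ) (i : ι),
        Continuous fun c : EuclideanSpace ℝ (Fin M) => X (∑ j, c j • b j) i) ∧
      ∀ P : MvPolynomial (Fin d) ℝ, P.totalDegree ≤ n → ∫ x, pEval P x ∂ν = 0 →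
        2 * Fintype.card (CoordPair d) < ∫ x, rotAbs P x ∂ν → 0 < ∑ i, pEval P (X P i) := by
  obtain ⟨C₀, hC₀, hctrl⟩ := exists_rotControl d L
  set m : ℝ := (Fintype.card (CoordPair d) : ℝ) with hm
  have hm1 : 1 ≤ m := by
    have : Nonempty (CoordPair d) := ⟨⟨(⟨0, by omega⟩, ⟨1, by omega⟩), by simp⟩⟩
    rw [hm]
    exact_mod_cast Fintype.card_pos (α := CoordPair d)
  set K : ℝ := 64 * m * C₀ with hK
  set ρ : ℝ := 1 / (256 * m ^ 2 * C₀) with hρ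
  set ε : ℝ := ρ / (64 * m * C₀) with hε
  have hC00 : 0 < C₀ := by linarith
  have hm0 : 0 < m := by linarith
  have hmC : 1 ≤ m * C₀ := by nlinarith
  have hρ0 : 0 < ρ := by positivity
  have hε0 : 0 < ε := by positivity
  have hρm : m * (m * ρ * C₀) = 1 / 256 := by rw [hρ]; field_simp
  have hεm : 64 * (m * C₀ * ε) = ρ := by rw [hε]; field_simp
  have hK2 : 2 ≤ K := by rw [hK]; nlinarith
  have hmρ : m * ρ ≤ 1 / 256 := by
    have : m * ρ * 1 ≤ m * ρ * (m * C₀) := by gcongr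
    nlinarith
  have hρ1 : ρ ≤ 1 / 256 := by nlinarith
  have hε1 : ε ≤ ρ / 64 := by nlinarith
  have hκ0 : 0 ≤ ρ * (4 * m / K + m * (m * ρ + ε)) + 2 * ε := by positivity
  set κ : ℝ := ρ * (4 * m / K + m * (m * ρ + ε)) + 2 * ε with hκ
  have hεC : C₀ * ε ≤ ρ / 64 := by
    have : C₀ * ε * 1 ≤ C₀ * ε * m := by gcongr
    linarith
  have hκC : κ * C₀ ≤ ρ / 8 := by
    have : κ * C₀ = ρ * (1 / 16 + 1 / 256 + m * C₀ * ε) + 2 * (C₀ * ε) := by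
      rw [hκ, ← hρm, hK]; field_simp; ring
    rw [this]
    nlinarith
  have hρmε : ρ * m * ε * C₀ ≤ ρ / 64 := by
    have : ρ * m * ε * C₀ = ρ * (m * C₀ * ε) := by ring
    rw [this]
    nlinarith
  clear_value m K ρ ε κ
  obtain ⟨k, hk⟩ := pow_unbounded_of_one_lt (2 / ε) one_lt_two
  rw [div_lt_iff₀ hε0] at hk
  refine ⟨2 * max 1 L ^ k, by positivity, fun ν _ hν n hn A hA => ?_⟩
  have hn0 : (0 : ℝ) < n := by exact_mod_cast hn
  have hL1 := hν.one_le
  rw [max_eq_right hL1]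
  have hA1 : 1 ≤ A := by
    obtain ⟨x, hx⟩ := hν.nonempty
    have h1 := hA x hx
    have h2 : ν.real (Metric.closedBall x (1 / n)) ≤ 1 := measureReal_le_one
    have h3 := measureReal_nonneg (μ := ν) (s := Metric.closedBall x (1 / n))
    by_contra hA'
    have h4 : 1 ≤ ν.real (Metric.closedBall x (1 / n)) := by nlinarith
    rw [le_antisymm h2 h4] at h1
    linarith
  have hLk : 1 ≤ L ^ k := one_le_pow₀ hL1
  obtain ⟨V, hVS, hsep, hcov⟩ := exists_finset_net
    (isCompact_sphere (0 : EuclideanSpace ℝ (Fin d)) 1) (r := ε / n) (by positivity)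
  obtain ⟨R, hRm, hRb, hRd, hRs⟩ := exists_partition_net hcov
  have hVne : V.Nonempty := by
    obtain ⟨x, hx⟩ := hν.nonempty
    obtain ⟨v, hv, -⟩ := hcov x hx
    exact ⟨v, hv⟩
  have hRsum : ∑ v ∈ V, ν.real (R v) = 1 := by
    rw [← measureReal_biUnion_finset hRd fun v _ => hRm v, measureReal_def,
      (prob_compl_eq_zero_iff (V.measurableSet_biUnion fun v _ => hRm v)).1
        (measure_mono_null (compl_subset_compl.2 hRs) hν.compl), ENNReal.toReal_one]
  set N : ℕ := ⌈A * L ^ k⌉₊ with hN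
  have hNge : A * L ^ k ≤ N := Nat.le_ceil _
  have hAL : 1 ≤ A * L ^ k := by nlinarith
  have hNle : (N : ℝ) ≤ 2 * L ^ k * A := by
    have := Nat.ceil_lt_add_one (by linarith : 0 ≤ A * L ^ k)
    linarith
  obtain ⟨b, hbN, hb⟩ := exists_rounding (fun v u => dist v u ≤ 2 * (ε / n)) V hVne
    (fun W hWV hW hne => exists_dist_le_of_net (isPreconnected_unitSphere hd) (by positivity)
      hVS hcov hWV hW hne) (fun v => N * ν.real (R v))
    (fun v _ => mul_nonneg N.cast_nonneg measureReal_nonneg) N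
    (by rw [← Finset.mul_sum, hRsum, mul_one])
  have hinf : ∀ v : V, (unitSphere d ∩ Metric.closedBall (v : EuclideanSpace ℝ (Fin d))
      (ε / (4 * n))).Infinite := fun v =>
    infinite_unitSphere_inter_closedBall hd (hVS v.2) (by positivity)
  let q : (v : V) → ℕ ↪ _ := fun v => (hinf v).natEmbedding
  have hqS : ∀ v j, (q v j : EuclideanSpace ℝ (Fin d)) ∈ unitSphere d := fun v j => (q v j).2.1
  have hqv : ∀ v j, ‖(q v j : EuclideanSpace ℝ (Fin d)) - v‖ ≤ ε / (4 * n) := fun v j => by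
    rw [← dist_eq_norm]; exact (q v j).2.2
  have hcard : Fintype.card ((v : V) × Fin (b v)) = N := by
    rw [Fintype.card_sigma]
    simp only [Fintype.card_fin]
    rw [Finset.sum_coe_sort V b, hbN]
  let X : MvPolynomial (Fin d) ℝ → ((v : V) × Fin (b v)) → EuclideanSpace ℝ (Fin d) :=
    fun P i => movedNode hVne (ρ / n) (K * n) P i.1 (q i.1 i.2)
  have key : ∃ (ι : Type) (_ : Fintype ι) (e : ι ≃ (v : V) × Fin (b v)), True :=
    ⟨Fin N, inferInstance, (Fintype.equivFinOfCardEq hcard).symm, trivial⟩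
  obtain ⟨ι, _, e, -⟩ := key
  have hcardι : Fintype.card ι = N := (Fintype.card_congr e).trans hcard
  refine ⟨ι, inferInstance, fun P i => X P (e i), ?_, by rwa [hcardι],
    fun P i => movedNode_mem _ _ _ _ (hqS _ _), fun P => ?_, fun M p i => ?_,
    fun P hP hP0 hD => ?_⟩
  · rw [hcardι]
    exact_mod_cast (by linarith : (0 : ℝ) < N)
  · refine Function.Injective.comp (g := X P) ?_ e.injective
    rintro ⟨v, i⟩ ⟨u, j⟩ h
    have hvu : v = u := by
      by_contra hne
      have hne' : (v : EuclideanSpace ℝ (Fin d)) ≠ u := fun h => hne (Subtype.ext h)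
      have h1 := hsep v v.2 u u.2 hne'
      rw [dist_eq_norm] at h1
      have h2 : ε / (4 * n) = ε / n / 4 := by field_simp
      refine hne' (eq_of_movedNode_eq hVne (s := ρ / n) (K := K * n) (by positivity)
        (by positivity) ?_ (hqS u j) ((hqv v i).trans (by linarith))
        ((hqv u j).trans (by linarith)) h)
      rw [← hm]
      refine le_of_eq ?_
      rw [hK, hρ]
      field_simp
      norm_num
    subst hvu
    have := (q v).injective (Subtype.ext (movedNode_inj hVne h))
    rw [show i = j from Fin.val_injective this]
  · refine continuous_rotList (fun l => Continuous.const_mul ?_ _) _ continuous_const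
    refine Continuous.finset_sup'_apply hVne fun u _ => ?_
    have : Continuous truncOne := by unfold truncOne; fun_prop
    refine (this.comp ?_).sub continuous_const
    simp only [pEval_rotDeriv_sum_smul]
    fun_prop
  · obtain ⟨G, hG, hGC⟩ := hctrl ν hν n hn P hP
    have hI0 : 0 ≤ ∫ x, G x ∂ν := integral_nonneg hG.nonneg
    have h1 : ∑ v ∈ V, (b v : ℝ) * nodeBound n ρ κ ε P G v ≤ n * ∑ i, pEval P (X P (e i)) := by
      have hnode : ∀ (v : V) (j : Fin (b v)),
          nodeBound n ρ κ ε P G v ≤ n * pEval P (X P ⟨v, j⟩) := fun v j => by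
        rw [hκ, hm]
        exact hG.nodeBound_le hn hVne hVS v.2 (hqS v j) hρ0.le hε0.le (by linarith) hK2
          (by rw [← hm]; linarith) ((hqv v j).trans (by gcongr; linarith))
      rw [Equiv.sum_comp e (fun i => pEval P (X P i)), Fintype.sum_sigma, Finset.mul_sum,
        ← Finset.sum_coe_sort V]
      refine Finset.sum_le_sum fun v _ => ?_
      have h2 := Finset.card_nsmul_le_sum Finset.univ
        (fun j : Fin (b v) => n * pEval P (X P ⟨v, j⟩)) _ fun j _ => hnode v j
      rwa [Finset.card_univ, Fintype.card_fin, nsmul_eq_mul, ← Finset.mul_sum] at h2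
    have h2 := hG.le_sum_mul_nodeBound hν hn hρ0.le hκ0 hε0 (by linarith) hVS hRm hRb hRd hRs
    rw [hP0, mul_zero, zero_add, ← hm] at h2
    have h3 := (abs_le.1 (hb (nodeBound n ρ κ ε P G) (fun v => (4 * ε + 2 * ρ * m * ε + κ) *
      localInf G (ε / n) v) (fun v _ => mul_nonneg (by positivity)
        (localInf_nonneg hG.nonneg _ _)) fun u hu v hv huv => by
        rw [dist_eq_norm] at huv
        rw [hm]
        exact hG.abs_nodeBound_sub_le hn (hVS hv) (hVS hu) hρ0.le hκ0 hε0.le (by linarith) huv)).1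
    have h4 := hG.sum_localInf_le hν hn hε0 hVS hsep (k := k) hk.le hA
    simp only [sub_mul, Finset.sum_sub_distrib, mul_assoc (N : ℝ), ← Finset.mul_sum] at h3
    have h8 := rounding_error_lt hρ0 hD hI0 hGC hNge hεC hκC hρmε hε0.le hκ0 hm0.le
      (by linarith) h4 h2
    have h9 : 0 < n * ∑ i, pEval P (X P (e i)) := by linarith
    exact (mul_pos_iff_of_pos_left hn0).1 h9

end NodeFamily

section CubatureExistence

variable {ν : Measure (EuclideanSpace ℝ (Fin d))} {L : ℝ} {n M : ℕ}

/-- A basis of the mean zero polynomials of degree at most `n`, considered on the sphere. -/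
lemma exists_meanZero_basis (n : ℕ) (Λ : MvPolynomial (Fin d) ℝ →ₗ[ℝ] ℝ) :
    ∃ (M : ℕ) (p : Fin M → MvPolynomial (Fin d) ℝ), (∀ j, (p j).totalDegree ≤ n) ∧
      (∀ j, Λ (p j) = 0) ∧
      (∀ P : MvPolynomial (Fin d) ℝ, P.totalDegree ≤ n → Λ P = 0 →
        ∃ c : Fin M → ℝ, ∀ x ∈ unitSphere d, pEval P x = ∑ j, c j * pEval (p j) x) ∧
      ∀ c : Fin M → ℝ, (∀ x ∈ unitSphere d, ∑ j, c j * pEval (p j) x = 0) → c = 0 := by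
  let Φ : MvPolynomial (Fin d) ℝ →ₗ[ℝ] (unitSphere d → ℝ) :=
    { toFun := fun P x => pEval P x
      map_add' := fun P Q => by ext x; simp
      map_smul' := fun a P => by ext x; simp }
  let W := MvPolynomial.restrictTotalDegree (Fin d) ℝ n ⊓ LinearMap.ker Λ
  have : Module.Finite ℝ W := Submodule.finiteDimensional_of_le inf_le_left
  let U := W.map Φ
  have b := Module.finBasis ℝ U
  have hb : ∀ j, ∃ p ∈ W, Φ p = b j := fun j => Submodule.mem_map.1 (b j).2
  choose p hpW hpb using hb
  have hpx : ∀ j (x : unitSphere d), pEval (p j) x = (b j : unitSphere d → ℝ) x := fun j x =>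
    congrFun (hpb j) x
  refine ⟨_, p, fun j => (MvPolynomial.mem_restrictTotalDegree _ _ _).1 (hpW j).1,
    fun j => (hpW j).2, fun P hP hP0 => ?_, fun c hc => ?_⟩
  · have hPU : Φ P ∈ U :=
      Submodule.mem_map_of_mem ⟨(MvPolynomial.mem_restrictTotalDegree _ _ _).2 hP, hP0⟩
    refine ⟨b.repr ⟨Φ P, hPU⟩, fun x hx => ?_⟩
    have h1 := congrArg (fun f : U => (f : unitSphere d → ℝ) ⟨x, hx⟩) (b.sum_repr ⟨Φ P, hPU⟩)
    simp only [Submodule.coe_sum, Finset.sum_apply, Submodule.coe_smul, Pi.smul_apply,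
      smul_eq_mul, ← hpx] at h1
    exact h1.symm
  · have h1 : ∑ j, c j • b j = 0 := by
      ext x
      simp only [Submodule.coe_sum, Finset.sum_apply, Submodule.coe_smul, Pi.smul_apply,
        smul_eq_mul, ← hpx]
      exact hc x x.2
    exact funext fun j => Fintype.linearIndependent_iff.1 b.linearIndependent c h1 j

/-- A continuous nonnegative function with vanishing integral vanishes on the sphere. -/
lemma SphereDoubling.eq_zero_of_integral_eq_zero [IsProbabilityMeasure ν]
    (hν : SphereDoubling ν L) {f : EuclideanSpace ℝ (Fin d) → ℝ} (hf : Continuous f)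
    (hf0 : ∀ x, 0 ≤ f x) (h : ∫ x, f x ∂ν = 0) {x : EuclideanSpace ℝ (Fin d)}
    (hx : x ∈ unitSphere d) : f x = 0 := by
  by_contra hne
  have h1 := (integral_eq_zero_iff_of_nonneg hf0 (hν.integrable_of_continuousOn hf)).1 h
  obtain ⟨r, hr, hball⟩ := Metric.nhds_basis_closedBall.mem_iff.1
    (hf.continuousAt.eventually_ne hne)
  have h2 := hν.measureReal_closedBall_pos hx hr
  have h3 : ν (Metric.closedBall x r) = 0 := measure_mono_null hball h1
  rw [measureReal_def, h3] at h2
  simp at h2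

lemma rotAbs_sum_smul (p : Fin M → MvPolynomial (Fin d) ℝ) (c : EuclideanSpace ℝ (Fin M))
    (x : EuclideanSpace ℝ (Fin d)) : rotAbs (∑ j, c j • p j) x =
      ∑ l : CoordPair d, |∑ j, c j * pEval (rotDeriv l.1.1 l.1.2 (p j)) x| := by
  simp only [rotAbs, pEval_rotDeriv_sum_smul]

lemma SphereDoubling.continuous_integral_rotAbs [IsProbabilityMeasure ν]
    (hν : SphereDoubling ν L) (p : Fin M → MvPolynomial (Fin d) ℝ) :
    Continuous fun c : EuclideanSpace ℝ (Fin M) => ∫ x, rotAbs (∑ j, c j • p j) x ∂ν := by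
  rw [← Measure.restrict_eq_self_of_ae_mem hν.ae_mem]
  refine continuous_parametric_integral_of_continuous ?_
    (isCompact_sphere (0 : EuclideanSpace ℝ (Fin d)) 1)
  simp only [Function.uncurry_def, rotAbs_sum_smul]
  fun_prop

/-- The size of the derivatives controls the coefficients in a basis. -/
lemma SphereDoubling.exists_lt_integral_rotAbs [IsProbabilityMeasure ν] (hd : 2 ≤ d)
    (hν : SphereDoubling ν L) (p : Fin M → MvPolynomial (Fin d) ℝ)
    (hp0 : ∀ j, ∫ x, pEval (p j) x ∂ν = 0)
    (hp : ∀ c : Fin M → ℝ, (∀ x ∈ unitSphere d, ∑ j, c j * pEval (p j) x = 0) → c = 0) (a : ℝ) :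
    ∃ r : ℝ, ∀ c : EuclideanSpace ℝ (Fin M), r ≤ ‖c‖ → a < ∫ x, rotAbs (∑ j, c j • p j) x ∂ν := by
  set D : EuclideanSpace ℝ (Fin M) → ℝ := fun c => ∫ x, rotAbs (∑ j, c j • p j) x ∂ν with hD
  have hrot0 : ∀ (P : MvPolynomial (Fin d) ℝ) x, 0 ≤ rotAbs P x := fun P x =>
    Finset.sum_nonneg fun _ _ => abs_nonneg _
  have hpos : ∀ c, c ≠ 0 → 0 < D c := fun c hc => by
    refine lt_of_le_of_ne (integral_nonneg fun x => hrot0 _ x) fun h0 => hc ?_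
    set P := ∑ j, c j • p j with hP
    have h1 : ∀ x ∈ unitSphere d, rotAbs P x = 0 := fun x hx =>
      hν.eq_zero_of_integral_eq_zero continuous_rotAbs (hrot0 P) h0.symm hx
    have h2 : ∀ l : CoordPair d, ∀ z ∈ unitSphere d, pEval (rotDeriv l.1.1 l.1.2 P) z = 0 :=
      fun l z hz => abs_eq_zero.1 ((Finset.sum_eq_zero_iff_of_nonneg fun _ _ => abs_nonneg _).1
        (h1 z hz) l (Finset.mem_univ l))
    have h3 : ∫ x, pEval P x ∂ν = 0 := by
      simp only [hP, pEval_sum, pEval_smul]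
      rw [integral_finsetSum _ fun j _ =>
        (hν.integrable_of_continuousOn (continuous_pEval (p j))).const_mul _]
      simp only [integral_const_mul, hp0, mul_zero, Finset.sum_const_zero]
    have h4 : ∀ x ∈ unitSphere d, pEval P x = 0 := fun x hx => by
      rw [← h3, integral_congr_ae (hν.ae_mem.mono fun y hy =>
        pEval_eq_of_rotDeriv_eq_zero hd h2 hx hy)]
      simp
    have h5 := hp c fun x hx => by
      rw [← h4 x hx, hP, pEval_sum]
      simp only [pEval_smul]
    ext j
    exact congrFun h5 j
  have hhom : ∀ (t : ℝ) c, D (t • c) = |t| * D c := fun t c => by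
    simp only [hD, rotAbs_sum_smul]
    rw [← integral_const_mul]
    congr 1
    ext x
    rw [Finset.mul_sum]
    refine Finset.sum_congr rfl fun l _ => ?_
    rw [← abs_mul, Finset.mul_sum]
    simp only [PiLp.smul_apply, smul_eq_mul, mul_assoc]
  have hmin : ∃ δ : ℝ, 0 < δ ∧ ∀ c, ‖c‖ = 1 → δ ≤ D c := by
    rcases (Metric.sphere (0 : EuclideanSpace ℝ (Fin M)) 1).eq_empty_or_nonempty with h | h
    · exact ⟨1, one_pos, fun c hc => absurd (mem_sphere_zero_iff_norm.2 hc) (by simp [h])⟩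
    · obtain ⟨c, hc, hmin⟩ := (isCompact_sphere _ _).exists_isMinOn h
        (hν.continuous_integral_rotAbs p).continuousOn
      refine ⟨D c, hpos c ?_, fun c' hc' => hmin (mem_sphere_zero_iff_norm.2 hc')⟩
      rintro rfl
      simp at hc
  obtain ⟨δ, hδ, hmin⟩ := hmin
  refine ⟨max 1 ((a + 1) / δ), fun c hc => ?_⟩
  have hc1 : 0 < ‖c‖ := zero_lt_one.trans_le ((le_max_left _ _).trans hc)
  have h1 := hmin (‖c‖⁻¹ • c) (by rw [norm_smul, norm_inv, norm_norm, inv_mul_cancel₀ hc1.ne'])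
  rw [hhom, abs_of_pos (by positivity), le_inv_mul_iff₀ hc1] at h1
  have h2 := (div_le_iff₀ hδ).1 ((le_max_right _ _).trans hc)
  change a < D c
  linarith

/-- Existence of strict Chebyshev-type cubature formulas with few nodes. -/
theorem exists_cubature (hd : 2 ≤ d) (L : ℝ) : ∃ C : ℝ, 0 < C ∧
    ∀ (ν : Measure (EuclideanSpace ℝ (Fin d))) [IsProbabilityMeasure ν], SphereDoubling ν L →
    ∀ n : ℕ, 1 ≤ n → ∀ A : ℝ,
    (∀ x ∈ unitSphere d, 1 ≤ A * ν.real (Metric.closedBall x (1 / n))) →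
    ∃ Z : Finset (EuclideanSpace ℝ (Fin d)), 0 < Z.card ∧ (Z.card : ℝ) ≤ C * A ∧
      ↑Z ⊆ unitSphere d ∧ ∀ P : MvPolynomial (Fin d) ℝ, P.totalDegree ≤ n →
        ∫ x, pEval P x ∂ν = (1 / (Z.card : ℝ)) * ∑ z ∈ Z, pEval P z := by
  obtain ⟨C, hC, h⟩ := exists_node_family hd L
  refine ⟨C, hC, fun ν _ hν n hn A hA => ?_⟩
  obtain ⟨ι, _, X, hι, hιC, hXS, hXinj, hXcont, hX⟩ := h ν hν n hn A hA
  have hintg : ∀ P : MvPolynomial (Fin d) ℝ, Integrable (pEval P) ν := fun P =>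
    hν.integrable_of_continuousOn (continuous_pEval P)
  let Λ : MvPolynomial (Fin d) ℝ →ₗ[ℝ] ℝ :=
    { toFun := fun P => ∫ x, pEval P x ∂ν
      map_add' := fun P Q => by simpa using integral_add (hintg P) (hintg Q)
      map_smul' := fun a P => by simpa using integral_const_mul a (pEval P) }
  obtain ⟨M, p, hpn, hp0, hspan, hindep⟩ := exists_meanZero_basis n Λ
  obtain ⟨r, hr⟩ := hν.exists_lt_integral_rotAbs hd p hp0 hindep
    (2 * Fintype.card (CoordPair d))
  set P : EuclideanSpace ℝ (Fin M) → MvPolynomial (Fin d) ℝ := fun c => ∑ j, c j • p j with hP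
  have hPn : ∀ c, (P c).totalDegree ≤ n := fun c =>
    MvPolynomial.totalDegree_finsetSum_le fun j _ =>
      (MvPolynomial.totalDegree_smul_le _ _).trans (hpn j)
  have hP0 : ∀ c, ∫ x, pEval (P c) x ∂ν = 0 := fun c => by
    change Λ (P c) = 0
    simp only [hP, map_sum, map_smul, hp0, smul_zero, Finset.sum_const_zero]
  set F : EuclideanSpace ℝ (Fin M) → EuclideanSpace ℝ (Fin M) := fun c =>
    WithLp.toLp 2 fun j => ∑ i, pEval (p j) (X (P c) i) with hF
  have hFcont : Continuous F := (PiLp.continuous_toLp 2 _).comp (continuous_pi fun j =>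
    continuous_finsetSum _ fun i _ => (continuous_pEval (p j)).comp (hXcont M p i))
  obtain ⟨c, hc⟩ := exists_zero_of_inner_pos hFcont (r := r) fun c hc => by
    have h1 := hX (P c) (hPn c) (hP0 c) (hr c hc)
    refine h1.trans_eq ?_
    simp only [hP, pEval_sum, pEval_smul]
    rw [Finset.sum_comm, PiLp.inner_apply]
    refine Finset.sum_congr rfl fun j _ => ?_
    rw [← Finset.mul_sum]
    rfl
  have hzero : ∀ Q : MvPolynomial (Fin d) ℝ, Q.totalDegree ≤ n → ∫ x, pEval Q x ∂ν = 0 →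
      ∑ i, pEval Q (X (P c) i) = 0 := fun Q hQ hQ0 => by
    obtain ⟨a, ha⟩ := hspan Q hQ hQ0
    simp only [ha _ (hXS (P c) _)]
    rw [Finset.sum_comm]
    refine Finset.sum_eq_zero fun j _ => ?_
    rw [← Finset.mul_sum]
    have : ∑ i, pEval (p j) (X (P c) i) = 0 := congrFun (congrArg WithLp.ofLp hc) j
    rw [this, mul_zero]
  refine ⟨Finset.univ.map ⟨X (P c), hXinj (P c)⟩, by rwa [Finset.card_map],
    by rwa [Finset.card_map], ?_, fun Q hQ => ?_⟩
  · intro z hz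
    simp only [Finset.coe_map, Function.Embedding.coeFn_mk, Finset.coe_univ, image_univ,
      mem_range] at hz
    obtain ⟨i, rfl⟩ := hz
    exact hXS _ i
  · have h1 := hzero (Q - MvPolynomial.C (∫ x, pEval Q x ∂ν))
      ((MvPolynomial.totalDegree_sub _ _).trans (max_le hQ (by simp))) (by
        simp only [pEval_sub, pEval_C]
        rw [integral_sub (hintg Q) (integrable_const _)]
        simp)
    simp only [pEval_sub, pEval_C, Finset.sum_sub_distrib, Finset.sum_const, nsmul_eq_mul] at h1
    have h2 : (0 : ℝ) < Fintype.card ι := by exact_mod_cast hι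
    rw [Finset.card_map, Finset.sum_map, Finset.card_univ, one_div, eq_inv_mul_iff_mul_eq₀ h2.ne']
    rw [Finset.card_univ] at h1
    simp only [Function.Embedding.coeFn_mk]
    linarith

end CubatureExistence

section WeightMeasure

variable {w : EuclideanSpace ℝ (Fin d) → ℝ} {x y : EuclideanSpace ℝ (Fin d)} {r : ℝ}

lemma measurableSet_unitSphere (d : ℕ) : MeasurableSet (unitSphere d) :=
  Metric.isClosed_sphere.measurableSet

lemma cap_subset_unitSphere : cap x r ⊆ unitSphere d := fun _ h => h.1

lemma cap_subset_closedBall (hx : x ∈ unitSphere d) : cap x r ⊆ Metric.closedBall x r := by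
  intro y hy
  rw [Metric.mem_closedBall', dist_eq_norm]
  exact (norm_sub_le_gdist hx hy.1).trans hy.2

lemma closedBall_inter_unitSphere_subset_cap (hx : x ∈ unitSphere d) :
    Metric.closedBall x r ∩ unitSphere d ⊆ cap x (2 * r) := by
  rintro y ⟨hy, hyS⟩
  rw [Metric.mem_closedBall', dist_eq_norm] at hy
  refine ⟨hyS, (gdist_le_norm_sub hx hyS).trans ?_⟩
  have h4 := pi_le_four
  calc π / 2 * ‖x - y‖ ≤ 2 * ‖x - y‖ := by gcongr; linarith
    _ ≤ 2 * r := by gcongr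

lemma wMass_nonneg (hw : ∀ x, 0 ≤ w x) (A : Set (EuclideanSpace ℝ (Fin d))) : 0 ≤ wMass w A :=
  integral_nonneg hw

lemma wMass_mono (hw : ∀ x, 0 ≤ w x) (hi : Integrable w (sphMeasure d))
    {A B : Set (EuclideanSpace ℝ (Fin d))} (hAB : A ⊆ B) : wMass w A ≤ wMass w B :=
  setIntegral_mono_set hi.integrableOn (Filter.Eventually.of_forall hw) hAB.eventuallyLE

/-- The probability measure on the sphere with density proportional to `w`. -/
def weightMeasure (w : EuclideanSpace ℝ (Fin d) → ℝ) : Measure (EuclideanSpace ℝ (Fin d)) :=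
  (ENNReal.ofReal (wMass w (unitSphere d)))⁻¹ •
    (sphMeasure d).withDensity fun x => ENNReal.ofReal (w x)

lemma weightMeasure_apply (hw : ∀ x, 0 ≤ w x) (hi : Integrable w (sphMeasure d))
    {A : Set (EuclideanSpace ℝ (Fin d))} (hA : MeasurableSet A) :
    weightMeasure w A = (ENNReal.ofReal (wMass w (unitSphere d)))⁻¹ * ENNReal.ofReal (wMass w A) := by
  rw [weightMeasure, Measure.smul_apply, withDensity_apply _ hA, smul_eq_mul, wMass,
    ← ofReal_integral_eq_lintegral_ofReal hi.integrableOn (Filter.Eventually.of_forall hw)]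
  rfl

lemma weightMeasure_real (hw : ∀ x, 0 ≤ w x) (hi : Integrable w (sphMeasure d))
    {A : Set (EuclideanSpace ℝ (Fin d))} (hA : MeasurableSet A) :
    (weightMeasure w).real A = wMass w A / wMass w (unitSphere d) := by
  rw [measureReal_def, weightMeasure_apply hw hi hA, ENNReal.toReal_mul, ENNReal.toReal_inv,
    ENNReal.toReal_ofReal (wMass_nonneg hw _), ENNReal.toReal_ofReal (wMass_nonneg hw _),
    div_eq_inv_mul]

lemma weightMeasure_compl (w : EuclideanSpace ℝ (Fin d) → ℝ) :
    weightMeasure w (unitSphere d)ᶜ = 0 := by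
  have h : sphMeasure d (unitSphere d)ᶜ = 0 := by
    rw [sphMeasure, Measure.restrict_apply (measurableSet_unitSphere d).compl, compl_inter_self,
      measure_empty]
  rw [weightMeasure, Measure.smul_apply, withDensity_absolutelyContinuous _ _ h, smul_zero]

lemma isProbabilityMeasure_weightMeasure (hw : ∀ x, 0 ≤ w x) (hi : Integrable w (sphMeasure d))
    (hT : 0 < wMass w (unitSphere d)) : IsProbabilityMeasure (weightMeasure w) := by
  have h : weightMeasure w (unitSphere d) = 1 := by
    rw [weightMeasure_apply hw hi (measurableSet_unitSphere d)]
    exact ENNReal.inv_mul_cancel (ENNReal.ofReal_pos.2 hT).ne' ENNReal.ofReal_ne_top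
  refine ⟨?_⟩
  rw [← measure_add_measure_compl (measurableSet_unitSphere d), weightMeasure_compl, h, add_zero]

lemma integral_weightMeasure (hw : ∀ x, 0 ≤ w x) (hi : Integrable w (sphMeasure d))
    (f : EuclideanSpace ℝ (Fin d) → ℝ) :
    ∫ x, f x ∂(weightMeasure w)
      = (1 / wMass w (unitSphere d)) * ∫ x, f x * w x ∂(sphMeasure d) := by
  rw [weightMeasure, integral_smul_measure,
    integral_withDensity_eq_integral_toReal_smul₀ hi.aestronglyMeasurable.aemeasurable.ennreal_ofReal
      (Filter.Eventually.of_forall fun _ => ENNReal.ofReal_lt_top), ENNReal.toReal_inv,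
    ENNReal.toReal_ofReal (wMass_nonneg hw _), one_div, smul_eq_mul]
  congr 2
  ext x
  rw [ENNReal.toReal_ofReal (hw x), smul_eq_mul, mul_comm]

lemma weightMeasure_real_closedBall_le (hw : ∀ x, 0 ≤ w x) (hi : Integrable w (sphMeasure d))
    (hx : x ∈ unitSphere d) :
    (weightMeasure w).real (Metric.closedBall x r)
      ≤ wMass w (cap x (2 * r)) / wMass w (unitSphere d) := by
  rw [weightMeasure_real hw hi Metric.isClosed_closedBall.measurableSet]
  refine div_le_div_of_nonneg_right ?_ (wMass_nonneg hw _)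
  refine le_trans (le_of_eq ?_) (wMass_mono hw hi (closedBall_inter_unitSphere_subset_cap hx))
  rw [wMass, wMass, sphMeasure, Measure.restrict_restrict Metric.isClosed_closedBall.measurableSet,
    Measure.restrict_restrict (Metric.isClosed_closedBall.measurableSet.inter
      (measurableSet_unitSphere d)), inter_assoc, inter_self]

lemma le_weightMeasure_real_closedBall (hw : ∀ x, 0 ≤ w x) (hi : Integrable w (sphMeasure d))
    (hx : x ∈ unitSphere d) :
    wMass w (cap x r) / wMass w (unitSphere d) ≤ (weightMeasure w).real (Metric.closedBall x r) := by
  rw [weightMeasure_real hw hi Metric.isClosed_closedBall.measurableSet]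
  exact div_le_div_of_nonneg_right (wMass_mono hw hi (cap_subset_closedBall hx)) (wMass_nonneg hw _)

lemma sphereDoubling_weightMeasure (hw : ∀ x, 0 ≤ w x) (hi : Integrable w (sphMeasure d)) {L : ℝ}
    (hL : 0 ≤ L) (hdoub : ∀ x ∈ unitSphere d, ∀ r : ℝ, 0 < r →
      wMass w (cap x (2 * r)) ≤ L * wMass w (cap x r)) :
    SphereDoubling (weightMeasure w) (L ^ 2) := by
  refine ⟨weightMeasure_compl w, fun x hx r hr => ?_⟩
  refine (weightMeasure_real_closedBall_le hw hi hx).trans ?_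
  refine le_trans ?_ (mul_le_mul_of_nonneg_left (le_weightMeasure_real_closedBall hw hi hx)
    (sq_nonneg L))
  rw [← mul_div_assoc]
  refine div_le_div_of_nonneg_right ?_ (wMass_nonneg hw _)
  calc wMass w (cap x (2 * (2 * r))) ≤ L * wMass w (cap x (2 * r)) := hdoub x hx _ (by positivity)
    _ ≤ L * (L * wMass w (cap x r)) := by gcongr; exact hdoub x hx r hr
    _ = L ^ 2 * wMass w (cap x r) := by ring

lemma one_le_of_doubling (hT : 0 < wMass w (unitSphere d)) (hx : x ∈ unitSphere d) {L : ℝ}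
    (hdoub : ∀ x ∈ unitSphere d, ∀ r : ℝ, 0 < r →
      wMass w (cap x (2 * r)) ≤ L * wMass w (cap x r)) : 1 ≤ L := by
  have h : ∀ r, π ≤ r → cap x r = unitSphere d := fun r hr =>
    Subset.antisymm cap_subset_unitSphere fun y hy => ⟨hy, (arccos_le_pi _).trans hr⟩
  have := hdoub x hx π pi_pos
  rw [h _ le_rfl, h _ (by linarith [pi_pos])] at this
  exact le_of_mul_le_mul_right (by linarith) hT

lemma minCubNodes_eq_zero (hT : wMass w (unitSphere d) = 0) (n : ℕ) : minCubNodes d w n = 0 := by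
  rw [minCubNodes, Nat.sInf_eq_zero]
  right
  refine eq_empty_of_forall_notMem ?_
  rintro N ⟨hN, Z, rfl, -, hZ⟩
  have h := hZ 1 (by simp)
  have hN' : (Z.card : ℝ) ≠ 0 := by exact_mod_cast hN.ne'
  simp [hT, hN'] at h

end WeightMeasure

/-- Sharp asymptotics of the minimal size of strict Chebyshev-type
cubature formulas for doubling weights on the sphere. -/
theorem minCubNodes_asymptotics (d : ℕ) (hd : 2 ≤ d) (L : ℝ) :
    ∃ c C : ℝ, 0 < c ∧ c ≤ C ∧
      ∀ w : EuclideanSpace ℝ (Fin d) → ℝ,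
        (∀ x, 0 ≤ w x) →
        Integrable w (sphMeasure d) →
        (∀ x ∈ unitSphere d, ∀ r : ℝ, 0 < r →
          wMass w (cap x (2 * r)) ≤ L * wMass w (cap x r)) →
        ∀ n : ℕ, 0 < n →
          c * sSup ((fun x => wMass w (unitSphere d) / wMass w (cap x (1 / (n : ℝ)))) ''
              unitSphere d)
            ≤ (minCubNodes d w n : ℝ) ∧
          (minCubNodes d w n : ℝ)
            ≤ C * sSup ((fun x => wMass w (unitSphere d) / wMass w (cap x (1 / (n : ℝ)))) ''
              unitSphere d) := by
  obtain ⟨C₁, hC₁, hlow⟩ := SphereDoubling.exists_card_lower_bound d (L ^ 2)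
  obtain ⟨C₂, hC₂, hup⟩ := exists_cubature hd (L ^ 2)
  set M := max 1 L
  have hM : 1 ≤ M := le_max_left _ _
  refine ⟨1 / (M * C₁), max (1 / (M * C₁)) C₂, by positivity, le_max_left _ _, ?_⟩
  intro w hw hi hdoub n hn
  set T := wMass w (unitSphere d) with hTdef
  have hn' : (0 : ℝ) < 1 / n := by positivity
  rcases (wMass_nonneg hw (unitSphere d)).eq_or_lt with hT | hT
  · have h0 : sSup ((fun x => T / wMass w (cap x (1 / (n : ℝ)))) '' unitSphere d) = 0 := by
      refine le_antisymm (Real.sSup_nonpos ?_) (Real.sSup_nonneg ?_) <;>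
      · rintro _ ⟨x, -, rfl⟩
        simp [T, ← hT]
    rw [h0, minCubNodes_eq_zero hT.symm]
    simp
  rw [← hTdef] at hT
  have hprob := isProbabilityMeasure_weightMeasure hw hi hT
  have hne : (unitSphere d).Nonempty := by
    rw [nonempty_iff_ne_empty]
    intro h
    rw [hTdef, h, wMass, Measure.restrict_empty, integral_zero_measure] at hT
    exact hT.false
  obtain ⟨x₀, hx₀⟩ := hne
  have hL : 1 ≤ L := one_le_of_doubling hT hx₀ hdoub
  have hν := sphereDoubling_weightMeasure hw hi (zero_le_one.trans hL) hdoub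
  have hball : ∀ x ∈ unitSphere d, T * (weightMeasure w).real (Metric.closedBall x (1 / n))
      ≤ M * wMass w (cap x (1 / n)) := fun x hx => by
    have h := weightMeasure_real_closedBall_le (r := 1 / n) hw hi hx
    rw [le_div_iff₀' hT] at h
    refine h.trans ((hdoub x hx _ hn').trans ?_)
    exact mul_le_mul_of_nonneg_right (le_max_right _ _) (wMass_nonneg hw _)
  have hpos : ∀ x ∈ unitSphere d, 0 < wMass w (cap x (1 / n)) := fun x hx =>
    pos_of_mul_pos_right ((mul_pos hT (hν.measureReal_closedBall_pos hx hn')).trans_le (hball x hx))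
      (by positivity)
  set A := sSup ((fun x => T / wMass w (cap x (1 / (n : ℝ)))) '' unitSphere d) with hA
  have hbdd : BddAbove ((fun x => T / wMass w (cap x (1 / (n : ℝ)))) '' unitSphere d) := by
    obtain ⟨c, hc, hcx⟩ := hν.exists_le_measureReal_closedBall hn'
    refine ⟨M / c, ?_⟩
    rintro _ ⟨x, hx, rfl⟩
    rw [div_le_div_iff₀ (hpos x hx) hc]
    exact (mul_le_mul_of_nonneg_left (hcx x hx) hT.le).trans (hball x hx)
  have hAx : ∀ x ∈ unitSphere d, 1 ≤ A * (weightMeasure w).real (Metric.closedBall x (1 / n)) :=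
    fun x hx => by
    have h1 : T / wMass w (cap x (1 / (n : ℝ))) ≤ A := le_csSup hbdd (mem_image_of_mem _ hx)
    calc (1 : ℝ) = T / wMass w (cap x (1 / (n : ℝ))) * (wMass w (cap x (1 / n)) / T) := by
          have := (hpos x hx).ne'
          field_simp
      _ ≤ _ := mul_le_mul h1 (le_weightMeasure_real_closedBall hw hi hx)
          (div_nonneg (hpos x hx).le hT.le) ((div_pos hT (hpos x hx)).le.trans h1)
  have hA0 : 0 ≤ A := (div_pos hT (hpos x₀ hx₀)).le.trans (le_csSup hbdd (mem_image_of_mem _ hx₀))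
  obtain ⟨Z, hZ0, hZA, hZS, hZ⟩ := hup _ hν n hn A hAx
  have hmem : Z.card ∈ {N : ℕ | 0 < N ∧ ∃ Z : Finset (EuclideanSpace ℝ (Fin d)), Z.card = N ∧
      (↑Z : Set (EuclideanSpace ℝ (Fin d))) ⊆ unitSphere d ∧
      ∀ P : MvPolynomial (Fin d) ℝ, P.totalDegree ≤ n →
        (1 / wMass w (unitSphere d)) * (∫ x, pEval P x * w x ∂(sphMeasure d))
          = (1 / (N : ℝ)) * ∑ z ∈ Z, pEval P z} :=
    ⟨hZ0, Z, rfl, hZS, fun P hP => by rw [← hZ P hP, integral_weightMeasure hw hi]⟩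
  constructor
  · obtain ⟨hN0, Y, hYN, hYS, hY⟩ := Nat.sInf_mem ⟨_, hmem⟩
    change 0 < minCubNodes d w n at hN0
    change Y.card = minCubNodes d w n at hYN
    have hlow' := hlow _ hν n hn Y (hYN ▸ hN0) hYS fun P hP => by
      rw [integral_weightMeasure hw hi, hY P hP, hYN]
      rfl
    rw [one_div_mul_eq_div, div_le_iff₀ (by positivity)]
    refine csSup_le ⟨_, mem_image_of_mem _ hx₀⟩ ?_
    rintro _ ⟨x, hx, rfl⟩
    have h := hlow' x hx
    rw [hYN] at h
    rw [div_le_iff₀ (hpos x hx)]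
    calc T ≤ T * (C₁ * minCubNodes d w n * (weightMeasure w).real (Metric.closedBall x (1 / n))) :=
          le_mul_of_one_le_right hT.le h
      _ = C₁ * minCubNodes d w n * (T * (weightMeasure w).real (Metric.closedBall x (1 / n))) := by
          ring
      _ ≤ C₁ * minCubNodes d w n * (M * wMass w (cap x (1 / n))) := 
          mul_le_mul_of_nonneg_left (hball x hx) (by positivity)
      _ = _ := by ring
  · calc (minCubNodes d w n : ℝ) ≤ Z.card := by exact_mod_cast Nat.sInf_le hmem
      _ ≤ C₂ * A := hZA
      _ ≤ _ := by gcongr; exact le_max_right _ _
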